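/- For each α > 0 the limit L(α) = lim_{n→∞} det[P_n (I + H(ψ_{α,n}))^{−1} P_n] (taken over n > α/π) exists and is a positive real number, and lim_{α→∞} ( log L(2α) + (log α)/4 ) = (log 2)/12 + 3ζ'(−1), where ζ'(−1) is the derivative of the Riemann zeta function at −1. -/

import Mathlib

open Filter MeasureTheory
open scoped InnerProductSpace

noncomputable section

/-- ℓ²(ℕ) over ℂ. -/
abbrev l2 : Type := lp (fun _ : ℕ => ℂ) 2

/-- The `k`-th Fourier coefficient of a function on the unit circle, given as a
`2π`-periodic function of the angle: `a_k = (1/(2π)) ∫_0^{2π} f(θ) e^{-ikθ} dθ`. -/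
def fc (f : ℝ → ℂ) (k : ℤ) : ℂ :=
  ((1 / (2 * Real.pi) : ℝ) : ℂ) *
    ∫ θ in (0:ℝ)..(2 * Real.pi), f θ * Complex.exp (-(Complex.I * k * θ))

/-- The standard orthonormal basis vector `e_j` of ℓ²(ℕ). -/
def ee (j : ℕ) : l2 := lp.single 2 j 1

/-- Matrix entry `⟨e_j, A e_k⟩` of an operator on ℓ²(ℕ). -/
def ent (A : l2 →L[ℂ] l2) (j k : ℕ) : ℂ := ⟪ee j, A (ee k)⟫_ℂ

/-- The determinant of the `n × n` section `Pₙ A Pₙ` of an operator on ℓ²(ℕ). -/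
def detP (n : ℕ) (A : l2 →L[ℂ] l2) : ℂ := (Matrix.of fun j k : Fin n => ent A j k).det

/-- The function `χ` on the circle: `χ(e^{iθ}) = i` for `0 < θ < π` and
`χ(e^{iθ}) = −i` for `−π < θ < 0`. -/
def chi (θ : ℝ) : ℂ := if 0 < Real.sin θ then Complex.I else -Complex.I

/-- Remainder terms of the Euler–Maclaurin approximation to `(s-1)ζ(s)`. -/
def emTail (x : ℝ) (s : ℂ) : ℂ :=
  (x : ℂ) ^ (1 - s) - (s - 1) / 2 * (x : ℂ) ^ (-s) + s * (s - 1) / 12 * (x : ℂ) ^ (-s - 1)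

/-- Consecutive differences of the Euler–Maclaurin approximations. -/
def emDiff (n : ℕ) (s : ℂ) : ℂ :=
  (s - 1) * (((n : ℝ) + 1 + 1 : ℝ) : ℂ) ^ (-s) + emTail ((n : ℝ) + 1 + 1) s - emTail ((n : ℝ) + 1) s

lemma hasDerivAt_add_cpow {x t : ℝ} (h : 0 < x + t) (r : ℂ) :
    HasDerivAt (fun t : ℝ => ((x + t : ℝ) : ℂ) ^ r) (r * ((x + t : ℝ) : ℂ) ^ (r - 1)) t := by
  have h1 : HasDerivAt (fun z : ℂ => ((x : ℂ) + z) ^ r)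
      (r * ((x : ℂ) + (t : ℂ)) ^ (r - 1) * 1) (t : ℂ) := by
    apply HasDerivAt.cpow_const
    · simpa using (hasDerivAt_id (t : ℂ)).const_add (x : ℂ)
    · left; simpa using h
  have h2 := h1.comp_ofReal
  simpa using h2

lemma norm_emDiff_le (n : ℕ) {s : ℂ} (hs : -3 ≤ s.re) :
    ‖emDiff n s‖ ≤ ‖s - 1‖ * ‖s‖ * ‖s + 1‖ * ‖s + 2‖ * ((n : ℝ) + 1) ^ (-s.re - 3) := by
  set x : ℝ := (n : ℝ) + 1 with hx
  have hx0 : 0 < x := by positivity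
  let Φ : ℝ → ℂ := fun t =>
    (s - 1) * (((t ^ 3 / 6 - t ^ 2 / 4 + t / 12 : ℝ) : ℂ)) * (s * (s + 1) * ((x + t : ℝ) : ℂ) ^ (-s - 2))
    - (s - 1) * (((t ^ 2 / 2 - t / 2 + 1 / 12 : ℝ) : ℂ)) * (-s * ((x + t : ℝ) : ℂ) ^ (-s - 1))
    + (s - 1) * (((t - 1 / 2 : ℝ) : ℂ)) * ((x + t : ℝ) : ℂ) ^ (-s) + ((x + t : ℝ) : ℂ) ^ (1 - s)
  have hΦ : emDiff n s = Φ 1 - Φ 0 := by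
    simp only [emDiff, emTail, Φ, ← hx]
    push_cast
    simp only [add_zero]
    ring
  rw [hΦ]
  apply norm_image_sub_le_of_norm_deriv_le_segment_01'
    (f' := fun t : ℝ => (s - 1) * (((t ^ 3 / 6 - t ^ 2 / 4 + t / 12 : ℝ) : ℂ)) *
      (s * (s + 1) * ((-s - 2) * ((x + t : ℝ) : ℂ) ^ (-s - 3))))
  · intro t ht
    have hxt : 0 < x + t := by linarith [ht.1]
    have e1 := hasDerivAt_add_cpow hxt (-s - 2)
    have e2 := hasDerivAt_add_cpow hxt (-s - 1)
    have e3 := hasDerivAt_add_cpow hxt (-s)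
    have e4 := hasDerivAt_add_cpow hxt (1 - s)
    have p1 : HasDerivAt (fun t : ℝ => ((t ^ 3 / 6 - t ^ 2 / 4 + t / 12 : ℝ) : ℂ))
        ((t ^ 2 / 2 - t / 2 + 1 / 12 : ℝ) : ℂ) t := by
      apply HasDerivAt.ofReal_comp
      refine ((((hasDerivAt_pow 3 t).div_const 6).sub ((hasDerivAt_pow 2 t).div_const 4)).add
        ((hasDerivAt_id t).div_const 12)).congr_deriv ?_
      norm_num; ring
    have p2 : HasDerivAt (fun t : ℝ => ((t ^ 2 / 2 - t / 2 + 1 / 12 : ℝ) : ℂ))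
        ((t - 1 / 2 : ℝ) : ℂ) t := by
      apply HasDerivAt.ofReal_comp
      refine ((((hasDerivAt_pow 2 t).div_const 2).sub ((hasDerivAt_id t).div_const 2)).add_const
        (1 / 12)).congr_deriv ?_
      norm_num
    have p3 : HasDerivAt (fun t : ℝ => ((t - 1 / 2 : ℝ) : ℂ)) ((1 : ℝ) : ℂ) t := by
      apply HasDerivAt.ofReal_comp
      exact (hasDerivAt_id t).sub_const _
    have := ((((p1.const_mul (s - 1)).mul (e1.const_mul (s * (s + 1)))).sub
      ((p2.const_mul (s - 1)).mul (e2.const_mul (-s)))).add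
      ((p3.const_mul (s - 1)).mul e3)).add e4
    refine HasDerivAt.hasDerivWithinAt (this.congr_deriv ?_)
    rw [show -s - 2 - 1 = -s - 3 by ring, show -s - 1 - 1 = -s - 2 by ring,
      show 1 - s - 1 = -s by ring]
    push_cast
    ring
  · intro t ht
    have hxt : 0 < x + t := by linarith [ht.1]
    have hP : ‖(((t ^ 3 / 6 - t ^ 2 / 4 + t / 12 : ℝ) : ℂ))‖ ≤ 1 := by
      rw [Complex.norm_real, Real.norm_eq_abs, abs_le]
      have := ht.1; have := ht.2
      constructor <;> nlinarith [pow_nonneg ht.1 2, pow_nonneg ht.1 3, pow_le_one₀ (n := 3) ht.1 ht.2.le,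
        pow_le_one₀ (n := 2) ht.1 ht.2.le]
    have hc : ‖((x + t : ℝ) : ℂ) ^ (-s - 3)‖ ≤ x ^ (-s.re - 3) := by
      rw [Complex.norm_cpow_eq_rpow_re_of_pos hxt]
      simp only [Complex.sub_re, Complex.neg_re, Complex.re_ofNat]
      apply Real.rpow_le_rpow_of_nonpos hx0 (by linarith [ht.1]) (by linarith)
    have h2 : ‖-s - 2‖ = ‖s + 2‖ := by rw [← norm_neg]; congr 1; ring
    simp only [norm_mul, h2]
    calc _ ≤ ‖s - 1‖ * 1 * (‖s‖ * ‖s + 1‖ * (‖s + 2‖ * x ^ (-s.re - 3))) := by gcongr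
      _ = _ := by ring

/-- Euler–Maclaurin approximation to `(s-1)ζ(s)`. -/
def emApprox (n : ℕ) (s : ℂ) : ℂ :=
  (s - 1) * ∑ k ∈ Finset.range (n + 1), (((k : ℝ) + 1 : ℝ) : ℂ) ^ (-s) + emTail ((n : ℝ) + 1) s

lemma emApprox_eq (n : ℕ) (s : ℂ) :
    emApprox n s = emApprox 0 s + ∑ k ∈ Finset.range n, emDiff k s := by
  induction n with
  | zero => simp
  | succ n ih =>
    rw [Finset.sum_range_succ, ← add_assoc, ← ih]
    simp only [emApprox, emDiff]
    rw [Finset.sum_range_succ _ (n + 1)]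
    push_cast
    ring

/-- The region on which the approximations converge uniformly. -/
def emDisk : Set ℂ := Metric.ball 2 (17 / 5)

lemma emDisk_re {s : ℂ} (hs : s ∈ emDisk) : -(7 / 5) < s.re := by
  have h1 := Complex.abs_re_le_norm (s - 2)
  have h2 : ‖s - 2‖ < 17 / 5 := by simpa [emDisk, dist_eq_norm] using hs
  have := (abs_le.1 h1).1
  simp at this
  linarith

lemma norm_emDiff_le' (n : ℕ) (s : ℂ) (hs : s ∈ emDisk) :
    ‖emDiff n s‖ ≤ 10 ^ 4 * ((n : ℝ) + 1) ^ (-(8 / 5 : ℝ)) := by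
  have hre := emDisk_re hs
  refine (norm_emDiff_le n (by linarith)).trans ?_
  have h2 : ‖s - 2‖ < 17 / 5 := by simpa [emDisk, dist_eq_norm] using hs
  have a1 : ‖s - 1‖ ≤ 10 := by
    calc ‖s - 1‖ = ‖(s - 2) + 1‖ := by ring_nf
      _ ≤ ‖s - 2‖ + ‖(1 : ℂ)‖ := norm_add_le _ _
      _ ≤ _ := by norm_num; linarith
  have a2 : ‖s‖ ≤ 10 := by
    calc ‖s‖ = ‖(s - 2) + 2‖ := by ring_nf
      _ ≤ ‖s - 2‖ + ‖(2 : ℂ)‖ := norm_add_le _ _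
      _ ≤ _ := by norm_num; linarith
  have a3 : ‖s + 1‖ ≤ 10 := by
    calc ‖s + 1‖ = ‖(s - 2) + 3‖ := by ring_nf
      _ ≤ ‖s - 2‖ + ‖(3 : ℂ)‖ := norm_add_le _ _
      _ ≤ _ := by norm_num; linarith
  have a4 : ‖s + 2‖ ≤ 10 := by
    calc ‖s + 2‖ = ‖(s - 2) + 4‖ := by ring_nf
      _ ≤ ‖s - 2‖ + ‖(4 : ℂ)‖ := norm_add_le _ _
      _ ≤ _ := by norm_num; linarith
  have a5 : ((n : ℝ) + 1) ^ (-s.re - 3) ≤ ((n : ℝ) + 1) ^ (-(8 / 5 : ℝ)) := by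
    apply Real.rpow_le_rpow_of_exponent_le
    · have : (0 : ℝ) ≤ n := by positivity
      linarith
    · linarith
  calc _ ≤ 10 * 10 * 10 * 10 * ((n : ℝ) + 1) ^ (-(8 / 5 : ℝ)) := by gcongr
    _ = _ := by norm_num

lemma summable_emBound : Summable (fun n : ℕ => 10 ^ 4 * ((n : ℝ) + 1) ^ (-(8 / 5 : ℝ))) := by
  apply Summable.mul_left
  have := (Real.summable_nat_rpow (p := -(8 / 5 : ℝ))).2 (by norm_num)
  have h2 := (summable_nat_add_iff 1).2 this
  simpa using h2

lemma differentiable_emTail {x : ℝ} (hx : 0 < x) : Differentiable ℂ (emTail x) := by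
  have hx' : (x : ℂ) ≠ 0 := by exact_mod_cast hx.ne'
  intro s
  unfold emTail
  refine ((DifferentiableAt.const_cpow (by fun_prop) (Or.inl hx')).sub (DifferentiableAt.mul (by fun_prop)
    (DifferentiableAt.const_cpow (by fun_prop) (Or.inl hx')))).add (DifferentiableAt.mul (by fun_prop)
    (DifferentiableAt.const_cpow (by fun_prop) (Or.inl hx')))

lemma differentiable_emDiff (n : ℕ) : Differentiable ℂ (emDiff n) := by
  have h1 : (0 : ℝ) < n + 1 := by positivity
  have h2 : (0 : ℝ) < (n : ℝ) + 1 + 1 := by positivity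
  have hx' : (((n : ℝ) + 1 + 1 : ℝ) : ℂ) ≠ 0 := by exact_mod_cast h2.ne'
  intro s
  exact ((DifferentiableAt.mul (by fun_prop)
    (DifferentiableAt.const_cpow (by fun_prop) (Or.inl hx'))).add
    (differentiable_emTail h2 s)).sub (differentiable_emTail h1 s)

lemma differentiable_emApprox (n : ℕ) : Differentiable ℂ (emApprox n) := by
  have h1 : (0 : ℝ) < n + 1 := by positivity
  intro s
  refine (DifferentiableAt.mul (by fun_prop) (DifferentiableAt.fun_sum ?_)).add
    (differentiable_emTail h1 s)
  intro k _
  have hx' : (((k : ℝ) + 1 : ℝ) : ℂ) ≠ 0 := by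
    have : (0 : ℝ) < k + 1 := by positivity
    exact_mod_cast this.ne'
  exact DifferentiableAt.const_cpow (by fun_prop) (Or.inl hx')

/-- The limit of the Euler–Maclaurin approximations. -/
def emLim (s : ℂ) : ℂ := emApprox 0 s + ∑' n, emDiff n s

lemma differentiableOn_emLim : DifferentiableOn ℂ emLim emDisk :=
  (differentiable_emApprox 0).differentiableOn.add
    (Complex.differentiableOn_tsum_of_summable_norm summable_emBound
      (fun n => (differentiable_emDiff n).differentiableOn) Metric.isOpen_ball norm_emDiff_le')

lemma tendsto_emApprox {s : ℂ} (hs : s ∈ emDisk) :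
    Tendsto (fun n => emApprox n s) atTop (nhds (emLim s)) := by
  have : Summable fun n => emDiff n s :=
    Summable.of_norm_bounded summable_emBound (fun n => norm_emDiff_le' n s hs)
  rw [show (fun n => emApprox n s) = _ from funext fun n => emApprox_eq n s]
  exact this.hasSum.tendsto_sum_nat.const_add _

lemma tendsto_deriv_emApprox {s : ℂ} (hs : s ∈ emDisk) :
    Tendsto (fun n => deriv (emApprox n) s) atTop (nhds (deriv emLim s)) := by
  have h := Complex.hasSum_deriv_of_summable_norm summable_emBound
      (fun n => (differentiable_emDiff n).differentiableOn) Metric.isOpen_ball norm_emDiff_le' hs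
  have h0 : ∀ n, deriv (emApprox n) s
      = deriv (emApprox 0) s + ∑ k ∈ Finset.range n, deriv (emDiff k) s := by
    intro n
    have : emApprox n = fun s => emApprox 0 s + ∑ k ∈ Finset.range n, emDiff k s :=
      funext (emApprox_eq n)
    rw [this, deriv_fun_add (differentiable_emApprox 0 s)
      (DifferentiableAt.fun_sum fun k _ => differentiable_emDiff k s),
      deriv_fun_sum fun k _ => differentiable_emDiff k s]
  have h1 : deriv emLim s = deriv (emApprox 0) s + deriv (fun w => ∑' n, emDiff n w) s := by
    refine deriv_fun_add (differentiable_emApprox 0 s) ?_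
    exact (Complex.differentiableOn_tsum_of_summable_norm summable_emBound
      (fun n => (differentiable_emDiff n).differentiableOn) Metric.isOpen_ball
      norm_emDiff_le').differentiableAt (Metric.isOpen_ball.mem_nhds hs)
  rw [h1, funext h0]
  exact h.tendsto_sum_nat.const_add _

lemma tendsto_cpow_zero {r : ℂ} (hr : r.re < 0) :
    Tendsto (fun n : ℕ => (((n : ℝ) + 1 : ℝ) : ℂ) ^ r) atTop (nhds 0) := by
  rw [tendsto_zero_iff_norm_tendsto_zero]
  have : ∀ n : ℕ, ‖(((n : ℝ) + 1 : ℝ) : ℂ) ^ r‖ = ((n : ℝ) + 1) ^ (-(-r.re)) := by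
    intro n
    rw [Complex.norm_cpow_eq_rpow_re_of_pos (by positivity), neg_neg]
  simp_rw [this]
  exact (tendsto_rpow_neg_atTop (by linarith : 0 < -r.re)).comp
    (tendsto_atTop_add_const_right _ _ tendsto_natCast_atTop_atTop)

lemma emLim_eq_of_one_lt {s : ℂ} (hs : s ∈ emDisk) (h1 : 1 < s.re) :
    emLim s = (s - 1) * riemannZeta s := by
  refine tendsto_nhds_unique (tendsto_emApprox hs) ?_
  have e1 := tendsto_cpow_zero (r := 1 - s) (by simp; linarith)
  have e2 := tendsto_cpow_zero (r := -s) (by simp; linarith)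
  have e3 := tendsto_cpow_zero (r := -s - 1) (by simp; linarith)
  have hsum : Summable fun n : ℕ => 1 / ((n : ℂ) + 1) ^ s := by
    have := (summable_nat_add_iff 1).2 (Complex.summable_one_div_nat_cpow.2 h1)
    simpa using this
  have e4 := (tendsto_add_atTop_iff_nat 1).2 hsum.hasSum.tendsto_sum_nat
  rw [← zeta_eq_tsum_one_div_nat_add_one_cpow h1] at e4
  have := (e4.const_mul (s - 1)).add ((e1.sub (e2.const_mul ((s - 1) / 2))).add
    (e3.const_mul (s * (s - 1) / 12)))
  simp only [mul_zero, sub_zero, add_zero] at this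
  refine this.congr fun n => ?_
  simp only [emApprox, emTail]
  congr 2
  refine Finset.sum_congr rfl fun k _ => ?_
  rw [Complex.cpow_neg, one_div]; push_cast; rfl

lemma emLim_eqOn : Set.EqOn emLim (DirichletCharacter.LFunctionTrivChar₁ 1) emDisk := by
  have hpre : IsPreconnected emDisk := (convex_ball _ _).isPreconnected
  have h2 : (2 : ℂ) ∈ emDisk := by simp [emDisk]
  refine AnalyticOnNhd.eqOn_of_preconnected_of_eventuallyEq
    (differentiableOn_emLim.analyticOnNhd Metric.isOpen_ball)
    ((DirichletCharacter.differentiable_LFunctionTrivChar₁ 1).differentiableOn.analyticOnNhd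
      Metric.isOpen_ball) hpre h2 ?_
  have hO : IsOpen {s : ℂ | 1 < s.re} := isOpen_lt continuous_const Complex.continuous_re
  filter_upwards [Metric.isOpen_ball.mem_nhds h2, hO.mem_nhds (by simp : (2 : ℂ) ∈ {s : ℂ | 1 < s.re})]
    with s hs h1
  rw [emLim_eq_of_one_lt hs h1, DirichletCharacter.LFunctionTrivChar₁, Function.update_of_ne]
  · simp [DirichletCharacter.LFunctionTrivChar, DirichletCharacter.LFunction_modOne_eq]
  · rintro rfl; simp at h1

lemma hasDerivAt_emTail {x : ℝ} (hx : 0 < x) :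
    HasDerivAt (emTail x) (-(x ^ 2 * Real.log x : ℝ) + (-x / 2 - x * Real.log x : ℝ)
      + (-1 / 4 - Real.log x / 6 : ℝ) : ℂ) (-1) := by
  have hx' : (x : ℂ) ≠ 0 := by exact_mod_cast hx.ne'
  have e1 : HasDerivAt (fun s : ℂ => (x : ℂ) ^ (1 - s))
      ((x : ℂ) ^ (1 - (-1) : ℂ) * Complex.log x * (-1)) (-1) :=
    ((hasDerivAt_id (-1 : ℂ)).const_sub 1).const_cpow (Or.inl hx')
  have e2 : HasDerivAt (fun s : ℂ => (x : ℂ) ^ (-s))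
      ((x : ℂ) ^ (-(-1) : ℂ) * Complex.log x * (-1)) (-1) :=
    ((hasDerivAt_id (-1 : ℂ)).neg).const_cpow (Or.inl hx')
  have e3 : HasDerivAt (fun s : ℂ => (x : ℂ) ^ (-s - 1))
      ((x : ℂ) ^ (-(-1) - 1 : ℂ) * Complex.log x * (-1)) (-1) :=
    (((hasDerivAt_id (-1 : ℂ)).neg).sub_const 1).const_cpow (Or.inl hx')
  have p2 : HasDerivAt (fun s : ℂ => (s - 1) / 2) (1 / 2) (-1) :=
    ((hasDerivAt_id (-1 : ℂ)).sub_const 1).div_const 2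
  have p3 : HasDerivAt (fun s : ℂ => s * (s - 1) / 12) ((1 * (-1 - 1) + (-1) * 1) / 12) (-1) :=
    ((hasDerivAt_id (-1 : ℂ)).mul ((hasDerivAt_id (-1 : ℂ)).sub_const 1)).div_const 12
  have := (e1.sub (p2.mul e2)).add (p3.mul e3)
  refine this.congr_deriv ?_
  rw [← Complex.ofReal_log hx.le]
  norm_num
  ring

/-- The constant `ζ'(-1)` as a limit: the Glaisher–Kinkelin asymptotics. -/
theorem tendsto_glaisher :
    Tendsto (fun n : ℕ => -∑ k ∈ Finset.range (n + 1), ((k : ℝ) + 1) * Real.log (k + 1)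
      + ((n : ℝ) + 1) ^ 2 * (Real.log (n + 1) / 2 - 1 / 4) + ((n : ℝ) + 1) * Real.log (n + 1) / 2
      + (1 + Real.log (n + 1)) / 12) atTop (nhds (deriv riemannZeta (-1)).re) := by
  have hm : (-1 : ℂ) ∈ emDisk := by
    simp only [emDisk, Metric.mem_ball, dist_eq_norm]; norm_num
  have t1 := tendsto_deriv_emApprox hm
  have t0 := tendsto_emApprox hm
  have hd : deriv emLim (-1) = -2 * deriv riemannZeta (-1) + riemannZeta (-1) := by
    have : emLim =ᶠ[nhds (-1)] DirichletCharacter.LFunctionTrivChar₁ 1 :=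
      emLim_eqOn.eventuallyEq_of_mem (Metric.isOpen_ball.mem_nhds hm)
    rw [this.deriv_eq, DirichletCharacter.deriv_LFunctionTrivChar₁_apply_of_ne_one _ (by norm_num)]
    simp only [DirichletCharacter.LFunctionTrivChar, DirichletCharacter.LFunction_modOne_eq]
    norm_num
  have h0 : emLim (-1) = -2 * riemannZeta (-1) := by
    rw [emLim_eqOn hm, DirichletCharacter.LFunctionTrivChar₁, Function.update_of_ne (by norm_num)]
    simp only [DirichletCharacter.LFunctionTrivChar, DirichletCharacter.LFunction_modOne_eq]
    norm_num
  rw [hd] at t1; rw [h0] at t0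
  have t2 := (t1.const_mul (-1 / 2 : ℂ)).sub (t0.const_mul (1 / 4 : ℂ))
  have e : -1 / 2 * (-2 * deriv riemannZeta (-1) + riemannZeta (-1)) -
      1 / 4 * (-2 * riemannZeta (-1)) = deriv riemannZeta (-1) := by ring
  rw [e] at t2
  have t3 := (Complex.continuous_re.tendsto _).comp t2
  refine t3.congr fun n => ?_
  have hx : (0 : ℝ) < n + 1 := by positivity
  have hder : deriv (emApprox n) (-1) = 1 * (∑ k ∈ Finset.range (n + 1), (((k : ℝ) + 1 : ℝ) : ℂ) ^ (-(-1) : ℂ))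
      + (-1 - 1) * (∑ k ∈ Finset.range (n + 1), (((k : ℝ) + 1 : ℝ) : ℂ) ^ (-(-1) : ℂ) *
        Complex.log (((k : ℝ) + 1 : ℝ) : ℂ) * (-1)) +
      (-(((n : ℝ) + 1) ^ 2 * Real.log ((n : ℝ) + 1) : ℝ) + (-((n : ℝ) + 1) / 2 - ((n : ℝ) + 1) * Real.log ((n : ℝ) + 1) : ℝ)
      + (-1 / 4 - Real.log ((n : ℝ) + 1) / 6 : ℝ) : ℂ) := by
    apply HasDerivAt.deriv
    refine HasDerivAt.add (HasDerivAt.mul ((hasDerivAt_id (-1 : ℂ)).sub_const 1)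
      (HasDerivAt.fun_sum (u := Finset.range (n + 1))
        (A := fun (k : ℕ) (s : ℂ) => (((k : ℝ) + 1 : ℝ) : ℂ) ^ (-s)) ?_)) (hasDerivAt_emTail hx)
    intro k _
    have hx' : (((k : ℝ) + 1 : ℝ) : ℂ) ≠ 0 := by
      have : (0 : ℝ) < k + 1 := by positivity
      exact_mod_cast this.ne'
    exact ((hasDerivAt_id (-1 : ℂ)).neg).const_cpow (Or.inl hx')
  have hval : emApprox n (-1) = (-2) * (∑ k ∈ Finset.range (n + 1), (((k : ℝ) + 1 : ℝ) : ℂ))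
      + ((((n : ℝ) + 1) ^ 2 + ((n : ℝ) + 1) + 1 / 6 : ℝ) : ℂ) := by
    simp only [emApprox, emTail]
    norm_num
    ring
  have hlog : ∀ k ∈ Finset.range (n + 1), (((k : ℝ) + 1 : ℝ) : ℂ) ^ (-(-1) : ℂ) *
        Complex.log (((k : ℝ) + 1 : ℝ) : ℂ) * (-1) = ((-(((k : ℝ) + 1) * Real.log (k + 1)) : ℝ) : ℂ) := by
    intro k _
    rw [← Complex.ofReal_log (by positivity)]
    simp
  simp only [Function.comp]
  rw [hder, hval, Finset.sum_congr rfl hlog]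
  simp only [neg_neg, Complex.cpow_one]
  rw [← Complex.ofReal_sum, ← Complex.ofReal_sum, ← Complex.ofReal_re (-_ + _ + _ + _)]
  congr 1
  rw [Finset.sum_neg_distrib]
  push_cast
  ring

/-- First-order Stirling correction. -/
lemma tendsto_stirling_correction :
    Tendsto (fun n : ℕ => (n : ℝ) * (Real.log (Stirling.stirlingSeq n) - Real.log (√Real.pi)))
      atTop (nhds (1 / 12)) := by
  have hlim : Tendsto (fun n : ℕ => Real.log (Stirling.stirlingSeq (n + 1))) atTop
      (nhds (Real.log (√Real.pi))) :=
    (((Real.continuousAt_log (by positivity)).tendsto.comp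
      Stirling.tendsto_stirlingSeq_sqrt_pi)).comp (tendsto_add_atTop_nat 1)
  have hinv : ∀ c : ℝ, Tendsto (fun n : ℕ => 1 / (12 * ((n : ℝ) + c))) atTop (nhds 0) := by
    intro c
    have : Tendsto (fun n : ℕ => 12 * ((n : ℝ) + c)) atTop atTop :=
      (tendsto_atTop_add_const_right _ _ tendsto_natCast_atTop_atTop).const_mul_atTop (by norm_num)
    simp only [one_div]
    exact this.inv_tendsto_atTop
  have hup : ∀ n : ℕ, Real.log (Stirling.stirlingSeq (n + 1)) - 1 / (12 * ((n : ℝ) + 1))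
      ≤ Real.log (√Real.pi) := by
    have hm : Monotone fun n : ℕ =>
        Real.log (Stirling.stirlingSeq (n + 1)) - 1 / (12 * ((n : ℝ) + 1)) := by
      refine monotone_nat_of_le_succ fun n => ?_
      have h := Stirling.log_stirlingSeq_sdiff_le (n + 1)
      have e : (1 : ℝ) / (12 * ((n + 1 : ℕ) : ℝ) * (((n + 1 : ℕ) : ℝ) + 1))
          = 1 / (12 * ((n : ℝ) + 1)) - 1 / (12 * (((n + 1 : ℕ) : ℝ) + 1)) := by
        push_cast
        field_simp
        ring
      rw [e] at h
      linarith
    have h2 := hlim.sub (hinv 1)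
    rw [sub_zero] at h2
    exact fun n => hm.ge_of_tendsto h2 n
  have hlo : ∀ n : ℕ, Real.log (√Real.pi) ≤
      Real.log (Stirling.stirlingSeq (n + 1)) - 1 / (12 * ((n : ℝ) + 3 / 2)) := by
    have hm : Antitone fun n : ℕ =>
        Real.log (Stirling.stirlingSeq (n + 1)) - 1 / (12 * ((n : ℝ) + 3 / 2)) := by
      refine antitone_nat_of_succ_le fun n => ?_
      have h := (Stirling.log_stirlingSeq_sdiff_hasSum n)

      have h1 := sum_le_hasSum (Finset.range 1) (fun k _ => by positivity) h
      simp only [Finset.sum_range_one] at h1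
      have e : 1 / (12 * ((n : ℝ) + 3 / 2)) - 1 / (12 * (((n + 1 : ℕ) : ℝ) + 3 / 2))
        ≤ (1 : ℝ) / (2 * ((0 + 1 : ℕ) : ℝ) + 1) * ((1 / (2 * ((n + 1 : ℕ) : ℝ) + 1)) ^ 2) ^ (0 + 1) := by
        push_cast
        have hn : (0 : ℝ) ≤ n := by positivity
        rw [div_sub_div _ _ (by positivity) (by positivity)]
        rw [pow_one, div_pow, one_pow, div_mul_div_comm,
          div_le_div_iff₀ (by positivity) (by positivity)]
        nlinarith
      have e2 : n + 1 + 1 = n + 2 := rfl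
      rw [e2]
      linarith
    have h2 := hlim.sub (hinv (3 / 2))
    rw [sub_zero] at h2
    exact fun n => hm.le_of_tendsto h2 n
  rw [← tendsto_add_atTop_iff_nat 1]
  refine tendsto_of_tendsto_of_tendsto_of_le_of_le (g := fun n : ℕ => 1 / 12 - 1 / 2 * (1 / (12 * ((n : ℝ) + 3 / 2))))
    (h := fun _ => 1 / 12) ?_ tendsto_const_nhds ?_ ?_
  · simpa only [mul_zero, sub_zero] using ((hinv (3 / 2)).const_mul (1 / 2)).const_sub (1 / 12)
  · intro n
    have h := hlo n
    have hn : (0 : ℝ) ≤ n := by positivity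
    have : (1 : ℝ) / 12 - 1 / 2 * (1 / (12 * ((n : ℝ) + 3 / 2))) = ((n : ℝ) + 1) * (1 / (12 * ((n : ℝ) + 3 / 2))) := by
      field_simp; ring
    simp only [this]
    push_cast
    gcongr
    linarith
  · intro n
    have h := hup n
    have hn : (0 : ℝ) ≤ n := by positivity
    have : (1 : ℝ) / 12 = ((n : ℝ) + 1) * (1 / (12 * ((n : ℝ) + 1))) := by
      field_simp
    simp only [this]
    push_cast
    gcongr
    linarith

/-- `log ∏_{i<n} i!`. -/
def logSuperfactorial (n : ℕ) : ℝ := ∑ i ∈ Finset.range n, Real.log (i.factorial : ℝ)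

lemma logSuperfactorial_eq (n : ℕ) : logSuperfactorial n =
    n * Real.log (n.factorial : ℝ) - ∑ k ∈ Finset.range n, ((k : ℝ) + 1) * Real.log (k + 1) := by
  induction n with
  | zero => simp [logSuperfactorial]
  | succ n ih =>
    unfold logSuperfactorial at ih ⊢
    rw [Finset.sum_range_succ, Finset.sum_range_succ, ih, Nat.factorial_succ, Nat.cast_mul,
      Real.log_mul (by positivity) (by positivity)]
    push_cast
    ring

/-- The discrepancy of `logSuperfactorial` from its elementary main terms. -/
def superfactorialError (n : ℕ) : ℝ :=
  logSuperfactorial n - ((n : ℝ) ^ 2 * Real.log n / 2 - 3 / 4 * n ^ 2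
    + n * Real.log (2 * Real.pi) / 2 - (1 + Real.log n) / 12)

lemma tendsto_superfactorialError : Tendsto superfactorialError atTop
    (nhds (1 / 12 + (deriv riemannZeta (-1)).re)) := by
  rw [← tendsto_add_atTop_iff_nat 1]
  have h1 := (tendsto_add_atTop_iff_nat 1).2 tendsto_stirling_correction
  refine (h1.add tendsto_glaisher).congr fun n => ?_
  unfold superfactorialError
  rw [logSuperfactorial_eq, Stirling.log_stirlingSeq_formula, Real.log_div (by positivity) (by positivity),
    Real.log_exp, Real.log_sqrt (by positivity), Real.log_mul (by norm_num) (by positivity),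
    Real.log_mul (by norm_num) (by positivity)]
  push_cast
  ring

/-- The logarithm of the Legendre Hankel determinant in terms of superfactorials. -/
def logLegendre (n : ℕ) : ℝ :=
  n * Real.log (2 / Real.pi) + 2 * n * (n - 1) * Real.log 2
    + 4 * logSuperfactorial n - logSuperfactorial (2 * n)

theorem tendsto_logLegendre : Tendsto (fun n : ℕ => logLegendre n + Real.log n / 4) atTop
    (nhds (Real.log 2 / 12 + 3 * (deriv riemannZeta (-1)).re)) := by
  have h1 := tendsto_superfactorialError
  have h2 : Tendsto (fun n : ℕ => superfactorialError (2 * n)) atTop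
      (nhds (1 / 12 + (deriv riemannZeta (-1)).re)) :=
    h1.comp (tendsto_id.const_mul_atTop' (by norm_num))
  have h3 := ((h1.const_mul 4).sub h2).add_const (-1 / 4 + Real.log 2 / 12)
  have e : 4 * (1 / 12 + (deriv riemannZeta (-1)).re) - (1 / 12 + (deriv riemannZeta (-1)).re) +
    (-1 / 4 + Real.log 2 / 12) = Real.log 2 / 12 + 3 * (deriv riemannZeta (-1)).re := by ring
  rw [e] at h3
  refine h3.congr' ?_
  filter_upwards [eventually_gt_atTop 0] with n hn
  have hn' : (0 : ℝ) < n := by exact_mod_cast hn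
  unfold superfactorialError logLegendre
  push_cast
  rw [Real.log_mul (by norm_num) hn'.ne', Real.log_mul (by norm_num) Real.pi_ne_zero,
    Real.log_div (by norm_num) Real.pi_ne_zero]
  ring

lemma cauchy_det_succ {K : Type*} [Field K] (n : ℕ) (y x : ℕ → K)
    (h : ∀ i < n + 1, ∀ j < n + 1, y i ≠ x j) :
    (Matrix.of fun i j : Fin (n + 1) => 1 / (y i - x j)).det =
      (Matrix.of fun i j : Fin n => 1 / (y i - x j)).det *
      (1 / (y n - x n) * ∏ i : Fin n,
        (((y i - y n) / (y i - x n)) * ((x n - x i) / (y n - x i)))) := by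
  have hne : ∀ i j : Fin n, y i - x j ≠ 0 := fun i j => sub_ne_zero.2 (h i (by omega) j (by omega))
  have hne2 : ∀ i : Fin n, y i - x n ≠ 0 := fun i => sub_ne_zero.2 (h i (by omega) n (by omega))
  have hne3 : ∀ j : Fin n, y n - x j ≠ 0 := fun j => sub_ne_zero.2 (h n (by omega) j (by omega))
  have hne4 : y n - x n ≠ 0 := sub_ne_zero.2 (h n (by omega) n (by omega))
  have hD : IsUnit (Matrix.of fun _ _ : Fin 1 => 1 / (y n - x n)) := by
    rw [Matrix.isUnit_iff_isUnit_det]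
    simpa using hne4
  have hD' : (Matrix.of fun _ _ : Fin 1 => 1 / (y n - x n))⁻¹ =
      Matrix.of fun _ _ : Fin 1 => (y n - x n) := by
    apply Matrix.inv_eq_left_inv
    ext i j
    fin_cases i; fin_cases j
    simp [Matrix.mul_apply, hne4]
  have e : (Matrix.of fun i j : Fin (n + 1) => 1 / (y i - x j)).submatrix finSumFinEquiv finSumFinEquiv =
      Matrix.fromBlocks (Matrix.of fun i j : Fin n => 1 / (y i - x j))
        (Matrix.of fun (i : Fin n) (_ : Fin 1) => 1 / (y i - x n))
        (Matrix.of fun (_ : Fin 1) (j : Fin n) => 1 / (y n - x j))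
        (Matrix.of fun _ _ : Fin 1 => 1 / (y n - x n)) := by
    ext i j
    rcases i with i | i <;> rcases j with j | j <;> simp [Fin.val_eq_zero]
  rw [← Matrix.det_submatrix_equiv_self finSumFinEquiv, e]
  let := hD.invertible
  rw [Matrix.det_fromBlocks₂₂]
  have e2 : (Matrix.of fun i j : Fin n => 1 / (y i - x j)) -
      (Matrix.of fun (i : Fin n) (_ : Fin 1) => 1 / (y i - x n)) *
        ⅟ (Matrix.of fun _ _ : Fin 1 => 1 / (y n - x n)) *
        (Matrix.of fun (_ : Fin 1) (j : Fin n) => 1 / (y n - x j)) =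
      Matrix.of fun i j : Fin n => ((y i - y n) / (y i - x n)) *
        (Matrix.of (fun i j : Fin n => ((x n - x j) / (y n - x j)) *
          (Matrix.of fun i j : Fin n => 1 / (y i - x j)) i j)) i j := by
    rw [Matrix.invOf_eq_nonsing_inv, hD']
    ext i j
    have h1 := hne i j; have h2 := hne2 i; have h3 := hne3 j
    simp [Matrix.mul_apply]
    field_simp
    ring
  rw [e2, Matrix.det_mul_column, Matrix.det_mul_row, Finset.prod_mul_distrib]
  simp
  ring

lemma cauchy_det_ne_zero_and_log (n : ℕ) (y x : ℕ → ℝ)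
    (h : ∀ i < n, ∀ j < n, y i ≠ x j)
    (hy : Set.InjOn y (Set.Iio n)) (hx : Set.InjOn x (Set.Iio n)) :
    (Matrix.of fun i j : Fin n => 1 / (y i - x j)).det ≠ 0 ∧
    2 * Real.log (Matrix.of fun i j : Fin n => 1 / (y i - x j)).det =
      ∑ i : Fin n, ∑ k : Fin n, (Real.log (y i - y k) + Real.log (x i - x k)
        - Real.log (y i - x k) - Real.log (x i - y k)) := by
  induction n with
  | zero => simp
  | succ n ih =>
    have ih := ih (fun i hi j hj => h i (by omega) j (by omega))
      (hy.mono (Set.Iio_subset_Iio n.le_succ)) (hx.mono (Set.Iio_subset_Iio n.le_succ))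
    have hne2 : ∀ i : Fin n, y i - x n ≠ 0 :=
      fun i => sub_ne_zero.2 (h i (by omega) n (by omega))
    have hne3 : ∀ j : Fin n, y n - x j ≠ 0 :=
      fun j => sub_ne_zero.2 (h n (by omega) j (by omega))
    have hne4 : y n - x n ≠ 0 := sub_ne_zero.2 (h n (by omega) n (by omega))
    have hyn : ∀ i : Fin n, y i - y n ≠ 0 := fun i =>
      sub_ne_zero.2 (hy.ne (by simp) (by simp) i.2.ne)
    have hxn : ∀ i : Fin n, x n - x i ≠ 0 := fun i =>
      sub_ne_zero.2 (hx.ne (by simp) (by simp) i.2.ne')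
    have hterm : ∀ i : Fin n, ((y i - y n) / (y i - x n)) * ((x n - x i) / (y n - x i)) ≠ 0 :=
      fun i => mul_ne_zero (div_ne_zero (hyn i) (hne2 _)) (div_ne_zero (hxn i) (hne3 _))
    have hprod : ∏ i : Fin n, (((y i - y n) / (y i - x n)) * ((x n - x i) / (y n - x i))) ≠ 0 :=
      Finset.prod_ne_zero_iff.2 fun i _ => hterm i
    have h1 : 1 / (y n - x n) ≠ 0 := one_div_ne_zero hne4
    rw [cauchy_det_succ n y x h]
    refine ⟨mul_ne_zero ih.1 (mul_ne_zero h1 hprod), ?_⟩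
    rw [Real.log_mul ih.1 (mul_ne_zero h1 hprod), Real.log_mul h1 hprod, mul_add, ih.2,
      Real.log_prod fun i _ => hterm i]
    simp only [Fin.sum_univ_castSucc, Fin.val_castSucc, Fin.val_last, Finset.sum_add_distrib]
    have e1 : Real.log (1 / (y n - x n)) = - Real.log (y n - x n) := by
      rw [one_div, Real.log_inv]
    have e2 : ∀ a b : ℝ, Real.log (a - b) = Real.log (b - a) := fun a b => by
      rw [← Real.log_neg_eq_log, neg_sub]
    have e3 : ∑ i : Fin n, Real.log (((y i - y n) / (y i - x n)) * ((x n - x i) / (y n - x i)))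
        = ∑ i : Fin n, (Real.log (y i - y n) - Real.log (y i - x n) + (Real.log (x i - x n)
          - Real.log (x i - y n))) := by
      refine Finset.sum_congr rfl fun i _ => ?_
      rw [Real.log_mul (div_ne_zero (hyn i) (hne2 _)) (div_ne_zero (hxn i) (hne3 _)),
        Real.log_div (hyn i) (hne2 _), Real.log_div (hxn i) (hne3 _), e2 (x n) (x i),
        e2 (y n) (x i)]
    have e4 : ∑ k : Fin n, (Real.log (y n - y k) + Real.log (x n - x k)
        - Real.log (y n - x k) - Real.log (x n - y k)) =
        ∑ i : Fin n, (Real.log (y i - y n) - Real.log (y i - x n) + (Real.log (x i - x n)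
          - Real.log (x i - y n))) := by
      refine Finset.sum_congr rfl fun i _ => ?_
      rw [e2 (y n) (y i), e2 (x n) (x i), e2 (y n) (x i), e2 (x n) (y i)]
      ring
    have e5 : ∑ i : Fin n, (Real.log (y i - y n) + Real.log (x i - x n)
        - Real.log (y i - x n) - Real.log (x i - y n)) =
        ∑ i : Fin n, (Real.log (y i - y n) - Real.log (y i - x n) + (Real.log (x i - x n)
          - Real.log (x i - y n))) := by
      refine Finset.sum_congr rfl fun i _ => ?_
      ring
    rw [e3, e4, e5, e1, e2 (x n) (y n)]
    simp
    ring

/-- The Cauchy determinant, in logarithmic form (`Real.log 0 = 0` removes the diagonal). -/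
theorem log_cauchy_det {ι : Type*} [Fintype ι] [DecidableEq ι] (y x : ι → ℝ) (h : ∀ i j, y i ≠ x j)
    (hy : Function.Injective y) (hx : Function.Injective x) :
    (Matrix.of fun i j => 1 / (y i - x j)).det ≠ 0 ∧
    2 * Real.log (Matrix.of fun i j => 1 / (y i - x j)).det =
      ∑ i, ∑ k, (Real.log (y i - y k) + Real.log (x i - x k)
        - Real.log (y i - x k) - Real.log (x i - y k)) := by
  let e := Fintype.equivFin ι
  let ext : (ι → ℝ) → ℕ → ℝ := fun z i =>
    if h : i < Fintype.card ι then z (e.symm ⟨i, h⟩) else 0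
  have hext : ∀ z (i : Fin (Fintype.card ι)), ext z i = z (e.symm i) := fun z i => by simp [ext]
  have hext' : ∀ z i (hi : i < Fintype.card ι), ext z i = z (e.symm ⟨i, hi⟩) :=
    fun z i hi => by simp [ext, hi]
  have hinj : ∀ z, Function.Injective z → Set.InjOn (ext z) (Set.Iio (Fintype.card ι)) := by
    intro z hz i hi j hj hij
    rw [hext' z i hi, hext' z j hj] at hij
    exact congrArg Fin.val (e.symm.injective (hz hij))
  have key := cauchy_det_ne_zero_and_log (Fintype.card ι) (ext y) (ext x)
    (fun i hi j hj => by rw [hext' y i hi, hext' x j hj]; exact h _ _) (hinj y hy) (hinj x hx)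
  simp only [hext] at key
  have hdet : (Matrix.of fun i j : Fin (Fintype.card ι) => 1 / (y (e.symm i) - x (e.symm j))).det
      = (Matrix.of fun i j => 1 / (y i - x j)).det := by
    rw [← Matrix.det_submatrix_equiv_self e.symm]
    rfl
  rw [hdet] at key
  refine ⟨key.1, key.2.trans ?_⟩
  rw [← e.symm.sum_comp]
  refine Finset.sum_congr rfl fun i _ => ?_
  rw [← e.symm.sum_comp]

/-- The determinant of the Hilbert matrix. -/
lemma log_hilbert_det (n : ℕ) :
    0 < (Matrix.of fun i j : Fin n => 1 / ((i : ℝ) + j + 1)).det ∧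
    Real.log (Matrix.of fun i j : Fin n => 1 / ((i : ℝ) + j + 1)).det =
      4 * logSuperfactorial n - logSuperfactorial (2 * n) := by
  induction n with
  | zero => simp [logSuperfactorial]
  | succ n ih =>
    have h := cauchy_det_succ n (fun i => (i : ℝ) + 1) (fun j => -(j : ℝ)) (fun i _ j _ => by
      have : (0 : ℝ) ≤ i := by positivity
      have : (0 : ℝ) ≤ j := by positivity
      show (i : ℝ) + 1 ≠ -(j : ℝ)
      linarith)
    have hd : ∀ m : ℕ, (Matrix.of fun i j : Fin m => 1 / ((i : ℝ) + j + 1)) =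
        Matrix.of fun i j : Fin m => 1 / ((i : ℝ) + 1 - -(j : ℝ)) := by
      intro m; ext i j; simp only [Matrix.of_apply]; congr 1; ring
    have hp : ∏ i : Fin n, ((((i : ℝ) + 1 - (n + 1)) / ((i : ℝ) + 1 - -(n : ℝ))) *
        ((-(n : ℝ) - -(i : ℝ)) / ((n : ℝ) + 1 - -(i : ℝ)))) =
        ((n.factorial : ℝ) * (n.factorial : ℝ) / ((2 * n).factorial : ℝ)) ^ 2 := by
      have p1 : ∏ i ∈ Finset.range n, ((n : ℝ) - i) = n.factorial := by
        rw [← Finset.prod_range_reflect, ← Finset.prod_range_add_one_eq_factorial]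
        push_cast
        refine Finset.prod_congr rfl fun i hi => ?_
        have := Finset.mem_range.1 hi
        rw [Nat.cast_sub (by omega), Nat.cast_sub (by omega)]
        push_cast; ring
      have p2 : (∏ i ∈ Finset.range n, ((n : ℝ) + 1 + i)) * n.factorial = (2 * n).factorial := by
        have := Nat.factorial_mul_ascFactorial n n
        rw [Nat.ascFactorial_eq_prod_range] at this
        rw [two_mul, ← this]
        push_cast
        ring
      have p3 : (∏ i ∈ Finset.range n, ((n : ℝ) + 1 + i)) = (2 * n).factorial / n.factorial := by
        rw [← p2]; field_simp
      rw [Fin.prod_univ_eq_prod_range (fun i : ℕ => (((i : ℝ) + 1 - (n + 1)) / ((i : ℝ) + 1 - -(n : ℝ))) *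
        ((-(n : ℝ) - -(i : ℝ)) / ((n : ℝ) + 1 - -(i : ℝ))))]
      have : ∀ i : ℕ, (((i : ℝ) + 1 - (n + 1)) / ((i : ℝ) + 1 - -(n : ℝ))) *
        ((-(n : ℝ) - -(i : ℝ)) / ((n : ℝ) + 1 - -(i : ℝ))) = (((n : ℝ) - i) / ((n : ℝ) + 1 + i)) ^ 2 := by
        intro i
        rw [div_mul_div_comm, div_pow]
        congr 1 <;> ring
      simp only [this]
      rw [Finset.prod_pow, Finset.prod_div_distrib, p1, p3]
      congr 1
      field_simp
    rw [hd] at ih ⊢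
    rw [h, hp]
    have hpos : (0 : ℝ) < ((n.factorial : ℝ) * (n.factorial : ℝ) / ((2 * n).factorial : ℝ)) ^ 2 := by
      positivity
    have hpos2 : (0 : ℝ) < 1 / ((n : ℝ) + 1 - -(n : ℝ)) := by
      rw [sub_neg_eq_add]; positivity
    refine ⟨mul_pos ih.1 (mul_pos hpos2 hpos), ?_⟩
    have hf : ∀ m : ℕ, ((m.factorial : ℕ) : ℝ) ≠ 0 := fun m => by positivity
    rw [Real.log_mul ih.1.ne' (mul_pos hpos2 hpos).ne', Real.log_mul hpos2.ne' hpos.ne', ih.2,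
      Real.log_pow, Real.log_div (mul_ne_zero (hf _) (hf _)) (hf _), Real.log_mul (hf _)
      (hf _), one_div, Real.log_inv]
    unfold logSuperfactorial
    rw [show 2 * (n + 1) = 2 * n + 1 + 1 by ring, Finset.sum_range_succ, Finset.sum_range_succ,
      Finset.sum_range_succ, Nat.factorial_succ (2 * n), Nat.cast_mul,
      Real.log_mul (by positivity) (by positivity)]
    push_cast
    rw [show (n : ℝ) + 1 - -(n : ℝ) = 2 * n + 1 by ring]
    ring

/-- The monic Chebyshev polynomials of the third kind, in the variable `2 cos θ`. -/
def chebThird : ℕ → Polynomial ℝ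
  | 0 => 1
  | 1 => Polynomial.X - 1
  | (n + 2) => Polynomial.X * chebThird (n + 1) - chebThird n

lemma chebThird_monic_natDegree (n : ℕ) : (chebThird n).Monic ∧ (chebThird n).natDegree = n := by
  induction n using Nat.strong_induction_on with
  | _ n ih =>
    match n with
    | 0 => simp [chebThird]
    | 1 =>
      refine ⟨?_, ?_⟩
      · simpa [chebThird] using Polynomial.monic_X_sub_C (1 : ℝ)
      · simpa [chebThird] using Polynomial.natDegree_X_sub_C (1 : ℝ)
    | n + 2 =>
      obtain ⟨h1, h1'⟩ := ih (n + 1) (by omega)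
      obtain ⟨h0, h0'⟩ := ih n (by omega)
      have hm : (Polynomial.X * chebThird (n + 1)).Monic := Polynomial.monic_X.mul h1
      have hd : (Polynomial.X * chebThird (n + 1)).natDegree = n + 2 := by
        rw [Polynomial.natDegree_X_mul h1.ne_zero, h1']
      have hlt : (chebThird n).natDegree < (Polynomial.X * chebThird (n + 1)).natDegree := by
        rw [hd, h0']; omega
      refine ⟨?_, ?_⟩
      · exact hm.sub_of_left (Polynomial.degree_lt_degree hlt)
      · rw [chebThird, Polynomial.natDegree_sub_eq_left_of_natDegree_lt hlt, hd]

lemma chebThird_eval (n : ℕ) (θ : ℝ) :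
    (chebThird n).eval (2 * Real.cos θ) * Real.cos (θ / 2) = Real.cos ((n + 1 / 2) * θ) := by
  induction n using Nat.strong_induction_on with
  | _ n ih =>
    match n with
    | 0 => simp [chebThird]; ring_nf
    | 1 =>
      simp only [chebThird, Polynomial.eval_sub, Polynomial.eval_X, Polynomial.eval_one]
      have := Real.cos_add_cos ((1 + 1 / 2) * θ) (θ / 2)
      have e1 : ((1 + 1 / 2) * θ + θ / 2) / 2 = θ := by ring
      have e2 : ((1 + 1 / 2) * θ - θ / 2) / 2 = θ / 2 := by ring
      rw [e1, e2] at this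
      push_cast
      linarith
    | n + 2 =>
      have h1 := ih (n + 1) (by omega)
      have h0 := ih n (by omega)
      simp only [chebThird, Polynomial.eval_sub, Polynomial.eval_X, Polynomial.eval_mul]
      have := Real.cos_add_cos ((((n + 2 : ℕ) : ℝ) + 1 / 2) * θ) (((n : ℝ) + 1 / 2) * θ)
      have e1 : ((((n + 2 : ℕ) : ℝ) + 1 / 2) * θ + ((n : ℝ) + 1 / 2) * θ) / 2
        = (((n + 1 : ℕ) : ℝ) + 1 / 2) * θ := by push_cast; ring
      have e2 : ((((n + 2 : ℕ) : ℝ) + 1 / 2) * θ - ((n : ℝ) + 1 / 2) * θ) / 2 = θ := by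
        push_cast; ring
      rw [e1, e2, ← h1, ← h0] at this
      linarith

lemma one_add_cos_mul_chebThird (j k : ℕ) (θ : ℝ) :
    (1 + Real.cos θ) * ((chebThird j).eval (2 * Real.cos θ) * (chebThird k).eval (2 * Real.cos θ)) =
      Real.cos (((j : ℝ) - k) * θ) + Real.cos (((j : ℝ) + k + 1) * θ) := by
  have h1 := chebThird_eval j θ
  have h2 := chebThird_eval k θ
  have h3 : 1 + Real.cos θ = 2 * Real.cos (θ / 2) ^ 2 := by
    rw [Real.cos_sq]; ring_nf
  have := Real.cos_add_cos (((j : ℝ) + k + 1) * θ) (((j : ℝ) - k) * θ)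
  have e1 : (((j : ℝ) + k + 1) * θ + ((j : ℝ) - k) * θ) / 2 = (j + 1 / 2) * θ := by ring
  have e2 : (((j : ℝ) + k + 1) * θ - ((j : ℝ) - k) * θ) / 2 = (k + 1 / 2) * θ := by ring
  rw [e1, e2, ← h1, ← h2] at this
  rw [h3]
  linarith

lemma det_functional_monic (L : Polynomial ℝ →ₗ[ℝ] ℝ) (p : ℕ → Polynomial ℝ)
    (hp : ∀ n, (p n).Monic ∧ (p n).natDegree = n) (n : ℕ) :
    (Matrix.of fun j k : Fin n => L (p j * p k)).det =
      (Matrix.of fun j k : Fin n => L (Polynomial.X ^ ((j : ℕ) + k))).det := by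
  let P : Matrix (Fin n) (Fin n) ℝ := Matrix.of fun i j => (p j).coeff i
  have hP : P.det = 1 := Matrix.det_matrixOfPolynomials (fun i : Fin n => p i)
    (fun i => (hp i).2) (fun i => (hp i).1)
  have hx : ∀ j : Fin n, p j = ∑ m : Fin n, Polynomial.C (P m j) * Polynomial.X ^ (m : ℕ) := by
    intro j
    conv_lhs => rw [(p j).as_sum_range' n (by rw [(hp j).2]; exact j.2)]
    rw [Finset.sum_range]
    refine Finset.sum_congr rfl fun m _ => ?_
    rw [Polynomial.C_mul_X_pow_eq_monomial]; rfl
  have : (Matrix.of fun j k : Fin n => L (p j * p k)) =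
      P.transpose * (Matrix.of fun j k : Fin n => L (Polynomial.X ^ ((j : ℕ) + k))) * P := by
    ext j k
    simp only [Matrix.of_apply, Matrix.mul_apply, Matrix.transpose_apply]
    conv_lhs => rw [hx j, hx k, Finset.sum_mul_sum, map_sum]
    simp_rw [map_sum, Finset.sum_mul]
    rw [Finset.sum_comm]
    refine Finset.sum_congr rfl fun a _ => Finset.sum_congr rfl fun b _ => ?_
    have : Polynomial.C (P b j) * Polynomial.X ^ (b : ℕ) * (Polynomial.C (P a k) * Polynomial.X ^ (a : ℕ))
        = (P b j * P a k) • Polynomial.X ^ ((b : ℕ) + a) := by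
      rw [Polynomial.smul_eq_C_mul, Polynomial.C_mul, pow_add]; ring
    rw [this, map_smul, smul_eq_mul]
    ring
  rw [this, Matrix.det_mul, Matrix.det_mul, Matrix.det_transpose, hP]
  ring

/-- Integration of a polynomial in `2 cos θ` against a continuous weight on `[a,b]`. -/
def weightFunctional (a b : ℝ) (w : ℝ → ℝ) (hw : Continuous w) : Polynomial ℝ →ₗ[ℝ] ℝ where
  toFun q := 1 / Real.pi * ∫ θ in a..b, w θ * q.eval (2 * Real.cos θ)
  map_add' p q := by
    rw [← mul_add, ← intervalIntegral.integral_add]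
    · simp only [Polynomial.eval_add, mul_add]
    · exact (hw.mul (p.continuous.comp (by fun_prop))).intervalIntegrable _ _
    · exact (hw.mul (q.continuous.comp (by fun_prop))).intervalIntegrable _ _
  map_smul' c p := by
    simp only [Polynomial.eval_smul, smul_eq_mul, RingHom.id_apply]
    rw [mul_left_comm, ← intervalIntegral.integral_const_mul c]
    congr 1
    apply intervalIntegral.integral_congr; intro θ _
    simp only
    ring

/-- The limiting weight. -/
def jacobiWeight (ρ θ : ℝ) : ℝ := Real.sin θ * √((1 + ρ * Real.cos θ) / (1 - ρ * Real.cos θ))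

lemma one_sub_mul_cos_pos {ρ : ℝ} (h0 : 0 ≤ ρ) (h1 : ρ < 1) (θ : ℝ) : 0 < 1 - ρ * Real.cos θ := by
  nlinarith [Real.cos_le_one θ]

lemma one_add_mul_cos_pos {ρ : ℝ} (h0 : 0 ≤ ρ) (h1 : ρ < 1) (θ : ℝ) : 0 < 1 + ρ * Real.cos θ := by
  nlinarith [Real.neg_one_le_cos θ]

lemma continuous_jacobiWeight {ρ : ℝ} (h0 : 0 ≤ ρ) (h1 : ρ < 1) : Continuous (jacobiWeight ρ) := by
  unfold jacobiWeight
  refine Real.continuous_sin.mul (Real.continuous_sqrt.comp (Continuous.div (by fun_prop)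
    (by fun_prop) fun θ => (one_sub_mul_cos_pos h0 h1 θ).ne'))

/-- The limiting Hankel determinant. -/
def jacobiDet (n : ℕ) (ρ : ℝ) : ℝ := (Matrix.of fun j k : Fin n => 1 / Real.pi *
  ∫ θ in (0 : ℝ)..Real.pi, jacobiWeight ρ θ *
    ((chebThird j).eval (2 * Real.cos θ) * (chebThird k).eval (2 * Real.cos θ))).det

lemma jacobiDet_eq {n : ℕ} {ρ : ℝ} (h0 : 0 ≤ ρ) (h1 : ρ < 1) (p : ℕ → Polynomial ℝ)
    (hp : ∀ n, (p n).Monic ∧ (p n).natDegree = n) :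
    jacobiDet n ρ = (Matrix.of fun j k : Fin n =>
      weightFunctional 0 Real.pi _ (continuous_jacobiWeight h0 h1) (p j * p k)).det := by
  rw [det_functional_monic _ p hp, ← det_functional_monic _ chebThird chebThird_monic_natDegree]
  simp only [jacobiDet, weightFunctional, LinearMap.coe_mk, AddHom.coe_mk, Polynomial.eval_mul]

lemma jacobiDet_zero (n : ℕ) : 0 < jacobiDet n 0 ∧ Real.log (jacobiDet n 0) = logLegendre n := by
  have hp : ∀ n, ((Polynomial.X + Polynomial.C (2 : ℝ)) ^ n).Monic ∧
      ((Polynomial.X + Polynomial.C (2 : ℝ)) ^ n).natDegree = n := fun n =>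
    ⟨(Polynomial.monic_X_add_C _).pow n, by simp⟩
  have hm : ∀ m : ℕ, weightFunctional 0 Real.pi _ (continuous_jacobiWeight le_rfl zero_lt_one)
      ((Polynomial.X + Polynomial.C (2 : ℝ)) ^ m) = 2 / Real.pi * 4 ^ m * (1 / ((m : ℝ) + 1)) := by
    intro m
    simp only [weightFunctional, LinearMap.coe_mk, AddHom.coe_mk, jacobiWeight]
    have hd : ∀ θ ∈ Set.uIcc 0 Real.pi, HasDerivAt
        (fun θ : ℝ => -((2 * Real.cos θ + 2) ^ (m + 1)) / (2 * (m + 1)))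
        (Real.sin θ * √((1 + 0 * Real.cos θ) / (1 - 0 * Real.cos θ)) *
          ((Polynomial.X + Polynomial.C (2 : ℝ)) ^ m).eval (2 * Real.cos θ)) θ := by
      intro θ _
      refine ((((((Real.hasDerivAt_cos θ).const_mul 2).add_const 2).pow (m + 1)).neg).div_const
        (2 * ((m : ℝ) + 1))).congr_deriv ?_
      simp
      field_simp
    rw [intervalIntegral.integral_eq_sub_of_hasDerivAt hd]
    · simp only [Real.cos_pi, Real.cos_zero]
      norm_num
      field_simp
      rw [pow_succ]; ring
    · apply Continuous.intervalIntegrable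
      refine (Continuous.mul ?_ (Polynomial.continuous _ |>.comp (by fun_prop)))
      simp only [zero_mul]
      fun_prop
  have key : jacobiDet n 0 = (2 / Real.pi) ^ n * 4 ^ (n * (n - 1)) *
      (Matrix.of fun i j : Fin n => 1 / ((i : ℝ) + j + 1)).det := by
    rw [jacobiDet_eq le_rfl zero_lt_one _ hp]
    have : (Matrix.of fun j k : Fin n => weightFunctional 0 Real.pi _
        (continuous_jacobiWeight le_rfl zero_lt_one)
        ((Polynomial.X + Polynomial.C (2 : ℝ)) ^ (j : ℕ) * (Polynomial.X + Polynomial.C (2 : ℝ)) ^ (k : ℕ))) =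
        Matrix.of fun j k : Fin n => (2 / Real.pi * 4 ^ (j : ℕ)) *
          (Matrix.of (fun j k : Fin n => 4 ^ (k : ℕ) *
            (Matrix.of fun i j : Fin n => 1 / ((i : ℝ) + j + 1)) j k)) j k := by
      ext j k
      simp only [Matrix.of_apply]
      rw [← pow_add, hm, pow_add]
      push_cast
      ring
    rw [this, Matrix.det_mul_column, Matrix.det_mul_row, Finset.prod_mul_distrib]
    simp only [Finset.prod_const, Finset.card_univ, Fintype.card_fin]
    rw [Finset.prod_pow_eq_pow_sum, Fin.sum_univ_eq_sum_range (fun i => i),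
      ← Finset.sum_range_id_mul_two, mul_two, pow_add]
    simp only [mul_assoc]
  obtain ⟨h1, h2⟩ := log_hilbert_det n
  rw [key]
  have hpi := Real.pi_pos
  refine ⟨by positivity, ?_⟩
  rw [Real.log_mul (by positivity) h1.ne', Real.log_mul (by positivity) (by positivity), h2,
    Real.log_pow, Real.log_pow, show (4 : ℝ) = 2 ^ 2 by norm_num, Real.log_pow]
  unfold logLegendre
  rcases n with _ | n
  · simp
    norm_num
  · push_cast [Nat.add_sub_cancel]
    ring

/-- The Toeplitz-plus-Hankel determinant of an arc. -/
def arcDet (n : ℕ) (b : ℝ) : ℝ := (Matrix.of fun j k : Fin n => 1 / Real.pi *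
  ∫ φ in b..(Real.pi - b), (Real.cos (((j : ℝ) - k) * φ) + Real.cos (((j : ℝ) + k + 1) * φ))).det

lemma arcDet_eq {n : ℕ} {b : ℝ} (h0 : 0 < b) (h1 : b < Real.pi / 2) :
    arcDet n b = Real.cos b ^ (n ^ 2) * jacobiDet n (Real.cos b) := by
  have hρ0 : 0 < Real.cos b := Real.cos_pos_of_mem_Ioo ⟨by linarith, h1⟩
  have hρ1 : Real.cos b < 1 := by
    rw [← Real.cos_zero]
    exact Real.cos_lt_cos_of_nonneg_of_le_pi_div_two le_rfl h1.le h0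
  set ρ := Real.cos b with hρ
  have hp : ∀ n, ((Polynomial.X : Polynomial ℝ) ^ n).Monic ∧
      ((Polynomial.X : Polynomial ℝ) ^ n).natDegree = n := fun n =>
    ⟨Polynomial.monic_X.pow n, by simp⟩
  have hc : Continuous fun φ : ℝ => 1 + Real.cos φ := by fun_prop
  have harc : arcDet n b = (Matrix.of fun j k : Fin n =>
      weightFunctional b (Real.pi - b) _ hc (Polynomial.X ^ ((j : ℕ) + k))).det := by
    rw [← det_functional_monic _ chebThird chebThird_monic_natDegree]
    simp only [arcDet, weightFunctional, LinearMap.coe_mk, AddHom.coe_mk, Polynomial.eval_mul,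
      one_add_cos_mul_chebThird]
  have hm : ∀ m : ℕ, weightFunctional b (Real.pi - b) _ hc (Polynomial.X ^ m) =
      ρ ^ (m + 1) * weightFunctional 0 Real.pi _ (continuous_jacobiWeight hρ0.le hρ1)
        (Polynomial.X ^ m) := by
    intro m
    simp only [weightFunctional, LinearMap.coe_mk, AddHom.coe_mk, Polynomial.eval_pow,
      Polynomial.eval_X]
    have hlt : ∀ θ, -1 < ρ * Real.cos θ ∧ ρ * Real.cos θ < 1 := fun θ =>
      ⟨by linarith [one_add_mul_cos_pos hρ0.le hρ1 θ], by linarith [one_sub_mul_cos_pos hρ0.le hρ1 θ]⟩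
    have hd : ∀ θ ∈ Set.uIcc 0 Real.pi, HasDerivAt (fun θ => Real.arccos (ρ * Real.cos θ))
        (-(1 / √(1 - (ρ * Real.cos θ) ^ 2)) * (ρ * -Real.sin θ)) θ := fun θ _ =>
      HasDerivAt.comp (h₂ := Real.arccos) θ (Real.hasDerivAt_arccos (hlt θ).1.ne' (hlt θ).2.ne)
        ((Real.hasDerivAt_cos θ).const_mul ρ)
    have hsq : ∀ θ, 0 < 1 - (ρ * Real.cos θ) ^ 2 := fun θ => by
      nlinarith [(hlt θ).1, (hlt θ).2]
    have hsub := intervalIntegral.integral_comp_mul_deriv (a := 0) (b := Real.pi) hd ?_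
      (hc.mul (Continuous.pow (by fun_prop : Continuous fun φ : ℝ => 2 * Real.cos φ) m))
    · have ea : Real.arccos (ρ * Real.cos 0) = b := by
        rw [Real.cos_zero, mul_one, hρ, Real.arccos_cos h0.le (by linarith)]
      have eb : Real.arccos (ρ * Real.cos Real.pi) = Real.pi - b := by
        rw [Real.cos_pi, mul_neg_one, Real.arccos_neg, hρ, Real.arccos_cos h0.le (by linarith)]
      rw [ea, eb] at hsub

      rw [show (∫ θ in b..(Real.pi - b), (1 + Real.cos θ) * (2 * Real.cos θ) ^ m) = _ from hsub.symm]
      rw [mul_left_comm, ← intervalIntegral.integral_const_mul (ρ ^ (m + 1))]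
      congr 1
      apply intervalIntegral.integral_congr; intro θ _
      simp only [Function.comp, Pi.mul_apply, Pi.pow_apply]
      rw [Real.cos_arccos (hlt θ).1.le (hlt θ).2.le]
      have e1 : √((1 + ρ * Real.cos θ) / (1 - ρ * Real.cos θ)) =
          (1 + ρ * Real.cos θ) / √(1 - (ρ * Real.cos θ) ^ 2) := by
        have hp1 := one_add_mul_cos_pos hρ0.le hρ1 θ
        have hp2 := one_sub_mul_cos_pos hρ0.le hρ1 θ
        rw [Real.sqrt_eq_iff_mul_self_eq (by positivity) (by positivity), div_mul_div_comm,
          Real.mul_self_sqrt (hsq θ).le, div_eq_div_iff hp2.ne' (hsq θ).ne']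
        ring
      rw [jacobiWeight, e1]
      have := Real.sqrt_pos.2 (hsq θ)
      field_simp
      ring
    · refine Continuous.continuousOn ?_
      refine Continuous.mul (Continuous.neg (Continuous.div (by fun_prop) (by fun_prop) fun θ =>
        (Real.sqrt_pos.2 (hsq θ)).ne')) (by fun_prop)
  rw [harc, jacobiDet_eq hρ0.le hρ1 _ hp]
  have : (Matrix.of fun j k : Fin n => weightFunctional b (Real.pi - b) _ hc
      (Polynomial.X ^ ((j : ℕ) + k))) = Matrix.of fun j k : Fin n => (ρ * ρ ^ (j : ℕ)) *
        (Matrix.of (fun j k : Fin n => ρ ^ (k : ℕ) * (Matrix.of fun j k : Fin n =>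
          weightFunctional 0 Real.pi _ (continuous_jacobiWeight hρ0.le hρ1)
            (Polynomial.X ^ (j : ℕ) * Polynomial.X ^ (k : ℕ))) j k)) j k := by
    ext j k
    simp only [Matrix.of_apply]
    rw [hm, ← pow_add (Polynomial.X : Polynomial ℝ)]
    ring
  rw [this, Matrix.det_mul_column, Matrix.det_mul_row, Finset.prod_mul_distrib]
  simp only [Finset.prod_const, Finset.card_univ, Fintype.card_fin]
  rw [Finset.prod_pow_eq_pow_sum, Fin.sum_univ_eq_sum_range (fun i => i), ← mul_assoc, ← pow_add,
    ← pow_add, add_assoc, ← mul_two, Finset.sum_range_id_mul_two]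
  congr 2
  rcases n with _ | n
  · simp
  · rw [Nat.add_sub_cancel]; ring

/-- The point `e^{iθ}` of the unit circle. -/
def circ (θ : ℝ) : ℂ := Complex.exp (Complex.I * θ)

lemma continuous_circ : Continuous circ := by unfold circ; fun_prop

lemma norm_circ (θ : ℝ) : ‖circ θ‖ = 1 := by
  rw [circ, mul_comm, Complex.norm_exp_ofReal_mul_I]

lemma circ_ne_zero (θ : ℝ) : circ θ ≠ 0 := Complex.exp_ne_zero _

lemma inv_circ (θ : ℝ) : (circ θ)⁻¹ = Complex.exp (-(Complex.I * θ)) := by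
  rw [circ, ← Complex.exp_neg]

lemma fc_eq_circ (f : ℝ → ℂ) (k : ℤ) : fc f k =
    ((1 / (2 * Real.pi) : ℝ) : ℂ) * ∫ θ in (0 : ℝ)..(2 * Real.pi), f θ * circ θ ^ (-k) := by
  unfold fc
  congr 1
  apply intervalIntegral.integral_congr
  intro θ _
  simp only [circ]
  rw [← Complex.exp_int_mul]
  push_cast
  congr 2; ring

lemma fc_one (k : ℤ) : fc (fun _ => 1) k = if k = 0 then 1 else 0 := by
  rw [fc]
  have hpi : (Real.pi : ℂ) ≠ 0 := by exact_mod_cast Real.pi_ne_zero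
  split_ifs with h
  · subst h
    simp
    field_simp
  · have hk : -(Complex.I * k) ≠ 0 := by
      simp [h]
    have : ∀ θ : ℝ, (1 : ℂ) * Complex.exp (-(Complex.I * k * θ)) =
        Complex.exp (-(Complex.I * k) * θ) := fun θ => by rw [one_mul]; congr 1; ring
    simp only [this]
    rw [integral_exp_mul_complex hk]
    have e : Complex.exp (-(Complex.I * k) * ((2 * Real.pi : ℝ) : ℂ)) = 1 := by
      rw [Complex.exp_eq_one_iff]
      exact ⟨-k, by push_cast; ring⟩
    rw [e]; simp

/-- An absolutely summable power series on the circle. -/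
def pser (c : ℕ → ℝ) (z : ℂ) : ℂ := ∑' i, (c i : ℂ) * z ^ i

lemma summable_pser {c : ℕ → ℝ} (hc : Summable fun i => |c i|) {z : ℂ} (hz : ‖z‖ ≤ 1) :
    Summable fun i => (c i : ℂ) * z ^ i := by
  refine Summable.of_norm_bounded hc fun i => ?_
  rw [norm_mul, norm_pow, Complex.norm_real, Real.norm_eq_abs]
  exact mul_le_of_le_one_right (abs_nonneg _) (pow_le_one₀ (norm_nonneg _) hz)

lemma norm_pser_le {c : ℕ → ℝ} (hc : Summable fun i => |c i|) {z : ℂ} (hz : ‖z‖ ≤ 1) :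
    ‖pser c z‖ ≤ ∑' i, |c i| := by
  refine tsum_of_norm_bounded hc.hasSum fun i => ?_
  rw [norm_mul, norm_pow, Complex.norm_real, Real.norm_eq_abs]
  exact mul_le_of_le_one_right (abs_nonneg _) (pow_le_one₀ (norm_nonneg _) hz)

lemma continuous_pser_comp {c : ℕ → ℝ} (hc : Summable fun i => |c i|) {g : ℝ → ℂ}
    (hg : Continuous g) (hg1 : ∀ θ, ‖g θ‖ ≤ 1) : Continuous fun θ => pser c (g θ) := by
  refine continuous_tsum (u := fun i => |c i|) (fun i => by fun_prop) hc fun i θ => ?_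
  rw [norm_mul, norm_pow, Complex.norm_real, Real.norm_eq_abs]
  exact mul_le_of_le_one_right (abs_nonneg _) (pow_le_one₀ (norm_nonneg _) (hg1 θ))

lemma hasSum_fc_mul {f : ℝ → ℂ} (hf : Continuous f) {C : ℝ} (hC : ∀ θ, ‖f θ‖ ≤ C)
    {c : ℕ → ℝ} (hc : Summable fun i => |c i|) (σ : ℤ) (k : ℤ) :
    HasSum (fun i : ℕ => (c i : ℂ) * fc f (k - σ * i))
      (fc (fun θ => f θ * pser c (circ θ ^ σ)) k) := by
  rw [fc_eq_circ]
  have hn : ∀ (i : ℕ) (θ : ℝ), ‖(c i : ℂ) * (f θ * circ θ ^ (-(k - σ * i)))‖ ≤ |c i| * C := by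
    intro i θ
    rw [norm_mul, norm_mul, norm_zpow, norm_circ, one_zpow, mul_one, Complex.norm_real,
      Real.norm_eq_abs]
    gcongr; exact hC θ
  have hz : ∀ k : ℤ, Continuous fun θ => circ θ ^ k := fun k =>
    continuous_circ.zpow₀ k fun θ => Or.inl (circ_ne_zero θ)
  have key := intervalIntegral.hasSum_integral_of_dominated_convergence (μ := volume)
    (a := 0) (b := 2 * Real.pi)
    (F := fun (i : ℕ) (θ : ℝ) => (c i : ℂ) * (f θ * circ θ ^ (-(k - σ * i))))
    (f := fun θ => f θ * pser c (circ θ ^ σ) * circ θ ^ (-k))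
    (fun i _ => |c i| * C)
    (fun i => (Continuous.aestronglyMeasurable (continuous_const.mul (hf.mul (hz _)))))
    (fun i => Eventually.of_forall fun θ _ => hn i θ)
    (Eventually.of_forall fun θ _ => hc.mul_right C)
    intervalIntegrable_const
    (Eventually.of_forall fun θ _ => by
      have h1 := (summable_pser hc (z := circ θ ^ σ) (by rw [norm_zpow, norm_circ, one_zpow])).hasSum
      have h2 := (h1.mul_left (f θ)).mul_right (circ θ ^ (-k))
      refine h2.congr_fun fun i => ?_
      rw [neg_sub, sub_eq_add_neg, zpow_add₀ (circ_ne_zero θ), zpow_mul, zpow_natCast]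
      ring)
  refine (key.mul_left ((1 / (2 * Real.pi) : ℝ) : ℂ)).congr_fun fun i => ?_
  rw [intervalIntegral.integral_const_mul, fc_eq_circ]
  ring

lemma fc_pser {c : ℕ → ℝ} (hc : Summable fun i => |c i|) (k : ℤ) :
    fc (fun θ => pser c (circ θ)) k = if 0 ≤ k then (c k.toNat : ℂ) else 0 := by
  have h := hasSum_fc_mul (f := fun _ => 1) continuous_const (C := 1) (by simp) hc 1 k
  simp only [one_mul, zpow_one, fc_one] at h
  refine h.unique ?_
  split_ifs with hk
  · convert hasSum_ite_eq k.toNat (c k.toNat : ℂ) using 2 with i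
    by_cases hi : i = k.toNat
    · subst hi; simp [hk]
    · rw [if_neg hi, if_neg (by omega), mul_zero]
  · convert hasSum_zero using 2 with i
    rw [if_neg (by omega), mul_zero]

lemma fc_pser_inv {c : ℕ → ℝ} (hc : Summable fun i => |c i|) (k : ℤ) :
    fc (fun θ => pser c (circ θ)⁻¹) k = if k ≤ 0 then (c (-k).toNat : ℂ) else 0 := by
  have h := hasSum_fc_mul (f := fun _ => 1) continuous_const (C := 1) (by simp) hc (-1) k
  simp only [one_mul, zpow_neg, zpow_one, fc_one] at h
  refine h.unique ?_
  split_ifs with hk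
  · convert hasSum_ite_eq (-k).toNat (c (-k).toNat : ℂ) using 2 with i
    by_cases hi : i = (-k).toNat
    · subst hi; simp [hk]
    · rw [if_neg hi, if_neg (by omega), mul_zero]
  · convert hasSum_zero using 2 with i
    rw [if_neg (by omega), mul_zero]

/-- The quotient symbol `u(z) a(1/z)` of two power series. -/
def quotSym (u α : ℕ → ℝ) (θ : ℝ) : ℂ := pser u (circ θ) * pser α (circ θ)⁻¹

/-- Autocorrelation coefficients. -/
def autoCorr (α : ℕ → ℝ) (k : ℤ) : ℝ := ∑' i, α i * α (i + k.natAbs)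

/-- The section `T + H` vectors multiplied by the inverse factor. -/
def innerVec (u α : ℕ → ℝ) (l : ℕ) (p : ℤ) : ℝ :=
  ∑ q ∈ Finset.range (l + 1), u (l - q) * (autoCorr α (p - q) + autoCorr α (p + q + 1))

/-- Entries of `U (T + H) Uᵀ`. -/
def solVec (u α : ℕ → ℝ) (l k : ℕ) : ℝ :=
  ∑ p ∈ Finset.range (k + 1), u (k - p) * innerVec u α l p

lemma norm_inv_circ (θ : ℝ) : ‖(circ θ)⁻¹‖ = 1 := by rw [norm_inv, norm_circ, inv_one]

lemma continuous_inv_circ : Continuous fun θ => (circ θ)⁻¹ :=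
  continuous_circ.inv₀ circ_ne_zero

lemma circ_neg (θ : ℝ) : circ (-θ) = (circ θ)⁻¹ := by
  rw [inv_circ, circ]; congr 1; push_cast; ring

lemma continuous_pser_circ {α : ℕ → ℝ} (hα : Summable fun i => |α i|) :
    Continuous fun θ => pser α (circ θ) :=
  continuous_pser_comp hα continuous_circ fun θ => (norm_circ θ).le

lemma continuous_pser_inv_circ {α : ℕ → ℝ} (hα : Summable fun i => |α i|) :
    Continuous fun θ => pser α (circ θ)⁻¹ :=
  continuous_pser_comp hα continuous_inv_circ fun θ => (norm_inv_circ θ).le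

lemma fc_quotSym_self {α : ℕ → ℝ} (hα : Summable fun i => |α i|) (k : ℤ) :
    fc (quotSym α α) k = autoCorr α k := by
  rcases le_total 0 k with hk | hk
  · have h := hasSum_fc_mul (continuous_pser_circ hα) (fun θ => norm_pser_le hα (norm_circ θ).le)
      hα (-1) k
    simp only [zpow_neg, zpow_one, fc_pser hα] at h
    rw [autoCorr, Complex.ofReal_tsum]
    refine (h.congr_fun fun i => ?_).tsum_eq.symm
    rw [if_pos (by omega), show (k - -1 * (i : ℤ)).toNat = i + k.natAbs by omega]
    push_cast; rfl
  · have h := hasSum_fc_mul (continuous_pser_inv_circ hα)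
      (fun θ => norm_pser_le hα (norm_inv_circ θ).le) hα 1 k
    simp only [zpow_one, fc_pser_inv hα] at h
    rw [autoCorr, Complex.ofReal_tsum]
    have e : fc (quotSym α α) k = fc (fun θ => pser α (circ θ)⁻¹ * pser α (circ θ)) k := by
      congr 1; funext θ; rw [quotSym, mul_comm]
    rw [e]
    refine (h.congr_fun fun i => ?_).tsum_eq.symm
    rw [if_pos (by omega), show (-(k - 1 * (i : ℤ))).toNat = i + k.natAbs by omega]
    push_cast; rfl

lemma sum_convolution {u α : ℕ → ℝ} (hu : Summable fun i => |u i|) (hα : Summable fun i => |α i|)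
    (hua : ∀ θ, pser u (circ θ) * pser α (circ θ) = 1) (n : ℕ) :
    ∑ t ∈ Finset.range (n + 1), u (n - t) * α t = if n = 0 then 1 else 0 := by
  have h := hasSum_fc_mul (continuous_pser_circ hu) (fun θ => norm_pser_le hu (norm_circ θ).le)
      hα 1 n
  simp only [zpow_one, fc_pser hu, hua, fc_one] at h
  have h2 := hasSum_sum_of_ne_finset_zero (L := SummationFilter.unconditional ℕ) (f := fun i : ℕ => (α i : ℂ) *
    if 0 ≤ (n : ℤ) - 1 * i then (u ((n : ℤ) - 1 * i).toNat : ℂ) else 0)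
    (s := Finset.range (n + 1)) (fun b hb => by
      rw [Finset.mem_range] at hb
      rw [if_neg (by omega), mul_zero])
  have h3 := h2.unique h
  have h4 : ((∑ t ∈ Finset.range (n + 1), u (n - t) * α t : ℝ) : ℂ) =
      ((if n = 0 then 1 else 0 : ℝ) : ℂ) := by
    rw [show ((if n = 0 then 1 else 0 : ℝ) : ℂ) = if (n : ℤ) = 0 then 1 else 0 by
      split_ifs <;> simp_all, ← h3, Complex.ofReal_sum]
    refine Finset.sum_congr rfl fun t ht => ?_
    rw [Finset.mem_range] at ht
    rw [if_pos (by omega), show ((n : ℤ) - 1 * (t : ℤ)).toNat = n - t by omega, mul_comm,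
      Complex.ofReal_mul]
  exact_mod_cast h4

lemma hasSum_mul_autoCorr {u α : ℕ → ℝ} (hu : Summable fun i => |u i|)
    (hα : Summable fun i => |α i|) (hua : ∀ θ, pser u (circ θ) * pser α (circ θ) = 1) (k : ℤ) :
    HasSum (fun i : ℕ => u i * autoCorr α (k - i)) (if k ≤ 0 then α (-k).toNat else 0) := by
  have h := hasSum_fc_mul (f := quotSym α α) ((continuous_pser_circ hα).mul
    (continuous_pser_inv_circ hα)) (C := (∑' i, |α i|) * (∑' i, |α i|)) (fun θ => by
      rw [quotSym, norm_mul]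
      exact mul_le_mul (norm_pser_le hα (norm_circ θ).le) (norm_pser_le hα (norm_inv_circ θ).le)
        (norm_nonneg _) (tsum_nonneg fun _ => abs_nonneg _)) hu 1 k
  have e : (fun θ => quotSym α α θ * pser u (circ θ ^ (1 : ℤ))) = fun θ => pser α (circ θ)⁻¹ := by
    funext θ
    rw [zpow_one, quotSym, mul_right_comm, mul_comm (pser α _), hua, one_mul]
  rw [e, fc_pser_inv hα] at h
  simp only [fc_quotSym_self hα, one_mul] at h
  rw [← Complex.hasSum_ofReal]
  convert h using 1
  · funext i; push_cast; rfl
  · split_ifs <;> simp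

lemma summable_autoCorr {α : ℕ → ℝ} (hα : Summable fun i => |α i|) :
    Summable fun k : ℕ => |autoCorr α k| := by
  have h1 : Summable fun x : ℕ × ℕ => |α x.1| * |α x.2| :=
    hα.mul_of_nonneg hα (fun _ => abs_nonneg _) (fun _ => abs_nonneg _)
  have hinj : Function.Injective (fun x : ℕ × ℕ => (x.2, x.2 + x.1)) := by
    rintro ⟨a, b⟩ ⟨c, d⟩ h
    simp only [Prod.mk.injEq] at h ⊢
    omega
  have h2 := h1.comp_injective hinj
  refine Summable.of_nonneg_of_le (fun _ => abs_nonneg _) (fun k => ?_) h2.prod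
  have h3 : Summable fun i : ℕ => |α i * α (i + k)| := by
    simp only [abs_mul]
    exact h2.prod_factor k
  rw [autoCorr]
  calc _ ≤ ∑' i, |α i * α (i + k)| := by
        rw [Int.natAbs_natCast]
        have := norm_tsum_le_tsum_norm (f := fun i : ℕ => α i * α (i + k))
          (by simpa only [Real.norm_eq_abs] using h3)
        simpa only [Real.norm_eq_abs] using this
    _ = _ := by simp only [abs_mul, Function.comp]

lemma summable_innerVec (u : ℕ → ℝ) {α : ℕ → ℝ} (hα : Summable fun i => |α i|) (l : ℕ) :
    Summable fun p : ℕ => |innerVec u α l p| := by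
  have hs := summable_autoCorr hα
  have h0 : ∀ q : ℕ, Summable fun p : ℕ => |autoCorr α ((p : ℤ) + q + 1)| := fun q => by
    refine ((summable_nat_add_iff (q + 1)).2 hs).congr fun p => ?_
    rw [show ((p + (q + 1) : ℕ) : ℤ) = p + q + 1 by push_cast; ring]
  have h1 : ∀ q : ℕ, Summable fun p : ℕ => |autoCorr α ((p : ℤ) - q)| := fun q => by
    rw [← summable_nat_add_iff q]
    refine hs.congr fun p => ?_
    rw [show ((p + q : ℕ) : ℤ) - q = p by push_cast; ring]
  refine Summable.of_nonneg_of_le (fun _ => abs_nonneg _) (fun p => Finset.abs_sum_le_sum_abs _ _)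
    (summable_sum fun q _ => ?_)
  refine Summable.of_nonneg_of_le (fun _ => abs_nonneg _) (fun p => ?_)
    (((h1 q).add (h0 q)).mul_left |u (l - q)|)
  rw [abs_mul]
  gcongr
  exact abs_add_le _ _

lemma summable_solVec {u : ℕ → ℝ} {α : ℕ → ℝ} (hu : Summable fun i => |u i|)
    (hα : Summable fun i => |α i|) (l : ℕ) : Summable fun k : ℕ => |solVec u α l k| := by
  have := summable_norm_sum_mul_range_of_summable_norm (f := fun p : ℕ => innerVec u α l p)
    (g := u) (summable_innerVec u hα l) hu
  refine this.congr fun k => ?_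
  rw [Real.norm_eq_abs, solVec]
  simp only [mul_comm]

lemma pser_solVec {u : ℕ → ℝ} {α : ℕ → ℝ} (hu : Summable fun i => |u i|)
    (hα : Summable fun i => |α i|) (l : ℕ) {z : ℂ} (hz : ‖z‖ ≤ 1) :
    pser (solVec u α l) z = pser u z * pser (fun p : ℕ => innerVec u α l p) z := by
  have hb : ∀ {c : ℕ → ℝ}, (Summable fun i => |c i|) → Summable fun i => ‖(c i : ℂ) * z ^ i‖ := by
    intro c hc
    refine Summable.of_nonneg_of_le (fun _ => norm_nonneg _) (fun i => ?_) hc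
    rw [norm_mul, norm_pow, Complex.norm_real, Real.norm_eq_abs]
    exact mul_le_of_le_one_right (abs_nonneg _) (pow_le_one₀ (norm_nonneg _) hz)
  rw [mul_comm, pser, pser, pser, tsum_mul_tsum_eq_tsum_sum_range_of_summable_norm
    (hb (summable_innerVec u hα l)) (hb hu)]
  refine tsum_congr fun k => ?_
  rw [solVec]
  push_cast
  rw [Finset.sum_mul]
  refine Finset.sum_congr rfl fun p hp => ?_
  rw [Finset.mem_range] at hp
  rw [show z ^ k = z ^ p * z ^ (k - p) by rw [← pow_add]; congr 1; omega]
  ring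

lemma innerVec_neg (u α : ℕ → ℝ) (l : ℕ) (p : ℤ) : innerVec u α l (-1 - p) = innerVec u α l p := by
  unfold innerVec
  refine Finset.sum_congr rfl fun q _ => ?_
  simp only [autoCorr]
  rw [show (-1 - p - (q : ℤ)).natAbs = (p + q + 1).natAbs by omega,
    show (-1 - p + (q : ℤ) + 1).natAbs = (p - q).natAbs by omega, add_comm]

/-- The vectors `solVec u α l` are the columns of `(I + H(u ã))⁻¹`. -/
theorem hasSum_hankel_solVec {u α : ℕ → ℝ} (hu : Summable fun i => |u i|)
    (hα : Summable fun i => |α i|) (hua : ∀ θ, pser u (circ θ) * pser α (circ θ) = 1) (l j : ℕ) :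
    HasSum (fun k : ℕ => fc (quotSym u α) ((j : ℤ) + k + 1) * (solVec u α l k : ℂ))
      (((if j = l then 1 else 0) - solVec u α l j : ℝ) : ℂ) := by
  have hs := summable_innerVec u hα l
  have h1 := hasSum_fc_mul (f := quotSym u α) ((continuous_pser_circ hu).mul
    (continuous_pser_inv_circ hα)) (C := (∑' i, |u i|) * (∑' i, |α i|)) (fun θ => by
      rw [quotSym, norm_mul]
      exact mul_le_mul (norm_pser_le hu (norm_circ θ).le) (norm_pser_le hα (norm_inv_circ θ).le)
        (norm_nonneg _) (tsum_nonneg fun _ => abs_nonneg _)) (summable_solVec hu hα l) (-1) (j + 1)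
  have h2 := hasSum_fc_mul (continuous_pser_circ hu) (fun θ => norm_pser_le hu (norm_circ θ).le)
    hs (-1) (j + 1)
  have hua' : ∀ θ, pser u (circ θ)⁻¹ * pser α (circ θ)⁻¹ = 1 := fun θ => by
    rw [← circ_neg]; exact hua _
  have e : (fun θ => quotSym u α θ * pser (solVec u α l) (circ θ ^ (-1 : ℤ))) = fun θ =>
      pser u (circ θ) * pser (fun p : ℕ => innerVec u α l p) (circ θ ^ (-1 : ℤ)) := by
    funext θ
    rw [zpow_neg, zpow_one, pser_solVec hu hα l (norm_inv_circ θ).le, quotSym]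
    linear_combination pser u (circ θ) * pser (fun p : ℕ => innerVec u α l p) (circ θ)⁻¹ * hua' θ
  rw [e] at h1
  have h3 : HasSum (fun i : ℕ => u i * innerVec u α l ((j : ℤ) - i))
      (∑ q ∈ Finset.range (l + 1), u (l - q) *
        ((if (j : ℤ) - q ≤ 0 then α (-((j : ℤ) - q)).toNat else 0) +
          if (j : ℤ) + q + 1 ≤ 0 then α (-((j : ℤ) + q + 1)).toNat else 0)) := by
    refine (hasSum_sum fun (q : ℕ) _ => (((hasSum_mul_autoCorr hu hα hua ((j : ℤ) - q)).add
      (hasSum_mul_autoCorr hu hα hua ((j : ℤ) + q + 1))).mul_left (u (l - q)))).congr_fun fun i => ?_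
    rw [innerVec, Finset.mul_sum]
    refine Finset.sum_congr rfl fun q _ => ?_
    rw [show (j : ℤ) - i - q = j - q - i by ring, show (j : ℤ) - i + q + 1 = j + q + 1 - i by ring]
    ring
  have h4 : (∑ q ∈ Finset.range (l + 1), u (l - q) *
        ((if (j : ℤ) - q ≤ 0 then α (-((j : ℤ) - q)).toNat else 0) +
          if (j : ℤ) + q + 1 ≤ 0 then α (-((j : ℤ) + q + 1)).toNat else 0)) =
      if j = l then 1 else 0 := by
    have : ∀ q ∈ Finset.range (l + 1), u (l - q) *
        ((if (j : ℤ) - q ≤ 0 then α (-((j : ℤ) - q)).toNat else 0) +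
          if (j : ℤ) + q + 1 ≤ 0 then α (-((j : ℤ) + q + 1)).toNat else 0) =
        if j ≤ q then u (l - q) * α (q - j) else 0 := by
      intro q _
      rw [if_neg (by omega : ¬ (j : ℤ) + q + 1 ≤ 0), add_zero]
      by_cases h : j ≤ q
      · rw [if_pos (by omega), if_pos h, show (-((j : ℤ) - q)).toNat = q - j by omega]
      · rw [if_neg (by omega), if_neg h, mul_zero]
    rw [Finset.sum_congr rfl this]
    by_cases hjl : j ≤ l
    · obtain ⟨d, rfl⟩ := Nat.exists_eq_add_of_le hjl
      rw [add_assoc, Finset.sum_range_add, Finset.sum_eq_zero, zero_add]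
      · have hc := sum_convolution hu hα hua d
        rw [show (if j = j + d then (1 : ℝ) else 0) = if d = 0 then 1 else 0 by simp, ← hc]
        refine Finset.sum_congr rfl fun t _ => ?_
        rw [if_pos (by omega), Nat.add_sub_cancel_left, Nat.add_sub_add_left]
      · intro q hq
        rw [Finset.mem_range] at hq
        rw [if_neg (by omega)]
    · rw [if_neg (by omega)]
      refine Finset.sum_eq_zero fun q hq => ?_
      rw [Finset.mem_range] at hq
      rw [if_neg (by omega)]
  rw [h4] at h3
  have h5 := (hasSum_nat_add_iff' (j + 1)).2 h3
  have h6 : ∑ i ∈ Finset.range (j + 1), u i * innerVec u α l ((j : ℤ) - i) = solVec u α l j := by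
    rw [solVec, ← Finset.sum_range_reflect]
    refine Finset.sum_congr rfl fun p hp => ?_
    rw [Finset.mem_range] at hp
    rw [show j + 1 - 1 - p = j - p by omega, show (j : ℤ) - ((j - p : ℕ) : ℤ) = p by omega]
  rw [h6, ← Complex.hasSum_ofReal] at h5
  have h7 := h5.unique (h2.congr_fun fun p => ?_)
  · rw [h7]
    refine h1.congr_fun fun k => ?_
    rw [mul_comm, show (j : ℤ) + 1 - -1 * k = j + k + 1 by ring]
  · rw [fc_pser hu, if_pos (by omega), show ((j : ℤ) + 1 - -1 * p).toNat = p + (j + 1) by omega,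
      show (j : ℤ) - ((p + (j + 1) : ℕ) : ℤ) = -1 - p by omega, innerVec_neg]
    push_cast; ring

/-- Residues in the partial fraction expansion of `∏ (1 - x_i z) / (1 - y_i z)`. -/
def pfCoeff {ι K : Type*} [Fintype ι] [DecidableEq ι] [Field K] (x y : ι → K) (j : ι) : K :=
  Lagrange.nodalWeight Finset.univ y j * ∏ i, (y j - x i)

lemma prod_sub_eq_pf {ι K : Type*} [Fintype ι] [DecidableEq ι] [Field K] (x y : ι → K)
    (hy : Function.Injective y) (s : K) (hs : ∀ j, s ≠ y j) :
    ∏ i, (s - x i) = (∏ i, (s - y i)) * (1 + ∑ j, pfCoeff x y j / (s - y j)) := by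
  set P : Polynomial K := Lagrange.nodal Finset.univ x - Lagrange.nodal Finset.univ y with hP
  have hdeg : P.degree < (Finset.univ : Finset ι).card := by
    rcases isEmpty_or_nonempty ι with h | h
    · simp [hP, Lagrange.nodal]
    · have h1 : (Lagrange.nodal Finset.univ x).degree = (Finset.univ : Finset ι).card :=
        Lagrange.degree_nodal
      rw [hP, ← h1]
      refine Polynomial.degree_sub_lt_left ?_ Lagrange.nodal_ne_zero ?_
      · rw [Lagrange.degree_nodal, Lagrange.degree_nodal]
      · rw [(Lagrange.nodal_monic).leadingCoeff, (Lagrange.nodal_monic).leadingCoeff]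
  have h2 := Lagrange.eq_interpolate (s := Finset.univ) (v := y) hy.injOn hdeg
  have h3 := congrArg (Polynomial.eval s) h2
  rw [Lagrange.eval_interpolate_not_at_node _ (fun i _ => hs i), hP, Polynomial.eval_sub,
    Lagrange.eval_nodal, Lagrange.eval_nodal, sub_eq_iff_eq_add] at h3
  rw [h3, mul_add, mul_one, add_comm]
  congr 2
  refine Finset.sum_congr rfl fun j _ => ?_
  rw [Polynomial.eval_sub, Lagrange.eval_nodal, Lagrange.eval_nodal,
    Finset.prod_eq_zero (f := fun i => y j - y i) (Finset.mem_univ j) (sub_self (y j)), sub_zero,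
    pfCoeff, div_eq_mul_inv]
  ring

lemma prod_div_eq_pf {ι K : Type*} [Fintype ι] [DecidableEq ι] [Field K] (x y : ι → K)
    (hy : Function.Injective y) (z : K) (hz : ∀ j, 1 - y j * z ≠ 0) :
    ∏ i, (1 - x i * z) / (1 - y i * z) = 1 + z * ∑ j, pfCoeff x y j / (1 - y j * z) := by
  by_cases h0 : z = 0
  · simp [h0]
  have e : ∀ t : K, 1 - t * z = z * (z⁻¹ - t) := fun t => by field_simp
  have hs : ∀ j, z⁻¹ ≠ y j := fun j h => hz j (by rw [e, h, sub_self, mul_zero])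
  have := prod_sub_eq_pf x y hy z⁻¹ hs
  rw [Finset.prod_div_distrib]
  simp only [e, Finset.prod_mul_distrib]
  rw [this]
  have h1 : ∏ i, (z⁻¹ - y i) ≠ 0 := Finset.prod_ne_zero_iff.2 fun i _ => sub_ne_zero.2 (hs i)
  have h2 : ∏ _i : ι, z ≠ 0 := Finset.prod_ne_zero_iff.2 fun i _ => h0
  rw [mul_div_mul_left _ _ h2, mul_div_cancel_left₀ _ h1, Finset.mul_sum]
  congr 1
  refine Finset.sum_congr rfl fun j _ => ?_
  rw [mul_div_assoc', mul_div_mul_left _ _ h0]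

/-- Power series coefficients of `∏ (1 - x_i z) / (1 - y_i z)`. -/
def ratCoeff {ι : Type*} [Fintype ι] [DecidableEq ι] (x y : ι → ℝ) : ℕ → ℝ
  | 0 => 1
  | N + 1 => ∑ j, pfCoeff x y j * y j ^ N

lemma pfCoeff_ofReal {ι : Type*} [Fintype ι] [DecidableEq ι] (x y : ι → ℝ) (j : ι) :
    pfCoeff (fun i => (x i : ℂ)) (fun i => (y i : ℂ)) j = (pfCoeff x y j : ℝ) := by
  simp [pfCoeff, Lagrange.nodalWeight]

lemma summable_ratCoeff {ι : Type*} [Fintype ι] [DecidableEq ι] (x y : ι → ℝ)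
    (hy1 : ∀ i, |y i| < 1) : Summable fun N => |ratCoeff x y N| := by
  rw [← summable_nat_add_iff 1]
  refine Summable.of_nonneg_of_le (fun _ => abs_nonneg _) (fun N => Finset.abs_sum_le_sum_abs _ _)
    (summable_sum fun j _ => ?_)
  simp only [abs_mul, abs_pow]
  exact (summable_geometric_of_lt_one (abs_nonneg _) (hy1 j)).mul_left _

lemma one_sub_mul_ne_zero {y : ℝ} (hy : |y| < 1) {z : ℂ} (hz : ‖z‖ ≤ 1) :
    1 - (y : ℂ) * z ≠ 0 := by
  intro h
  have h1 : ‖(y : ℂ) * z‖ = 1 := by rw [← sub_eq_zero.1 h, norm_one]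
  rw [norm_mul, Complex.norm_real, Real.norm_eq_abs] at h1
  nlinarith [norm_nonneg z, abs_nonneg y]

lemma hasSum_ratCoeff {ι : Type*} [Fintype ι] [DecidableEq ι] (x y : ι → ℝ)
    (hy : Function.Injective y) (hy1 : ∀ i, |y i| < 1) {z : ℂ} (hz : ‖z‖ ≤ 1) :
    HasSum (fun N => (ratCoeff x y N : ℂ) * z ^ N) (∏ i, (1 - x i * z) / (1 - y i * z)) := by
  rw [prod_div_eq_pf (fun i => (x i : ℂ)) (fun i => (y i : ℂ))
    (fun a b h => hy (Complex.ofReal_injective h)) z (fun j => one_sub_mul_ne_zero (hy1 j) hz)]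
  rw [← hasSum_nat_add_iff' 1]
  simp only [Finset.range_one, Finset.sum_singleton, ratCoeff, pow_zero, mul_one,
    Complex.ofReal_one, add_sub_cancel_left]
  simp only [pfCoeff_ofReal x y]
  rw [Finset.mul_sum]
  refine (hasSum_sum (f := fun j N => z * (((pfCoeff x y j : ℝ) : ℂ) * ((y j : ℂ) * z) ^ N))
    fun j _ => ?_).congr_fun fun N => ?_
  · have hlt : ‖(y j : ℂ) * z‖ < 1 := by
      rw [norm_mul, Complex.norm_real, Real.norm_eq_abs]
      nlinarith [norm_nonneg z, abs_nonneg (y j), hy1 j]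
    have := ((hasSum_geometric_of_norm_lt_one hlt).mul_left ((pfCoeff x y j : ℝ) : ℂ)).mul_left z
    rwa [← div_eq_mul_inv] at this
  · push_cast
    rw [Finset.sum_mul]
    refine Finset.sum_congr rfl fun j _ => ?_
    rw [mul_pow, pow_succ]; ring

lemma pser_ratCoeff {ι : Type*} [Fintype ι] [DecidableEq ι] (x y : ι → ℝ)
    (hy : Function.Injective y) (hy1 : ∀ i, |y i| < 1) {z : ℂ} (hz : ‖z‖ ≤ 1) :
    pser (ratCoeff x y) z = ∏ i, (1 - x i * z) / (1 - y i * z) :=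
  (hasSum_ratCoeff x y hy hy1 hz).tsum_eq

/-- Two interlacing families of nodes in `(-1, 1)`. -/
structure Interlacing {ι : Type*} (x y : ι → ℝ) : Prop where
  lower : ∀ i, -1 < x i
  upper : ∀ i, y i < 1
  lt : ∀ i, x i < y i
  sep : ∀ i j, i ≠ j → y i < x j ∨ y j < x i

namespace Interlacing
variable {ι : Type*} {x y : ι → ℝ}

lemma abs_x (h : Interlacing x y) (i : ι) : |x i| < 1 :=
  abs_lt.2 ⟨h.lower i, (h.lt i).trans (h.upper i)⟩

lemma abs_y (h : Interlacing x y) (i : ι) : |y i| < 1 :=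
  abs_lt.2 ⟨(h.lower i).trans (h.lt i), h.upper i⟩

lemma inj_x (h : Interlacing x y) : Function.Injective x := by
  intro i j hij
  by_contra hne
  rcases h.sep i j hne with h1 | h1
  · linarith [h.lt i]
  · linarith [h.lt j]

lemma inj_y (h : Interlacing x y) : Function.Injective y := by
  intro i j hij
  by_contra hne
  rcases h.sep i j hne with h1 | h1
  · linarith [h.lt j]
  · linarith [h.lt i]

lemma y_ne_x (h : Interlacing x y) (i j : ι) : y i ≠ x j := by
  by_cases hij : i = j
  · subst hij; exact (h.lt i).ne'
  · rcases h.sep i j hij with h1 | h1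
    · exact h1.ne
    · exact ((h1.trans' (h.lt j)).trans (h.lt i)).ne'

lemma pfCoeff_pos [Fintype ι] [DecidableEq ι] (h : Interlacing x y) (j : ι) :
    0 < pfCoeff x y j := by
  rw [pfCoeff, Lagrange.nodalWeight, ← Finset.mul_prod_erase _ _ (Finset.mem_univ j), mul_left_comm,
    ← Finset.prod_mul_distrib]
  refine mul_pos (sub_pos.2 (h.lt j)) (Finset.prod_pos fun i hi => ?_)
  rw [Finset.mem_erase] at hi
  rw [inv_mul_eq_div]
  rcases h.sep i j hi.1 with h1 | h1
  · exact div_pos (by linarith [h.lt i, h.lt j]) (by linarith [h.lt j])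
  · exact div_pos_of_neg_of_neg (by linarith [h.lt i]) (by linarith [h.lt i])

end Interlacing

/-- The weights `R_j` of the Hankel operator of a rational symbol. -/
def hankelWeight {ι : Type*} [Fintype ι] [DecidableEq ι] (x y : ι → ℝ) (j : ι) : ℝ :=
  pfCoeff x y j * ∏ i, (1 - y i * y j) / (1 - x i * y j)

lemma one_sub_mul_pos {a b : ℝ} (ha : |a| < 1) (hb : |b| < 1) : 0 < 1 - a * b := by
  have h1 : |a * b| < 1 := by
    rw [abs_mul]; nlinarith [abs_nonneg a, abs_nonneg b]
  linarith [le_abs_self (a * b)]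

lemma Interlacing.hankelWeight_pos {ι : Type*} [Fintype ι] [DecidableEq ι] {x y : ι → ℝ}
    (h : Interlacing x y) (j : ι) : 0 < hankelWeight x y j :=
  mul_pos (h.pfCoeff_pos j) (Finset.prod_pos fun i _ =>
    div_pos (one_sub_mul_pos (h.abs_y i) (h.abs_y j)) (one_sub_mul_pos (h.abs_x i) (h.abs_y j)))

/-- The unimodular symbol of the Hankel operator. -/
def ratSym {ι : Type*} [Fintype ι] [DecidableEq ι] (x y : ι → ℝ) : ℝ → ℂ :=
  quotSym (ratCoeff x y) (ratCoeff y x)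

section
variable {ι : Type*} [Fintype ι] [DecidableEq ι] {x y : ι → ℝ}

lemma fc_ratSym (h : Interlacing x y) (m : ℕ) :
    fc (ratSym x y) ((m : ℤ) + 1) = (∑ j, hankelWeight x y j * y j ^ m : ℝ) := by
  have hu := summable_ratCoeff x y h.abs_y
  have hα := summable_ratCoeff y x h.abs_x
  have h1 := hasSum_fc_mul (continuous_pser_circ hu) (fun θ => norm_pser_le hu (norm_circ θ).le)
    hα (-1) (m + 1)
  simp only [zpow_neg, zpow_one, fc_pser hu] at h1
  refine h1.unique ?_
  push_cast
  have h2 : HasSum (fun N => ∑ j, ((pfCoeff x y j * y j ^ m : ℝ) : ℂ) *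
      ((ratCoeff y x N : ℂ) * (y j : ℂ) ^ N)) (∑ j, ((pfCoeff x y j * y j ^ m : ℝ) : ℂ) *
        ∏ i, (1 - (y i : ℂ) * y j) / (1 - (x i : ℂ) * y j)) :=
    hasSum_sum fun j _ => (hasSum_ratCoeff y x h.inj_x h.abs_x
      (by rw [Complex.norm_real]; exact (h.abs_y j).le)).mul_left _
  have e : (∑ j, (hankelWeight x y j : ℂ) * (y j : ℂ) ^ m) = (∑ j, ((pfCoeff x y j * y j ^ m : ℝ) : ℂ) *
        ∏ i, (1 - (y i : ℂ) * y j) / (1 - (x i : ℂ) * y j)) := by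
    refine Finset.sum_congr rfl fun j _ => ?_
    rw [hankelWeight]; push_cast; ring
  rw [e]
  refine h2.congr_fun fun i => ?_
  rw [if_pos (by omega), show ((m : ℤ) + 1 - -1 * i).toNat = (m + i) + 1 by omega]
  simp only [ratCoeff]
  push_cast
  rw [Finset.mul_sum]
  refine Finset.sum_congr rfl fun j _ => ?_
  rw [pow_add]; ring

lemma pser_mul_ratCoeff (h : Interlacing x y) (θ : ℝ) :
    pser (ratCoeff x y) (circ θ) * pser (ratCoeff y x) (circ θ) = 1 := by
  rw [pser_ratCoeff x y h.inj_y h.abs_y (norm_circ θ).le,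
    pser_ratCoeff y x h.inj_x h.abs_x (norm_circ θ).le, ← Finset.prod_mul_distrib]
  refine Finset.prod_eq_one fun i _ => ?_
  rw [div_mul_div_comm, mul_comm, div_self]
  exact mul_ne_zero (one_sub_mul_ne_zero (h.abs_y i) (norm_circ θ).le)
    (one_sub_mul_ne_zero (h.abs_x i) (norm_circ θ).le)

/-- The solution vectors for the rational symbol. -/
def ratSol (x y : ι → ℝ) (l k : ℕ) : ℝ := solVec (ratCoeff x y) (ratCoeff y x) l k

/-- Values at `y_i` of the generating function of the solution vector. -/
def ratVal (x y : ι → ℝ) (l : ℕ) (i : ι) : ℝ := ∑' k, y i ^ k * ratSol x y l k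

lemma summable_ratVal (h : Interlacing x y) (l : ℕ) (i : ι) :
    Summable fun k => y i ^ k * ratSol x y l k := by
  refine Summable.of_norm_bounded (summable_solVec (summable_ratCoeff x y h.abs_y)
    (summable_ratCoeff y x h.abs_x) l) fun k => ?_
  rw [norm_mul, norm_pow, Real.norm_eq_abs, Real.norm_eq_abs]
  exact mul_le_of_le_one_left (abs_nonneg _) (pow_le_one₀ (abs_nonneg _) (h.abs_y i).le)

lemma hasSum_hankel_ratSol (h : Interlacing x y) (l j : ℕ) :
    HasSum (fun k : ℕ => (∑ i, hankelWeight x y i * y i ^ (j + k)) * ratSol x y l k)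
      ((if j = l then 1 else 0) - ratSol x y l j) := by
  have := hasSum_hankel_solVec (summable_ratCoeff x y h.abs_y) (summable_ratCoeff y x h.abs_x)
    (pser_mul_ratCoeff h) l j
  rw [← Complex.hasSum_ofReal]
  refine this.congr_fun fun k => ?_
  have e := fc_ratSym h (j + k)
  push_cast at e ⊢
  rw [← e]; rfl

lemma ratSol_eq (h : Interlacing x y) (l j : ℕ) :
    ratSol x y l j = (if j = l then 1 else 0) -
      ∑ i, hankelWeight x y i * ratVal x y l i * y i ^ j := by
  have h1 := hasSum_hankel_ratSol h l j
  have h2 : HasSum (fun k => ∑ i, hankelWeight x y i * y i ^ j * (y i ^ k * ratSol x y l k))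
      (∑ i, hankelWeight x y i * y i ^ j * ratVal x y l i) :=
    hasSum_sum fun i _ => (summable_ratVal h l i).hasSum.mul_left _
  have h3 := h1.unique (h2.congr_fun fun k => by
    rw [Finset.sum_mul]
    exact Finset.sum_congr rfl fun i _ => by rw [pow_add]; ring)
  have h4 : ∑ i, hankelWeight x y i * ratVal x y l i * y i ^ j =
      ∑ i, hankelWeight x y i * y i ^ j * ratVal x y l i :=
    Finset.sum_congr rfl fun i _ => by ring
  rw [h4]; linarith

lemma ratVal_eq (h : Interlacing x y) (l : ℕ) (i : ι) :
    ratVal x y l i = y i ^ l -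
      ∑ i', 1 / (1 - y i * y i') * (hankelWeight x y i' * ratVal x y l i') := by
  have h1 : HasSum (fun k => y i ^ k * (if k = l then 1 else 0)) (y i ^ l) := by
    convert hasSum_ite_eq l (y i ^ l) using 2 with k
    split_ifs with hk
    · rw [hk, mul_one]
    · rw [mul_zero]
  have h2 : HasSum (fun k => ∑ i', (y i * y i') ^ k * (hankelWeight x y i' * ratVal x y l i'))
      (∑ i', 1 / (1 - y i * y i') * (hankelWeight x y i' * ratVal x y l i')) := by
    refine hasSum_sum fun i' _ => ?_
    rw [one_div]
    refine (hasSum_geometric_of_abs_lt_one ?_).mul_right _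
    rw [abs_mul]
    nlinarith [abs_nonneg (y i), abs_nonneg (y i'), h.abs_y i, h.abs_y i']
  refine ((summable_ratVal h l i).hasSum).unique ((h1.sub h2).congr_fun fun k => ?_)
  rw [ratSol_eq h, mul_sub, Finset.mul_sum]
  congr 1
  exact Finset.sum_congr rfl fun i' _ => by rw [mul_pow]; ring

end

section
variable {ι : Type*} [Fintype ι] [DecidableEq ι]

lemma det_one_add_mul_diagonal_pos {C : Matrix ι ι ℝ} (hC : C.PosSemidef) {w : ι → ℝ}
    (hw : ∀ i, 0 ≤ w i) : 0 < (1 + C * Matrix.diagonal w).det := by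
  set S : Matrix ι ι ℝ := Matrix.diagonal fun i => √(w i) with hS
  have e : Matrix.diagonal w = S * S := by
    rw [hS, Matrix.diagonal_mul_diagonal]
    congr 1; funext i; exact (Real.mul_self_sqrt (hw i)).symm
  have hST : S.conjTranspose = S := by
    rw [hS, Matrix.diagonal_conjTranspose]; congr 1
  rw [e, ← Matrix.mul_assoc, Matrix.det_one_add_mul_comm]
  have h1 : (S * (C * S)).PosSemidef := by
    have := hC.conjTranspose_mul_mul_same S
    rwa [hST, Matrix.mul_assoc] at this
  exact (Matrix.PosDef.one.add_posSemidef h1).det_pos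

lemma log_det_update_sub {C : Matrix ι ι ℝ} (hC : C.PosSemidef) {w : ι → ℝ}
    (hw : ∀ i, 0 ≤ w i) (i : ι) {t : ℝ} (ht : 0 ≤ t) :
    0 ≤ Real.log (1 + C * Matrix.diagonal (w + Pi.single i t)).det -
        Real.log (1 + C * Matrix.diagonal w).det ∧
      Real.log (1 + C * Matrix.diagonal (w + Pi.single i t)).det -
        Real.log (1 + C * Matrix.diagonal w).det ≤ t * C i i := by
  set Q := 1 + C * Matrix.diagonal w with hQ
  have hdet : 0 < Q.det := det_one_add_mul_diagonal_pos hC hw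
  have hunit : IsUnit Q.det := hdet.ne'.isUnit
  set v : ι → ℝ := Matrix.mulVec Q⁻¹ (fun j => C j i) with hv
  have hQv : ∀ j, v j + ∑ k, C j k * (w k * v k) = C j i := by
    intro j
    have h1 : Matrix.mulVec Q v = fun j => C j i := by
      rw [hv, Matrix.mulVec_mulVec, Matrix.mul_nonsing_inv _ hunit, Matrix.one_mulVec]
    have h2 := congrFun h1 j
    rw [hQ, Matrix.add_mulVec, Matrix.one_mulVec, ← Matrix.mulVec_mulVec, Pi.add_apply,
      show Matrix.mulVec (Matrix.diagonal w) v = fun k => w k * v k from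
        funext fun k => Matrix.mulVec_diagonal w v k] at h2
    simpa only [Matrix.mulVec, dotProduct] using h2
  have hsymm : ∀ j k, C j k = C k j := fun j k => by
    have := hC.1.apply k j
    simpa using this
  have hq : ∀ x : ι → ℝ, 0 ≤ ∑ j, x j * ∑ k, C j k * x k := fun x => by
    simpa [Matrix.mulVec, dotProduct] using hC.dotProduct_mulVec_nonneg x
  have hE : 0 ≤ ∑ j, w j * v j ^ 2 := Finset.sum_nonneg fun j _ => mul_nonneg (hw j) (sq_nonneg _)
  have hv0 : 0 ≤ v i := by
    have h1 := hq (fun j => (if j = i then 1 else 0) - w j * v j)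
    have h2 : ∀ j, ∑ k, C j k * ((if k = i then 1 else 0) - w k * v k) = v j := fun j => by
      simp only [mul_sub, Finset.sum_sub_distrib, mul_ite, mul_one, mul_zero,
        Finset.sum_ite_eq', Finset.mem_univ, if_true]
      linarith [hQv j]
    simp only [h2, sub_mul, Finset.sum_sub_distrib, ite_mul, one_mul, zero_mul,
      Finset.sum_ite_eq', Finset.mem_univ, if_true] at h1
    have h3 : ∑ j, w j * v j * v j = ∑ j, w j * v j ^ 2 :=
      Finset.sum_congr rfl fun j _ => by ring
    linarith
  have hv1 : v i ≤ C i i := by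
    have h1 := hq (fun j => w j * v j)
    have h2 : ∑ k, C i k * (w k * v k) =
        ∑ j, w j * v j ^ 2 + ∑ j, w j * v j * ∑ k, C j k * (w k * v k) := by
      rw [← Finset.sum_add_distrib]
      refine Finset.sum_congr rfl fun j _ => ?_
      rw [hsymm i j, ← hQv j]; ring
    linarith [hQv i]
  have hkey : (1 + C * Matrix.diagonal (w + Pi.single i t)).det = Q.det * (1 + t * v i) := by
    have e : (1 + C * Matrix.diagonal (w + Pi.single i t)) =
        Q + Matrix.replicateCol Unit (fun j => C j i) *
          Matrix.replicateRow Unit (Pi.single i t) := by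
      ext j k
      have h1 : (Matrix.replicateCol Unit (fun j => C j i) *
          Matrix.replicateRow Unit (Pi.single i t)) j k = C j i * (Pi.single i t : ι → ℝ) k := by
        simp [Matrix.mul_apply]
      rw [Matrix.add_apply, Matrix.add_apply, h1]
      simp only [hQ, Matrix.add_apply, Matrix.mul_diagonal, Pi.add_apply]
      by_cases hk : k = i
      · subst hk; ring
      · simp [hk]
    rw [e, Matrix.det_add_replicateCol_mul_replicateRow hunit]
    congr 1
    rw [Matrix.det_unique, Matrix.add_apply, Matrix.one_apply_eq, Matrix.mul_assoc,
      Matrix.mul_apply]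
    congr 1
    simp only [Matrix.replicateRow_apply, Pi.single_apply, ite_mul, zero_mul, Finset.sum_ite_eq',
      Finset.mem_univ, if_true]
    rfl
  have hpos : 0 < 1 + t * v i := by positivity
  rw [hkey, Real.log_mul hdet.ne' hpos.ne', add_sub_cancel_left]
  refine ⟨Real.log_nonneg (by nlinarith), ?_⟩
  calc _ ≤ 1 + t * v i - 1 := Real.log_le_sub_one_of_pos hpos
    _ ≤ _ := by nlinarith

lemma abs_log_det_update_sub {C : Matrix ι ι ℝ} (hC : C.PosSemidef) {w : ι → ℝ}
    (hw : ∀ i, 0 ≤ w i) (i : ι) {b : ℝ} (hb : 0 ≤ b) :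
    |Real.log (1 + C * Matrix.diagonal (Function.update w i b)).det -
      Real.log (1 + C * Matrix.diagonal w).det| ≤ |b - w i| * C i i := by
  rcases le_total (w i) b with h | h
  · have e : Function.update w i b = w + Pi.single i (b - w i) := by
      funext j
      by_cases hj : j = i
      · subst hj; simp
      · simp [hj]
    obtain ⟨h1, h2⟩ := log_det_update_sub hC hw i (sub_nonneg.2 h)
    rw [e, abs_of_nonneg h1, abs_of_nonneg (sub_nonneg.2 h)]
    exact h2
  · have hw' : ∀ j, 0 ≤ Function.update w i b j := fun j => by
      by_cases hj : j = i
      · subst hj; simpa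
      · simpa [hj] using hw j
    have e : w = Function.update w i b + Pi.single i (w i - b) := by
      funext j
      by_cases hj : j = i
      · subst hj; simp
      · simp [hj]
    obtain ⟨h1, h2⟩ := log_det_update_sub hC hw' i (sub_nonneg.2 h)
    rw [← e] at h1 h2
    rw [abs_sub_comm, abs_of_nonneg h1, abs_sub_comm, abs_of_nonneg (sub_nonneg.2 h)]
    exact h2

lemma abs_log_det_sub_le {C : Matrix ι ι ℝ} (hC : C.PosSemidef) {w w' : ι → ℝ}
    (hw : ∀ i, 0 ≤ w i) (hw' : ∀ i, 0 ≤ w' i) :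
    |Real.log (1 + C * Matrix.diagonal w').det - Real.log (1 + C * Matrix.diagonal w).det| ≤
      ∑ i, |w' i - w i| * C i i := by
  suffices H : ∀ s : Finset ι, |Real.log (1 + C * Matrix.diagonal (s.piecewise w' w)).det -
      Real.log (1 + C * Matrix.diagonal w).det| ≤ ∑ i ∈ s, |w' i - w i| * C i i by
    simpa using H Finset.univ
  intro s
  induction s using Finset.induction_on with
  | empty => simp
  | insert i s hi ih =>
    have h0 : ∀ j, 0 ≤ s.piecewise w' w j := fun j => by
      by_cases hj : j ∈ s
      · simpa [hj] using hw' j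
      · simpa [hj] using hw j
    have h1 := abs_log_det_update_sub hC h0 i (hw' i)
    rw [Finset.piecewise_eq_of_notMem _ _ _ hi] at h1
    rw [Finset.piecewise_insert, Finset.sum_insert hi]
    calc _ ≤ _ := abs_sub_le _ (Real.log (1 + C * Matrix.diagonal (s.piecewise w' w)).det) _
      _ ≤ _ := add_le_add h1 ih

/-- The Gram matrix `(y_i y_j)^n / (1 - y_i y_j)`. -/
def gramMat (n : ℕ) (y : ι → ℝ) : Matrix ι ι ℝ :=
  Matrix.of fun i j => (y i * y j) ^ n / (1 - y i * y j)

lemma abs_mul_lt_one {a b : ℝ} (ha : |a| < 1) (hb : |b| < 1) : |a * b| < 1 := by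
  rw [abs_mul]; nlinarith [abs_nonneg a, abs_nonneg b]

lemma hasSum_gram_quadratic (n : ℕ) {y : ι → ℝ} (hy : ∀ i, |y i| < 1) (v : ι → ℝ) :
    HasSum (fun k => (∑ i, v i * y i ^ (n + k)) ^ 2)
      (∑ i, v i * ∑ j, gramMat n y i j * v j) := by
  have h1 : HasSum (fun k => ∑ i, ∑ j, v i * (y i * y j) ^ n * v j * (y i * y j) ^ k)
      (∑ i, ∑ j, v i * (y i * y j) ^ n * v j * (1 - y i * y j)⁻¹) :=
    hasSum_sum fun i _ => hasSum_sum fun j _ =>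
      (hasSum_geometric_of_abs_lt_one (abs_mul_lt_one (hy i) (hy j))).mul_left _
  have e : (∑ i, v i * ∑ j, gramMat n y i j * v j) =
      ∑ i, ∑ j, v i * (y i * y j) ^ n * v j * (1 - y i * y j)⁻¹ := by
    refine Finset.sum_congr rfl fun i _ => ?_
    rw [Finset.mul_sum]
    refine Finset.sum_congr rfl fun j _ => ?_
    rw [gramMat, Matrix.of_apply, div_eq_mul_inv]; ring
  rw [e]
  refine h1.congr_fun fun k => ?_
  rw [sq, Finset.sum_mul_sum]
  refine Finset.sum_congr rfl fun i _ => Finset.sum_congr rfl fun j _ => ?_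
  rw [pow_add, pow_add, mul_pow, mul_pow]; ring

lemma gramMat_posSemidef (n : ℕ) {y : ι → ℝ} (hy : ∀ i, |y i| < 1) : (gramMat n y).PosSemidef := by
  refine Matrix.PosSemidef.of_dotProduct_mulVec_nonneg ?_ fun v => ?_
  · ext i j
    simp [gramMat, mul_comm (y i)]
  · have := (hasSum_gram_quadratic n hy v).nonneg fun k => sq_nonneg _
    simpa [Matrix.mulVec, dotProduct] using this

/-- The Fredholm determinant of the compression of a finite rank Hankel operator. -/
def gramDet (n : ℕ) (x y : ι → ℝ) : ℝ :=
  (1 + gramMat n y * Matrix.diagonal (hankelWeight x y)).det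

variable {x y : ι → ℝ}

lemma gramDet_pos (h : Interlacing x y) (n : ℕ) : 0 < gramDet n x y :=
  det_one_add_mul_diagonal_pos (gramMat_posSemidef n h.abs_y) fun i => (h.hankelWeight_pos i).le

/-- The Toeplitz-plus-Hankel section of a rational symbol. -/
def ratMat (n : ℕ) (x y : ι → ℝ) : Matrix (Fin n) (Fin n) ℝ := Matrix.of fun j k : Fin n =>
  autoCorr (ratCoeff y x) ((j : ℤ) - k) + autoCorr (ratCoeff y x) ((j : ℤ) + k + 1)

lemma det_ratSol_eq_det_ratMat (n : ℕ) (x y : ι → ℝ) :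
    (Matrix.of fun k l : Fin n => ratSol x y l k).det = (ratMat n x y).det := by
  set U : Matrix (Fin n) (Fin n) ℝ := Matrix.of fun k p : Fin n =>
    if p ≤ k then ratCoeff x y ((k : ℕ) - p) else 0 with hU
  have hdet : U.det = 1 := by
    rw [Matrix.det_of_isLowerTriangular]
    · refine Finset.prod_eq_one fun i _ => ?_
      simp [hU, ratCoeff]
    · intro i j hij
      simp only [hU, Matrix.of_apply]
      rw [if_neg]
      simpa using hij
  have hsum : ∀ (k : Fin n) (F : ℕ → ℝ), ∑ p : Fin n, U k p * F p =
      ∑ p ∈ Finset.range ((k : ℕ) + 1), ratCoeff x y (k - p) * F p := by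
    intro k F
    have h1 : ∑ p : Fin n, U k p * F p = ∑ p ∈ Finset.range n,
        (if p ≤ (k : ℕ) then ratCoeff x y (k - p) else 0) * F p := by
      rw [Finset.sum_range]
      rfl
    rw [h1, ← Finset.sum_subset (Finset.range_subset_range.2 k.2)]
    · refine Finset.sum_congr rfl fun p hp => ?_
      rw [Finset.mem_range] at hp
      rw [if_pos (by omega)]
    · intro p _ hp
      rw [Finset.mem_range] at hp
      rw [if_neg (by omega), zero_mul]
  have : (Matrix.of fun k l : Fin n => ratSol x y l k) = U * (ratMat n x y * U.transpose) := by
    ext k l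
    simp only [Matrix.of_apply, Matrix.mul_apply, Matrix.transpose_apply, ratMat]
    rw [ratSol, solVec, ← hsum k (fun p => innerVec (ratCoeff x y) (ratCoeff y x) l p)]
    refine Finset.sum_congr rfl fun p _ => ?_
    congr 1
    rw [innerVec, ← hsum l (fun q => autoCorr (ratCoeff y x) ((p : ℤ) - q) +
      autoCorr (ratCoeff y x) ((p : ℤ) + q + 1))]
    refine Finset.sum_congr rfl fun q _ => ?_
    rw [mul_comm]
  rw [this, Matrix.det_mul, Matrix.det_mul, Matrix.det_transpose, hdet, one_mul, mul_one]

theorem det_ratSol (h : Interlacing x y) (n : ℕ) :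
    (Matrix.of fun k l : Fin n => ratSol x y l k).det = gramDet n x y / gramDet 0 x y := by
  set D := Matrix.diagonal (hankelWeight x y) with hD
  set Q := 1 + gramMat 0 y * D with hQ
  set Y : Matrix ι (Fin n) ℝ := Matrix.of fun i k => y i ^ (k : ℕ) with hY
  set F : Matrix ι (Fin n) ℝ := Matrix.of fun i l => ratVal x y l i with hF
  have hdet : 0 < Q.det := gramDet_pos h 0
  have hunit : IsUnit Q.det := hdet.ne'.isUnit
  have hQF : Q * F = Y := by
    ext i l
    rw [hQ, Matrix.add_mul, Matrix.one_mul, Matrix.add_apply, Matrix.mul_assoc, Matrix.mul_apply]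
    simp only [hF, hY, hD, Matrix.of_apply, Matrix.diagonal_mul, gramMat, pow_zero]
    have := ratVal_eq h l i
    linarith
  have hF' : F = Q⁻¹ * Y := by
    rw [← hQF, ← Matrix.mul_assoc, Matrix.nonsing_inv_mul _ hunit, Matrix.one_mul]
  have h1 : (Matrix.of fun k l : Fin n => ratSol x y l k) = 1 - Y.transpose * (D * F) := by
    ext k l
    rw [Matrix.of_apply, ratSol_eq h, Matrix.sub_apply, Matrix.mul_apply, Matrix.one_apply]
    congr 1
    · simp only [Fin.ext_iff]
    · refine Finset.sum_congr rfl fun i _ => ?_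
      simp only [hD, hY, hF, Matrix.transpose_apply, Matrix.diagonal_mul, Matrix.of_apply]
      ring
  have h2 : 1 + gramMat n y * D = Q - Y * Y.transpose * D := by
    rw [hQ, add_sub_assoc, ← Matrix.sub_mul]
    congr 2
    ext i j
    simp only [gramMat, Matrix.sub_apply, Matrix.mul_apply, hY, Matrix.of_apply,
      Matrix.transpose_apply]
    have hp := one_sub_mul_pos (h.abs_y i) (h.abs_y j)
    have hs : ∑ k : Fin n, y i ^ (k : ℕ) * y j ^ (k : ℕ) =
        ∑ k ∈ Finset.range n, (y i * y j) ^ k := by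
      rw [Finset.sum_range]; simp only [mul_pow]
    rw [hs, eq_sub_iff_add_eq, pow_zero, div_add' _ _ _ hp.ne', geom_sum_mul_neg,
      add_sub_cancel]
  rw [h1, eq_div_iff (gramDet_pos h 0).ne']
  change _ * Q.det = (1 + gramMat n y * D).det
  have h3 : Q - Y * Y.transpose * D = (1 - Y * (Y.transpose * (D * Q⁻¹))) * Q := by
    rw [Matrix.sub_mul, Matrix.one_mul, Matrix.mul_assoc Y, Matrix.mul_assoc Y,
      Matrix.mul_assoc Y.transpose, Matrix.mul_assoc D, Matrix.nonsing_inv_mul _ hunit,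
      Matrix.mul_one]
  rw [h2, h3, Matrix.det_mul, hF', Matrix.det_one_sub_mul_comm Y, Matrix.mul_assoc Y.transpose,
    Matrix.mul_assoc D]
end

section
variable {ι : Type*} [Fintype ι] [DecidableEq ι] {x y : ι → ℝ}

/-- The coefficients of the Hankel matrix attached to interlacing nodes. -/
def hankelSeq (x y : ι → ℝ) (m : ℕ) : ℝ := ∑ j, hankelWeight x y j * y j ^ m

lemma fc_ratSym' (h : Interlacing x y) (m : ℕ) :
    fc (ratSym x y) ((m : ℤ) + 1) = (hankelSeq x y m : ℝ) := fc_ratSym h m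

lemma continuous_ratSym (h : Interlacing x y) : Continuous (ratSym x y) :=
  (continuous_pser_circ (summable_ratCoeff x y h.abs_y)).mul
    (continuous_pser_inv_circ (summable_ratCoeff y x h.abs_x))

lemma ratSym_eq (h : Interlacing x y) (θ : ℝ) :
    ratSym x y θ = (∏ i, (1 - x i * circ θ) / (1 - y i * circ θ)) *
      ∏ i, (1 - y i * (circ θ)⁻¹) / (1 - x i * (circ θ)⁻¹) := by
  rw [ratSym, quotSym, pser_ratCoeff x y h.inj_y h.abs_y (norm_circ θ).le,
    pser_ratCoeff y x h.inj_x h.abs_x (norm_inv_circ θ).le]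

lemma conj_circ (θ : ℝ) : (starRingEnd ℂ) (circ θ) = (circ θ)⁻¹ := by
  rw [inv_circ, circ, ← Complex.exp_conj]; congr 1; simp

lemma norm_one_sub_mul_inv_circ (t θ : ℝ) : ‖1 - (t : ℂ) * (circ θ)⁻¹‖ = ‖1 - (t : ℂ) * circ θ‖ := by
  rw [← conj_circ, ← Complex.norm_conj]
  simp

lemma norm_ratSym (h : Interlacing x y) (θ : ℝ) : ‖ratSym x y θ‖ = 1 := by
  rw [ratSym_eq h, ← Finset.prod_mul_distrib, norm_prod]
  refine Finset.prod_eq_one fun i _ => ?_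
  rw [norm_mul, norm_div, norm_div, norm_one_sub_mul_inv_circ, norm_one_sub_mul_inv_circ]
  have h1 := norm_ne_zero_iff.2 (one_sub_mul_ne_zero (h.abs_x i) (norm_circ θ).le)
  have h2 := norm_ne_zero_iff.2 (one_sub_mul_ne_zero (h.abs_y i) (norm_circ θ).le)
  rw [div_mul_div_comm, mul_comm, div_self (mul_ne_zero h2 h1)]

lemma hankelSeq_even_nonneg (h : Interlacing x y) (m : ℕ) : 0 ≤ hankelSeq x y (2 * m) :=
  Finset.sum_nonneg fun j _ => mul_nonneg (h.hankelWeight_pos j).le (by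
    rw [pow_mul]; positivity)

lemma hankelSeq_even_antitone (h : Interlacing x y) {m n : ℕ} (hmn : m ≤ n) :
    hankelSeq x y (2 * n) ≤ hankelSeq x y (2 * m) :=
  Finset.sum_le_sum fun j _ => mul_le_mul_of_nonneg_left (by
    rw [pow_mul, pow_mul]
    refine pow_le_pow_of_le_one (sq_nonneg _) ?_ hmn
    rw [sq_le_one_iff_abs_le_one]; exact (h.abs_y j).le) (h.hankelWeight_pos j).le

lemma abs_hankelSeq_succ_le (h : Interlacing x y) (m : ℕ) :
    |hankelSeq x y (2 * m + 1)| ≤ hankelSeq x y (2 * m) := by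
  refine (Finset.abs_sum_le_sum_abs _ _).trans (Finset.sum_le_sum fun j _ => ?_)
  rw [abs_mul, abs_of_pos (h.hankelWeight_pos j)]
  refine mul_le_mul_of_nonneg_left ?_ (h.hankelWeight_pos j).le
  rw [pow_succ, abs_mul, pow_mul, abs_of_nonneg (pow_nonneg (sq_nonneg (y j)) m)]
  exact mul_le_of_le_one_right (pow_nonneg (sq_nonneg (y j)) m) (h.abs_y j).le

lemma mul_integral_sum_sum (s : Finset ℕ) (F : ℕ → ℕ → ℝ → ℂ) (hF : ∀ p q, Continuous (F p q))
    (c : ℂ) (a b : ℝ) : c * ∫ θ in a..b, ∑ p ∈ s, ∑ q ∈ s, F p q θ =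
      ∑ p ∈ s, ∑ q ∈ s, c * ∫ θ in a..b, F p q θ := by
  rw [intervalIntegral.integral_finsetSum (f := fun p θ => ∑ q ∈ s, F p q θ) fun p _ =>
    (continuous_finsetSum _ fun q _ => hF p q).intervalIntegrable _ _, Finset.mul_sum]
  refine Finset.sum_congr rfl fun p _ => ?_
  rw [intervalIntegral.integral_finsetSum (f := fun q θ => F p q θ) fun q _ =>
    (hF p q).intervalIntegrable _ _, Finset.mul_sum]

lemma sum_hankelSeq_le (h : Interlacing x y) (N : ℕ) :
    ∑ p ∈ Finset.range N, ∑ q ∈ Finset.range N, hankelSeq x y (2 * (p + q)) ≤ N := by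
  set T : ℝ → ℂ := fun θ => ∑ p ∈ Finset.range N, circ θ ^ (-(2 * p : ℤ)) with hT
  have hc : ∀ k : ℤ, Continuous fun θ => circ θ ^ k := fun k =>
    continuous_circ.zpow₀ k fun θ => Or.inl (circ_ne_zero θ)
  have hTc : Continuous T := continuous_finsetSum _ fun p _ => hc _
  have hψ := continuous_ratSym h
  have e1 : ((∑ p ∈ Finset.range N, ∑ q ∈ Finset.range N, hankelSeq x y (2 * (p + q)) : ℝ) : ℂ) =
      ((1 / (2 * Real.pi) : ℝ) : ℂ) *
        ∫ θ in (0 : ℝ)..(2 * Real.pi), ratSym x y θ * (circ θ ^ (-1 : ℤ) * (T θ * T θ)) := by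
    have : ∀ θ, ratSym x y θ * (circ θ ^ (-1 : ℤ) * (T θ * T θ)) = ∑ p ∈ Finset.range N,
        ∑ q ∈ Finset.range N, ratSym x y θ * circ θ ^ (-((2 * (p + q) : ℕ) + 1 : ℤ)) := by
      intro θ
      rw [hT, Finset.sum_mul_sum, Finset.mul_sum, Finset.mul_sum]
      refine Finset.sum_congr rfl fun p _ => ?_
      rw [Finset.mul_sum, Finset.mul_sum]
      refine Finset.sum_congr rfl fun q _ => ?_
      rw [← zpow_add₀ (circ_ne_zero θ), ← zpow_add₀ (circ_ne_zero θ)]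
      congr 2; push_cast; ring
    simp only [this]
    rw [mul_integral_sum_sum _ (fun p q θ => ratSym x y θ * circ θ ^ (-((2 * (p + q) : ℕ) + 1 : ℤ)))
      fun p q => hψ.mul (hc _), Complex.ofReal_sum]
    refine Finset.sum_congr rfl fun p _ => ?_
    rw [Complex.ofReal_sum]
    refine Finset.sum_congr rfl fun q _ => ?_
    rw [← fc_ratSym' h, fc_eq_circ]
  have e2 : ((N : ℝ) : ℂ) = ((1 / (2 * Real.pi) : ℝ) : ℂ) *
      ∫ θ in (0 : ℝ)..(2 * Real.pi), ((‖T θ‖ ^ 2 : ℝ) : ℂ) := by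
    have : ∀ θ, ((‖T θ‖ ^ 2 : ℝ) : ℂ) = ∑ p ∈ Finset.range N,
        ∑ q ∈ Finset.range N, (fun _ => (1 : ℂ)) θ * circ θ ^ (-(2 * p - 2 * q : ℤ)) := by
      intro θ
      rw [← Complex.normSq_eq_norm_sq, ← Complex.mul_conj, hT]
      simp only [map_sum, map_zpow₀, conj_circ]
      rw [Finset.sum_mul_sum]
      refine Finset.sum_congr rfl fun p _ => Finset.sum_congr rfl fun q _ => ?_
      rw [inv_zpow', ← zpow_add₀ (circ_ne_zero θ), one_mul]
      congr 1; ring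
    simp only [this]
    rw [mul_integral_sum_sum _ (fun p q θ => (fun _ => (1 : ℂ)) θ *
      circ θ ^ (-(2 * p - 2 * q : ℤ))) fun p q => continuous_const.mul (hc _)]
    have h2 : ∀ p ∈ Finset.range N, ∑ q ∈ Finset.range N, ((1 / (2 * Real.pi) : ℝ) : ℂ) *
        ∫ θ in (0 : ℝ)..(2 * Real.pi), (fun _ => (1 : ℂ)) θ *
          circ θ ^ (-(2 * p - 2 * q : ℤ)) = 1 := by
      intro p hp
      simp only [← fc_eq_circ (fun _ => (1 : ℂ)), fc_one]
      rw [Finset.sum_eq_single p]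
      · simp
      · intro q _ hq
        rw [if_neg (by omega)]
      · exact fun hn => absurd hp hn
    rw [Finset.sum_congr rfl h2]
    simp
  have hpi := Real.pi_pos
  have e3 : (N : ℝ) = 1 / (2 * Real.pi) * ∫ θ in (0 : ℝ)..(2 * Real.pi), ‖T θ‖ ^ 2 := by
    rw [intervalIntegral.integral_ofReal] at e2
    exact_mod_cast e2
  have e4 := congrArg norm e1
  rw [norm_mul, Complex.norm_real, Complex.norm_real,
    Real.norm_of_nonneg (show (0:ℝ) ≤ 1 / (2 * Real.pi) by positivity)] at e4
  refine (le_abs_self _).trans ?_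
  rw [Real.norm_eq_abs] at e4
  rw [e4, e3]
  refine mul_le_mul_of_nonneg_left ?_ (by positivity)
  refine (intervalIntegral.norm_integral_le_integral_norm (by positivity)).trans (le_of_eq ?_)
  apply intervalIntegral.integral_congr
  intro θ _
  simp only [norm_mul, norm_ratSym h, norm_zpow, norm_circ]
  simp [sq]

lemma hankelSeq_even_le (h : Interlacing x y) (n : ℕ) : hankelSeq x y (2 * n) ≤ 2 / (n + 1) := by
  set N := n / 2 + 1 with hN
  have h1 := sum_hankelSeq_le h N
  have h2 : (N : ℝ) * (N * hankelSeq x y (2 * n)) ≤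
      ∑ p ∈ Finset.range N, ∑ q ∈ Finset.range N, hankelSeq x y (2 * (p + q)) := by
    rw [← nsmul_eq_mul, ← nsmul_eq_mul]
    refine (by simp : _ = (Finset.range N).card • N • hankelSeq x y (2 * n)).trans_le
      (Finset.card_nsmul_le_sum _ _ _ fun p hp => ?_)
    refine (by simp : _ = (Finset.range N).card • hankelSeq x y (2 * n)).trans_le
      (Finset.card_nsmul_le_sum _ _ _ fun q hq => ?_)
    rw [Finset.mem_range] at hp hq
    exact hankelSeq_even_antitone h (by omega)
  have hN0 : (0 : ℝ) < N := by positivity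
  have h3 : N * hankelSeq x y (2 * n) ≤ 1 := by nlinarith
  have h4 : ((n : ℝ) + 1) ≤ 2 * N := by
    have : n + 1 ≤ 2 * N := by omega
    exact_mod_cast this
  rw [le_div_iff₀ (by positivity)]
  nlinarith [hankelSeq_even_nonneg h n]

lemma abs_hankelSeq_le (h : Interlacing x y) (m : ℕ) : |hankelSeq x y m| ≤ 4 / (m + 1) := by
  obtain ⟨n, rfl | rfl⟩ := m.even_or_odd'
  · rw [abs_of_nonneg (hankelSeq_even_nonneg h n)]
    refine (hankelSeq_even_le h n).trans ?_
    rw [div_le_div_iff₀ (by positivity) (by positivity)]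
    push_cast; linarith
  · refine ((abs_hankelSeq_succ_le h n).trans (hankelSeq_even_le h n)).trans ?_
    rw [div_le_div_iff₀ (by positivity) (by positivity)]
    push_cast; linarith

/-- Deviation of the solution vector from the unit vector. -/
lemma ratSol_energy (h : Interlacing x y) (l : ℕ) :
    ∑ i, hankelWeight x y i * ratVal x y l i ^ 2 ≤ 1 ∧
      ∀ s : Finset ℕ, ∑ k ∈ s, ((if k = l then 1 else 0) - ratSol x y l k) ^ 2 ≤ 1 := by
  set E := ∑ i, hankelWeight x y i * ratVal x y l i ^ 2 with hE
  set g : ℕ → ℝ := fun k => (if k = l then 1 else 0) - ratSol x y l k with hg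
  have hg' : ∀ k, g k = ∑ i, hankelWeight x y i * ratVal x y l i * y i ^ k := fun k => by
    simp only [hg, ratSol_eq h]; ring
  have h1 := hasSum_gram_quadratic 0 h.abs_y fun i => hankelWeight x y i * ratVal x y l i
  simp only [zero_add, ← hg'] at h1
  have h2 : ∑ i, hankelWeight x y i * ratVal x y l i *
      ∑ j, gramMat 0 y i j * (hankelWeight x y j * ratVal x y l j) = g l - E := by
    rw [hg', hE, ← Finset.sum_sub_distrib]
    refine Finset.sum_congr rfl fun i _ => ?_
    have := ratVal_eq h l i
    simp only [gramMat, Matrix.of_apply, pow_zero]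
    rw [show ∑ j, 1 / (1 - y i * y j) * (hankelWeight x y j * ratVal x y l j) =
      y i ^ l - ratVal x y l i by linarith]
    ring
  rw [h2] at h1
  have hE0 : 0 ≤ E := Finset.sum_nonneg fun i _ => mul_nonneg (h.hankelWeight_pos i).le (sq_nonneg _)
  have h3 : ∀ s : Finset ℕ, ∑ k ∈ s, g k ^ 2 ≤ g l - E := fun s =>
    sum_le_hasSum s (fun k _ => sq_nonneg _) h1
  have h4 := h3 {l}
  rw [Finset.sum_singleton] at h4
  have h5 : g l ≤ 1 := by nlinarith
  have h6 : 0 ≤ g l := by nlinarith [sq_nonneg (g l)]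
  exact ⟨by nlinarith [sq_nonneg (g l)], fun s => (h3 s).trans (by linarith)⟩

lemma ratSol_sub_sq_le (h : Interlacing x y) (l k : ℕ) :
    ((if k = l then 1 else 0) - ratSol x y l k) ^ 2 ≤ 2 / (k + 1) := by
  have h1 := (ratSol_energy h l).1
  have e : (if k = l then 1 else 0) - ratSol x y l k =
      ∑ i, hankelWeight x y i * ratVal x y l i * y i ^ k := by rw [ratSol_eq h]; ring
  rw [e]
  have h2 : (∑ i, hankelWeight x y i * ratVal x y l i * y i ^ k) ^ 2 ≤
      (∑ i, hankelWeight x y i * ratVal x y l i ^ 2) * hankelSeq x y (2 * k) := by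
    refine Finset.sum_sq_le_sum_mul_sum_of_sq_le_mul _
      (fun i _ => mul_nonneg (h.hankelWeight_pos i).le (sq_nonneg _))
      (fun i _ => mul_nonneg (h.hankelWeight_pos i).le (by rw [pow_mul]; positivity))
      fun i _ => le_of_eq ?_
    ring
  have h3 := hankelSeq_even_le h k
  have h4 := hankelSeq_even_nonneg h k
  refine h2.trans ?_
  calc _ ≤ 1 * hankelSeq x y (2 * k) := mul_le_mul_of_nonneg_right h1 h4
    _ ≤ _ := by linarith

/-- The squared modulus of the analytic factor. -/
def ratWeight (x y : ι → ℝ) (θ : ℝ) : ℝ :=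
  ∏ i, (1 - 2 * y i * Real.cos θ + y i ^ 2) / (1 - 2 * x i * Real.cos θ + x i ^ 2)

lemma one_sub_two_mul_cos_pos {t : ℝ} (ht : |t| < 1) (θ : ℝ) :
    0 < 1 - 2 * t * Real.cos θ + t ^ 2 := by
  have h1 := abs_lt.1 ht
  nlinarith [sq_nonneg (t - Real.cos θ), Real.sin_sq_add_cos_sq θ, sq_nonneg (Real.sin θ),
    mul_pos (by linarith : 0 < 1 - t) (by linarith : 0 < 1 + t), Real.neg_one_le_cos θ,
    Real.cos_le_one θ, sq_nonneg (1 - t), sq_nonneg (1 + t)]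

lemma one_sub_mul_circ_mul (t θ : ℝ) : (1 - (t : ℂ) * circ θ) * (1 - t * (circ θ)⁻¹) =
    (1 - 2 * t * Real.cos θ + t ^ 2 : ℝ) := by
  have h1 : circ θ + (circ θ)⁻¹ = 2 * Complex.cos θ := by
    rw [inv_circ, circ, Complex.cos, mul_comm Complex.I, ← neg_mul]; ring
  have h2 := mul_inv_cancel₀ (circ_ne_zero θ)
  push_cast
  linear_combination (-(t : ℂ)) * h1 + (t : ℂ) ^ 2 * h2

lemma continuous_ratWeight (h : Interlacing x y) : Continuous (ratWeight x y) :=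
  continuous_finsetProd _ fun i _ => Continuous.div (by fun_prop) (by fun_prop) fun θ =>
    (one_sub_two_mul_cos_pos (h.abs_x i) θ).ne'

lemma quotSym_self_eq (h : Interlacing x y) (θ : ℝ) :
    quotSym (ratCoeff y x) (ratCoeff y x) θ = (ratWeight x y θ : ℝ) := by
  rw [quotSym, pser_ratCoeff y x h.inj_x h.abs_x (norm_circ θ).le,
    pser_ratCoeff y x h.inj_x h.abs_x (norm_inv_circ θ).le, ← Finset.prod_mul_distrib, ratWeight]
  rw [Complex.ofReal_prod]
  refine Finset.prod_congr rfl fun i _ => ?_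
  rw [div_mul_div_comm, one_sub_mul_circ_mul, one_sub_mul_circ_mul, Complex.ofReal_div]

lemma autoCorr_eq_integral (h : Interlacing x y) (k : ℤ) : autoCorr (ratCoeff y x) k =
    1 / Real.pi * ∫ θ in (0 : ℝ)..Real.pi, ratWeight x y θ * Real.cos (k * θ) := by
  have h1 := fc_quotSym_self (summable_ratCoeff y x h.abs_x) k
  have hcont := continuous_ratWeight h
  rw [fc, show (quotSym (ratCoeff y x) (ratCoeff y x)) = fun θ => ((ratWeight x y θ : ℝ) : ℂ) from
    funext fun θ => quotSym_self_eq h θ] at h1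
  have h2 := congrArg Complex.re h1
  rw [Complex.ofReal_re, Complex.re_ofReal_mul] at h2
  have hci : Continuous fun θ : ℝ => ((ratWeight x y θ : ℝ) : ℂ) *
      Complex.exp (-(Complex.I * k * θ)) := by fun_prop
  have h3 : (∫ θ in (0 : ℝ)..(2 * Real.pi), ((ratWeight x y θ : ℝ) : ℂ) *
      Complex.exp (-(Complex.I * k * θ))).re =
      ∫ θ in (0 : ℝ)..(2 * Real.pi), ratWeight x y θ * Real.cos (k * θ) := by
    rw [← Complex.reCLM_apply, ← Complex.reCLM.intervalIntegral_comp_comm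
      (hci.intervalIntegrable _ _)]
    apply intervalIntegral.integral_congr
    intro θ _
    simp only [Complex.reCLM_apply, Complex.re_ofReal_mul]
    congr 1
    rw [show -(Complex.I * k * θ) = ((-(k * θ) : ℝ) : ℂ) * Complex.I by push_cast; ring,
      Complex.exp_ofReal_mul_I_re, Real.cos_neg]
  rw [h3] at h2
  set f : ℝ → ℝ := fun θ => ratWeight x y θ * Real.cos (k * θ) with hf
  have hfc : Continuous f := by fun_prop
  have h4 : ∫ θ in (Real.pi)..(2 * Real.pi), f θ = ∫ θ in (0 : ℝ)..Real.pi, f θ := by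
    have := intervalIntegral.integral_comp_sub_left (a := 0) (b := Real.pi) f (2 * Real.pi)
    rw [show 2 * Real.pi - Real.pi = Real.pi by ring, sub_zero] at this
    rw [← this]
    apply intervalIntegral.integral_congr
    intro θ _
    simp only [hf, ratWeight, Real.cos_two_pi_sub]
    congr 1
    rw [mul_sub, show (k : ℝ) * (2 * Real.pi) = (k : ℤ) * (2 * Real.pi) by push_cast; ring,
      Real.cos_int_mul_two_pi_sub]
  rw [← intervalIntegral.integral_add_adjacent_intervals (hfc.intervalIntegrable 0 Real.pi)
    (hfc.intervalIntegrable _ _), h4] at h2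
  rw [← h2]
  field_simp
  ring

lemma ratMat_apply (h : Interlacing x y) (n : ℕ) (j k : Fin n) : ratMat n x y j k =
    1 / Real.pi * ∫ θ in (0 : ℝ)..Real.pi, ratWeight x y θ * (1 + Real.cos θ) *
      ((chebThird j).eval (2 * Real.cos θ) * (chebThird k).eval (2 * Real.cos θ)) := by
  have hcont := continuous_ratWeight h
  rw [ratMat, Matrix.of_apply, autoCorr_eq_integral h, autoCorr_eq_integral h, ← mul_add,
    ← intervalIntegral.integral_add (Continuous.intervalIntegrable (by fun_prop) _ _)
      (Continuous.intervalIntegrable (by fun_prop) _ _)]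
  congr 1
  apply intervalIntegral.integral_congr
  intro θ _
  simp only
  rw [mul_assoc, one_add_cos_mul_chebThird]
  push_cast
  ring

end

section
variable {ι : Type*} [Fintype ι] [DecidableEq ι] {x y : ι → ℝ}

lemma prod_sub_div_eq (h : Interlacing x y) {s : ℝ} (hs : ∀ j, s ≠ x j) :
    (∏ i, (s - y i)) / ∏ i, (s - x i) = 1 + ∑ j, pfCoeff y x j / (s - x j) := by
  rw [prod_sub_eq_pf y x h.inj_x s hs, mul_comm, mul_div_assoc, div_self, mul_one]
  exact Finset.prod_ne_zero_iff.2 fun i _ => sub_ne_zero.2 (hs i)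

lemma sum_pfCoeff_div (h : Interlacing x y) (i : ι) : ∑ j, pfCoeff y x j / (y i - x j) = -1 := by
  have := prod_sub_div_eq h (h.y_ne_x i)
  rw [Finset.prod_eq_zero (Finset.mem_univ i) (sub_self (y i)), zero_div] at this
  linarith

lemma sum_pfCoeff_div_sq (h : Interlacing x y) (k : ι) :
    ∑ j, pfCoeff y x j / (y k - x j) ^ 2 = -(pfCoeff x y k)⁻¹ := by
  set g : ℝ → ℝ := fun s => (∏ i ∈ Finset.univ.erase k, (s - y i)) / ∏ i, (s - x i) with hg
  have hgd : DifferentiableAt ℝ g (y k) :=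
    DifferentiableAt.div (by fun_prop) (by fun_prop)
      (Finset.prod_ne_zero_iff.2 fun i _ => sub_ne_zero.2 (h.y_ne_x k i))
  have h1 : HasDerivAt (fun s => (s - y k) * g s) (g (y k)) (y k) := by
    have := ((hasDerivAt_id (y k)).sub_const (y k)).mul hgd.hasDerivAt
    refine this.congr_deriv ?_
    simp
  have h2 : HasDerivAt (fun s => 1 + ∑ j, pfCoeff y x j / (s - x j))
      (∑ j, -(pfCoeff y x j / (y k - x j) ^ 2)) (y k) := by
    refine HasDerivAt.const_add _ (HasDerivAt.fun_sum fun j _ => ?_)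
    have h3 := (((hasDerivAt_id (y k)).sub_const (x j)).inv
      (sub_ne_zero.2 (h.y_ne_x k j))).const_mul (pfCoeff y x j)
    refine h3.congr_deriv ?_
    simp only [id]; ring
  have h4 : (fun s => (s - y k) * g s) =ᶠ[nhds (y k)] fun s => 1 + ∑ j, pfCoeff y x j / (s - x j) := by
    have : ∀ᶠ s in nhds (y k), ∀ j, s ≠ x j := by
      rw [eventually_all]
      exact fun j => isOpen_ne.mem_nhds (h.y_ne_x k j)
    filter_upwards [this] with s hs
    rw [← prod_sub_div_eq h hs, hg, ← mul_div_assoc,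
      Finset.mul_prod_erase _ (fun i => s - y i) (Finset.mem_univ k)]
  have h5 := (h1.congr_of_eventuallyEq h4.symm).unique h2
  rw [Finset.sum_neg_distrib] at h5
  rw [← neg_eq_iff_eq_neg, ← h5, pfCoeff, Lagrange.nodalWeight, mul_inv, ← Finset.prod_inv_distrib]
  simp only [hg, div_eq_mul_inv, inv_inv]

lemma gramDet_zero_mul (h : Interlacing x y) :
    gramDet 0 x y * (Matrix.of fun i j => 1 / (y i - x j)).det =
      (Matrix.of fun j k => (1 - x j) * (1 + y k) / ((y k - x j) * (1 - x j * y k))).det := by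
  set Cau : Matrix ι ι ℝ := Matrix.of fun i j => 1 / (y i - x j) with hCau
  set K : Matrix ι ι ℝ :=
    Matrix.of fun j k => (1 - x j) * (1 + y k) / ((y k - x j) * (1 - x j * y k)) with hK
  set W : Matrix ι ι ℝ := Matrix.of fun i j => -(pfCoeff y x j / (y i - x j)) with hW
  set r := Matrix.diagonal (pfCoeff x y) with hr
  have hd1 : ∀ i j, y i - x j ≠ 0 := fun i j => sub_ne_zero.2 (h.y_ne_x i j)
  have hd2 : ∀ i j, 1 - x j * y i ≠ 0 := fun i j => (one_sub_mul_pos (h.abs_x j) (h.abs_y i)).ne'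
  have hd3 : ∀ i j, 1 - y j * y i ≠ 0 := fun i j => (one_sub_mul_pos (h.abs_y j) (h.abs_y i)).ne'
  have e1 : W * (Cau.transpose * r) = 1 := by
    ext i k
    rw [← Matrix.mul_assoc, Matrix.mul_diagonal, Matrix.mul_apply]
    simp only [hW, hCau, Matrix.of_apply, Matrix.transpose_apply]
    by_cases hik : i = k
    · subst hik
      have h1 : ∑ j, -(pfCoeff y x j / (y i - x j)) * (1 / (y i - x j)) =
          -∑ j, pfCoeff y x j / (y i - x j) ^ 2 := by
        rw [← Finset.sum_neg_distrib]
        exact Finset.sum_congr rfl fun j _ => by have := hd1 i j; field_simp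
      rw [h1, sum_pfCoeff_div_sq h, neg_neg, inv_mul_cancel₀ (h.pfCoeff_pos i).ne',
        Matrix.one_apply_eq]
    · have hne : y k - y i ≠ 0 := sub_ne_zero.2 fun e => hik (h.inj_y e).symm
      have h1 : ∑ j, -(pfCoeff y x j / (y i - x j)) * (1 / (y k - x j)) =
          (∑ j, pfCoeff y x j / (y k - x j) - ∑ j, pfCoeff y x j / (y i - x j)) / (y k - y i) := by
        rw [← Finset.sum_sub_distrib, Finset.sum_div]
        refine Finset.sum_congr rfl fun j _ => ?_
        have := hd1 i j
        have := hd1 k j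
        field_simp
        ring
      rw [h1, sum_pfCoeff_div h, sum_pfCoeff_div h, sub_self, zero_div, zero_mul,
        Matrix.one_apply_ne hik]
  have e2 : W * (K * r) = 1 + gramMat 0 y * Matrix.diagonal (hankelWeight x y) := by
    have hK' : ∀ j k, K j k = Cau.transpose j k + 1 / (1 - x j * y k) := by
      intro j k
      simp only [hK, hCau, Matrix.of_apply, Matrix.transpose_apply]
      have := hd1 k j
      have := hd2 k j
      field_simp
      ring
    have hK'' : K = Cau.transpose + Matrix.of fun j k => 1 / (1 - x j * y k) := by
      ext j k; rw [hK']; rfl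
    rw [hK'', Matrix.add_mul, Matrix.mul_add, e1]
    congr 1
    ext i k
    rw [← Matrix.mul_assoc, Matrix.mul_diagonal, Matrix.mul_diagonal, Matrix.mul_apply]
    simp only [hW, Matrix.of_apply, gramMat, pow_zero]
    have h1 : ∑ j, -(pfCoeff y x j / (y i - x j)) * (1 / (1 - x j * y k)) =
        (y k * (∑ j, pfCoeff y x j / (1 - x j * y k)) - ∑ j, pfCoeff y x j / (y i - x j)) /
          (1 - y i * y k) := by
      rw [Finset.mul_sum, ← Finset.sum_sub_distrib, Finset.sum_div]
      refine Finset.sum_congr rfl fun j _ => ?_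
      have := hd1 i j
      have := hd2 k j
      have := hd3 k i
      field_simp
      ring
    have h2 := prod_div_eq_pf y x h.inj_x (y k) (hd2 k)
    rw [h1, sum_pfCoeff_div h, hankelWeight, h2]
    ring
  have e3 := congrArg Matrix.det e1
  have e4 := congrArg Matrix.det e2
  rw [Matrix.det_mul, Matrix.det_mul, Matrix.det_transpose, Matrix.det_one] at e3
  rw [Matrix.det_mul, Matrix.det_mul] at e4
  rw [gramDet, ← e4]
  linear_combination K.det * e3

/-- The change of variables linearising the kernel of the Cauchy determinant. -/
def joukowski (t : ℝ) : ℝ := t / (1 + t ^ 2)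

lemma joukowski_sub (a b : ℝ) : joukowski a - joukowski b =
    (a - b) * (1 - a * b) / ((1 + a ^ 2) * (1 + b ^ 2)) := by
  unfold joukowski
  have h1 : 1 + a ^ 2 ≠ 0 := by positivity
  have h2 : 1 + b ^ 2 ≠ 0 := by positivity
  field_simp
  ring

lemma joukowski_ne {a b : ℝ} (ha : |a| < 1) (hb : |b| < 1) (hab : a ≠ b) :
    joukowski a ≠ joukowski b := by
  rw [← sub_ne_zero, joukowski_sub]
  exact div_ne_zero (mul_ne_zero (sub_ne_zero.2 hab) (one_sub_mul_pos ha hb).ne') (by positivity)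

lemma log_joukowski_sub {a b : ℝ} (ha : |a| < 1) (hb : |b| < 1) (hab : a ≠ b) :
    Real.log (joukowski a - joukowski b) = Real.log (a - b) +
      (Real.log (1 - a * b) - Real.log (1 + a ^ 2) - Real.log (1 + b ^ 2)) := by
  rw [joukowski_sub, Real.log_div (mul_ne_zero (sub_ne_zero.2 hab) (one_sub_mul_pos ha hb).ne')
    (by positivity), Real.log_mul (sub_ne_zero.2 hab) (one_sub_mul_pos ha hb).ne',
    Real.log_mul (by positivity) (by positivity)]
  ring

lemma sum_sum_log_joukowski {a : ι → ℝ} (ha : ∀ i, |a i| < 1) (hinj : Function.Injective a) :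
    ∑ i, ∑ k, Real.log (joukowski (a i) - joukowski (a k)) = ∑ i, ∑ k, Real.log (a i - a k) +
      ∑ i, ∑ k, (Real.log (1 - a i * a k) - Real.log (1 + a i ^ 2) - Real.log (1 + a k ^ 2)) -
      ∑ i, (Real.log (1 - a i * a i) - Real.log (1 + a i ^ 2) - Real.log (1 + a i ^ 2)) := by
  rw [← Finset.sum_add_distrib, ← Finset.sum_sub_distrib]
  refine Finset.sum_congr rfl fun i _ => ?_
  rw [← Finset.sum_add_distrib, ← Finset.sum_erase_add _ _ (Finset.mem_univ i),
    ← Finset.sum_erase_add (a := i) _ (fun k => Real.log (a i - a k) + _) (Finset.mem_univ i)]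
  simp only [sub_self, Real.log_zero, zero_add, add_zero, add_sub_cancel_right]
  refine Finset.sum_congr rfl fun k hk => ?_
  exact log_joukowski_sub (ha i) (ha k) fun e => (Finset.ne_of_mem_erase hk) (hinj e).symm

lemma log_gramDet_zero (h : Interlacing x y) : 2 * Real.log (gramDet 0 x y) =
    ∑ i, (Real.log (1 + y i) - Real.log (1 - y i) - (Real.log (1 + x i) - Real.log (1 - x i))) +
    ∑ i, ∑ k, (Real.log (1 - y i * y k) + Real.log (1 - x i * x k) - Real.log (1 - y i * x k) -
      Real.log (1 - x i * y k)) := by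
  have hx1 : ∀ i, 0 < 1 - x i := fun i => by linarith [(abs_lt.1 (h.abs_x i)).2]
  have hx2 : ∀ i, 0 < 1 + x i := fun i => by linarith [(abs_lt.1 (h.abs_x i)).1]
  have hy1 : ∀ i, 0 < 1 - y i := fun i => by linarith [(abs_lt.1 (h.abs_y i)).2]
  have hy2 : ∀ i, 0 < 1 + y i := fun i => by linarith [(abs_lt.1 (h.abs_y i)).1]
  have hjx : Function.Injective fun i => joukowski (x i) := fun a b hab => by
    by_contra hne
    exact joukowski_ne (h.abs_x a) (h.abs_x b) (fun e => hne (h.inj_x e)) hab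
  have hjy : Function.Injective fun i => joukowski (y i) := fun a b hab => by
    by_contra hne
    exact joukowski_ne (h.abs_y a) (h.abs_y b) (fun e => hne (h.inj_y e)) hab
  obtain ⟨n1, l1⟩ := log_cauchy_det y x h.y_ne_x h.inj_y h.inj_x
  obtain ⟨n2, l2⟩ := log_cauchy_det (fun i => joukowski (y i)) (fun i => joukowski (x i))
    (fun i j => joukowski_ne (h.abs_y i) (h.abs_x j) (h.y_ne_x i j)) hjy hjx
  have e1 := gramDet_zero_mul h
  have e2 : (Matrix.of fun j k => (1 - x j) * (1 + y k) / ((y k - x j) * (1 - x j * y k))).det =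
      (∏ j, (1 - x j) / (1 + x j ^ 2)) * ((∏ k, (1 + y k) / (1 + y k ^ 2)) *
        (Matrix.of fun i j => 1 / (joukowski (y i) - joukowski (x j))).det) := by
    rw [← Matrix.det_transpose (Matrix.of fun i j => 1 / (joukowski (y i) - joukowski (x j))),
      ← Matrix.det_mul_row, ← Matrix.det_mul_column]
    congr 1
    ext j k
    simp only [Matrix.of_apply, Matrix.transpose_apply, joukowski_sub]
    have := sub_ne_zero.2 (h.y_ne_x k j)
    have := (one_sub_mul_pos (h.abs_x j) (h.abs_y k)).ne'
    have : 1 - y k * x j ≠ 0 := by rwa [mul_comm]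
    have : 1 + x j ^ 2 ≠ 0 := by positivity
    have : 1 + y k ^ 2 ≠ 0 := by positivity
    rw [mul_comm (x j) (y k)]
    field_simp
  rw [e2] at e1
  have e3 := congrArg Real.log e1
  have p1 : ∀ j, (1 - x j) / (1 + x j ^ 2) ≠ 0 := fun j =>
    (div_pos (hx1 j) (by positivity)).ne'
  have p2 : ∀ j, (1 + y j) / (1 + y j ^ 2) ≠ 0 := fun j =>
    (div_pos (hy2 j) (by positivity)).ne'
  rw [Real.log_mul (gramDet_pos h 0).ne' n1, Real.log_mul (Finset.prod_ne_zero_iff.2 fun j _ => p1 j)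
    (mul_ne_zero (Finset.prod_ne_zero_iff.2 fun j _ => p2 j) n2),
    Real.log_mul (Finset.prod_ne_zero_iff.2 fun j _ => p2 j) n2,
    Real.log_prod fun j _ => p1 j, Real.log_prod fun j _ => p2 j] at e3
  have e4 : 2 * Real.log (gramDet 0 x y) = 2 * ∑ j, Real.log ((1 - x j) / (1 + x j ^ 2)) +
      2 * ∑ j, Real.log ((1 + y j) / (1 + y j ^ 2)) +
      (2 * Real.log (Matrix.of fun i j => 1 / (joukowski (y i) - joukowski (x j))).det -
      2 * Real.log (Matrix.of fun i j => 1 / (y i - x j)).det) := by linarith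
  rw [e4, l1, l2]
  have m1 : ∀ i k, Real.log (joukowski (y i) - joukowski (x k)) = _ := fun i k =>
    log_joukowski_sub (h.abs_y i) (h.abs_x k) (h.y_ne_x i k)
  have m2 : ∀ i k, Real.log (joukowski (x i) - joukowski (y k)) = _ := fun i k =>
    log_joukowski_sub (h.abs_x i) (h.abs_y k) (h.y_ne_x k i).symm
  have m3 := sum_sum_log_joukowski h.abs_y h.inj_y
  have m4 := sum_sum_log_joukowski h.abs_x h.inj_x
  have q1 : ∀ j, Real.log ((1 - x j) / (1 + x j ^ 2)) =
      Real.log (1 - x j) - Real.log (1 + x j ^ 2) := fun j =>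
    Real.log_div (hx1 j).ne' (by positivity)
  have q2 : ∀ j, Real.log ((1 + y j) / (1 + y j ^ 2)) =
      Real.log (1 + y j) - Real.log (1 + y j ^ 2) := fun j =>
    Real.log_div (hy2 j).ne' (by positivity)
  have q3 : ∀ j, Real.log (1 - x j * x j) = Real.log (1 - x j) + Real.log (1 + x j) := fun j => by
    rw [← Real.log_mul (hx1 j).ne' (hx2 j).ne']; congr 1; ring
  have q4 : ∀ j, Real.log (1 - y j * y j) = Real.log (1 - y j) + Real.log (1 + y j) := fun j => by
    rw [← Real.log_mul (hy1 j).ne' (hy2 j).ne']; congr 1; ring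
  simp only [m1, m2, q1, q2, Finset.sum_add_distrib, Finset.sum_sub_distrib] at *
  rw [m3, m4]
  simp only [q3, q4, Finset.sum_add_distrib, Finset.sum_const]
  ring

end

lemma sum_sub_le_of_monotoneOn {ι : Type*} {x y : ι → ℝ} (hlt : ∀ i, x i < y i)
    (hsep : ∀ i j, i ≠ j → y i < x j ∨ y j < x i) {φ : ℝ → ℝ} {a : ℝ} (s : Finset ι) :
    ∀ b, a ≤ b → MonotoneOn φ (Set.Icc a b) → (∀ i ∈ s, a ≤ x i ∧ y i ≤ b) →
      ∑ i ∈ s, (φ (y i) - φ (x i)) ≤ φ b - φ a := by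
  classical
  induction s using Finset.induction_on_max_value x with
  | empty =>
    intro b hab hφ _
    simpa using hφ (Set.left_mem_Icc.2 hab) (Set.right_mem_Icc.2 hab) hab
  | insert i s hi hmax ih =>
    intro b hab hφ hs
    rw [Finset.sum_insert hi]
    obtain ⟨h1, h2⟩ := hs i (Finset.mem_insert_self i s)
    have hxi := hlt i
    have h3 := ih (x i) h1 (hφ.mono (Set.Icc_subset_Icc_right (by linarith))) fun j hj => by
      refine ⟨(hs j (Finset.mem_insert_of_mem hj)).1, ?_⟩
      rcases hsep i j (fun e => hi (e ▸ hj)) with h | h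
      · linarith [hmax j hj]
      · exact h.le
    have h4 := hφ ⟨by linarith, h2⟩ ⟨hab, le_rfl⟩ h2
    linarith

lemma nodalWeight_univ_eq {ι : Type*} [Fintype ι] [DecidableEq ι] (y : ι → ℝ) (j : ι) :
    Lagrange.nodalWeight Finset.univ y j = ∏ k, if k = j then 1 else (y j - y k)⁻¹ := by
  rw [Lagrange.nodalWeight, ← Finset.mul_prod_erase _ _ (Finset.mem_univ j), if_pos rfl, one_mul]
  exact Finset.prod_congr rfl fun k hk => by rw [if_neg (Finset.ne_of_mem_erase hk)]

section
variable {ι κ : Type*} [Fintype ι] [DecidableEq ι] [Fintype κ] [DecidableEq κ]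
  {xo yo : ι → ℝ} {xi yi : κ → ℝ}

lemma Interlacing.outer (h : Interlacing (Sum.elim xo xi) (Sum.elim yo yi)) : Interlacing xo yo where
  lower i := h.lower (Sum.inl i)
  upper i := h.upper (Sum.inl i)
  lt i := h.lt (Sum.inl i)
  sep i j hij := h.sep (Sum.inl i) (Sum.inl j) (fun e => hij (Sum.inl_injective e))

lemma Interlacing.inner (h : Interlacing (Sum.elim xo xi) (Sum.elim yo yi)) : Interlacing xi yi where
  lower i := h.lower (Sum.inr i)
  upper i := h.upper (Sum.inr i)
  lt i := h.lt (Sum.inr i)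
  sep i j hij := h.sep (Sum.inr i) (Sum.inr j) (fun e => hij (Sum.inr_injective e))

lemma hankelWeight_inl (i : ι) :
    hankelWeight (Sum.elim xo xi) (Sum.elim yo yi) (Sum.inl i) = hankelWeight xo yo i *
      ∏ k, ((yo i - yi k)⁻¹ * (yo i - xi k) * ((1 - yi k * yo i) / (1 - xi k * yo i))) := by
  unfold hankelWeight pfCoeff
  rw [nodalWeight_univ_eq, nodalWeight_univ_eq, Fintype.prod_sum_type, Fintype.prod_sum_type,
    Fintype.prod_sum_type, Finset.prod_mul_distrib, Finset.prod_mul_distrib]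
  simp only [Sum.elim_inl, Sum.elim_inr, Sum.inl.injEq, reduceCtorEq, if_false]
  ring

lemma gramMat_mul_diagonal_zero_inr (n : ℕ) (w : ι → ℝ) :
    (1 + gramMat n (Sum.elim yo yi) * Matrix.diagonal (Sum.elim w (0 : κ → ℝ))).det =
      (1 + gramMat n yo * Matrix.diagonal w).det := by
  have : 1 + gramMat n (Sum.elim yo yi) * Matrix.diagonal (Sum.elim w (0 : κ → ℝ)) =
      Matrix.fromBlocks (1 + gramMat n yo * Matrix.diagonal w) 0
        (Matrix.of fun k i => gramMat n (Sum.elim yo yi) (Sum.inr k) (Sum.inl i) * w i) 1 := by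
    ext a b
    rw [Matrix.add_apply, Matrix.mul_diagonal]
    rcases a with a | a <;> rcases b with b | b
    · simp only [Sum.elim_inl, Matrix.fromBlocks_apply₁₁, Matrix.add_apply, Matrix.mul_diagonal,
        gramMat, Matrix.of_apply, Matrix.one_apply, Sum.inl.injEq]
    · simp
    · simp
    · simp [Matrix.one_apply]
  rw [this, Matrix.det_fromBlocks_zero₁₂, Matrix.det_one, mul_one]

lemma prod_mobius_bounds (h : Interlacing xi yi) {μ v : ℝ} (hμ0 : 0 < μ)
    (hi : ∀ k, -μ ≤ xi k ∧ yi k ≤ μ) (hμv : μ < v) (hv : v < 1) :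
    1 ≤ ∏ k, ((v - yi k)⁻¹ * (v - xi k) * ((1 - yi k * v) / (1 - xi k * v))) ∧
      ∏ k, ((v - yi k)⁻¹ * (v - xi k) * ((1 - yi k * v) / (1 - xi k * v))) ≤
        1 + 2 * μ * (1 - v ^ 2) / ((v - μ) * (1 + μ * v)) := by
  set φ : ℝ → ℝ := fun t => Real.log ((1 - t * v) / (v - t)) with hφ
  have hpos : ∀ t ∈ Set.Icc (-μ) μ, 0 < 1 - t * v ∧ 0 < v - t := fun t ht =>
    ⟨by nlinarith [ht.1, ht.2], by linarith [ht.2]⟩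
  have hmono : MonotoneOn φ (Set.Icc (-μ) μ) := by
    intro s hs t ht hst
    refine Real.log_le_log (div_pos (hpos s hs).1 (hpos s hs).2) ?_
    rw [div_le_div_iff₀ (hpos s hs).2 (hpos t ht).2]
    nlinarith [mul_nonneg (sub_nonneg.2 hst) (show 0 ≤ 1 - v ^ 2 by nlinarith)]
  have hx : ∀ k, xi k ∈ Set.Icc (-μ) μ := fun k => ⟨(hi k).1, (h.lt k).le.trans (hi k).2⟩
  have hy : ∀ k, yi k ∈ Set.Icc (-μ) μ := fun k => ⟨(hi k).1.trans (h.lt k).le, (hi k).2⟩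
  have hfac : ∀ k, (v - yi k)⁻¹ * (v - xi k) * ((1 - yi k * v) / (1 - xi k * v)) =
      Real.exp (φ (yi k) - φ (xi k)) := by
    intro k
    obtain ⟨a1, a2⟩ := hpos _ (hx k)
    obtain ⟨b1, b2⟩ := hpos _ (hy k)
    rw [Real.exp_sub, hφ, Real.exp_log (div_pos b1 b2), Real.exp_log (div_pos a1 a2)]
    field_simp
  simp only [hfac, ← Real.exp_sum]
  have hm1 : -μ ∈ Set.Icc (-μ) μ := ⟨le_rfl, by linarith⟩
  have hm2 : μ ∈ Set.Icc (-μ) μ := ⟨by linarith, le_rfl⟩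
  refine ⟨Real.one_le_exp (Finset.sum_nonneg fun k _ =>
    sub_nonneg.2 (hmono (hx k) (hy k) (h.lt k).le)), ?_⟩
  refine (Real.exp_le_exp.2 (sum_sub_le_of_monotoneOn h.lt h.sep Finset.univ μ (by linarith) hmono
    fun k _ => hi k)).trans (le_of_eq ?_)
  obtain ⟨a1, a2⟩ := hpos _ hm1
  obtain ⟨b1, b2⟩ := hpos _ hm2
  rw [Real.exp_sub, hφ, Real.exp_log (div_pos b1 b2), Real.exp_log (div_pos a1 a2)]
  have : 1 + μ * v ≠ 0 := by nlinarith
  have : v - μ ≠ 0 := b2.ne'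
  rw [sub_neg_eq_add] at a2
  have : v + μ ≠ 0 := a2.ne'
  rw [sub_neg_eq_add, show 1 - -μ * v = 1 + μ * v by ring]
  field_simp
  ring

lemma Interlacing.neg (h : Interlacing xi yi) : Interlacing (fun k => -yi k) fun k => -xi k where
  lower i := by linarith [h.upper i]
  upper i := by linarith [h.lower i]
  lt i := by linarith [h.lt i]
  sep i j hij := by
    rcases h.sep i j hij with h1 | h1
    · right; linarith
    · left; linarith

lemma abs_hankelWeight_sub_le (h : Interlacing (Sum.elim xo xi) (Sum.elim yo yi)) {μ : ℝ}
    (hμ0 : 0 < μ) (hi : ∀ k, -μ ≤ xi k ∧ yi k ≤ μ) {i : ι} (hμv : μ < |yo i|) :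
    |hankelWeight xo yo i - hankelWeight (Sum.elim xo xi) (Sum.elim yo yi) (Sum.inl i)| ≤
      2 * μ * (1 - yo i ^ 2) / ((|yo i| - μ) * (1 + μ * |yo i|)) * hankelWeight xo yo i := by
  have hw := h.outer.hankelWeight_pos i
  have hv1 := h.outer.abs_y i
  rw [hankelWeight_inl]
  set q := ∏ k, ((yo i - yi k)⁻¹ * (yo i - xi k) * ((1 - yi k * yo i) / (1 - xi k * yo i))) with hq
  set T := 2 * μ * (1 - yo i ^ 2) / ((|yo i| - μ) * (1 + μ * |yo i|)) with hT
  have hT0 : 0 ≤ T := by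
    refine div_nonneg (mul_nonneg (by linarith) ?_) (mul_nonneg (by linarith) (by positivity))
    rw [sub_nonneg, sq_le_one_iff_abs_le_one]; exact hv1.le
  suffices H : |1 - q| ≤ T by
    rw [show hankelWeight xo yo i - hankelWeight xo yo i * q = hankelWeight xo yo i * (1 - q) by ring,
      abs_mul, abs_of_pos hw, mul_comm]
    exact mul_le_mul_of_nonneg_right H hw.le
  rcases le_or_gt 0 (yo i) with hs | hs
  · rw [abs_of_nonneg hs] at hμv hv1 hT
    obtain ⟨h1, h2⟩ := prod_mobius_bounds h.inner hμ0 hi hμv hv1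
    rw [← hq] at h1 h2
    rw [abs_le]
    constructor <;> linarith
  · rw [abs_of_neg hs] at hμv hv1 hT
    obtain ⟨h1, h2⟩ := prod_mobius_bounds h.inner.neg hμ0
      (fun k => ⟨by linarith [(hi k).2], by linarith [(hi k).1]⟩) hμv hv1
    have e : ∏ k, ((-yo i - -xi k)⁻¹ * (-yo i - -yi k) *
        ((1 - -xi k * -yo i) / (1 - -yi k * -yo i))) = q⁻¹ := by
      rw [hq, ← Finset.prod_inv_distrib]
      refine Finset.prod_congr rfl fun k _ => ?_
      rw [show -yo i - -xi k = -(yo i - xi k) by ring, show -yo i - -yi k = -(yo i - yi k) by ring,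
        neg_mul_neg, neg_mul_neg, inv_neg, neg_mul_neg, mul_inv, mul_inv, inv_inv, inv_div,
        mul_comm (yo i - xi k)⁻¹]
    rw [e] at h1 h2
    have hq0 : 0 < q := by
      by_contra hn
      have : q⁻¹ ≤ 0 := inv_nonpos.2 (not_lt.1 hn)
      linarith
    have hq1 : q ≤ 1 := by rw [one_le_inv₀ hq0] at h1; exact h1
    have h3 : q⁻¹ ≤ 1 + T := by rw [hT]; rw [neg_sq] at h2; exact h2
    rw [abs_of_nonneg (by linarith)]
    have h4 : 1 - q ≤ q⁻¹ - 1 := by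
      have := mul_inv_cancel₀ hq0.ne'
      nlinarith
    linarith

theorem abs_log_gramDet_sub_le (h : Interlacing (Sum.elim xo xi) (Sum.elim yo yi)) {μ : ℝ}
    (hμ0 : 0 < μ) (hμ1 : μ < 1) (hi : ∀ k, -μ ≤ xi k ∧ yi k ≤ μ) (ho : ∀ i, μ < |yo i|) (n : ℕ) :
    |Real.log (gramDet n (Sum.elim xo xi) (Sum.elim yo yi)) - Real.log (gramDet n xo yo)| ≤
      16 / ((1 - μ) * (n + 1)) := by
  set x := Sum.elim xo xi with hx
  set y := Sum.elim yo yi with hy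
  have hz : ∀ a, 0 ≤ Sum.elim (hankelWeight xo yo) (0 : κ → ℝ) a := by
    rintro (a | a)
    · exact (h.outer.hankelWeight_pos a).le
    · exact le_rfl
  have key := abs_log_det_sub_le (gramMat_posSemidef n h.abs_y) hz fun a => (h.hankelWeight_pos a).le
  rw [gramMat_mul_diagonal_zero_inr] at key
  refine key.trans ?_
  have hpt : ∀ a, |hankelWeight x y a - Sum.elim (hankelWeight xo yo) (0 : κ → ℝ) a| ≤
      4 / (1 - μ) * (1 - y a * y a) *
        (hankelWeight x y a + Sum.elim (hankelWeight xo yo) (0 : κ → ℝ) a) := by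
    intro a
    have h1 := h.abs_y a
    have hw := h.hankelWeight_pos a
    have hμ' : 0 < 1 - μ := by linarith
    have hsq : y a * y a = |y a| ^ 2 := by rw [sq_abs, sq]
    by_cases hq : |y a| < (1 + μ) / 2
    · have h2 : 1 ≤ 4 / (1 - μ) * (1 - y a * y a) := by
        rw [div_mul_eq_mul_div, le_div_iff₀ hμ', hsq]
        nlinarith [abs_nonneg (y a)]
      calc _ ≤ hankelWeight x y a + Sum.elim (hankelWeight xo yo) (0 : κ → ℝ) a := by
            rw [abs_le]; constructor <;> linarith [hz a]
        _ ≤ _ := le_mul_of_one_le_left (by linarith [hz a]) h2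
    · rw [not_lt] at hq
      rcases a with a | a
      · have h3 := abs_hankelWeight_sub_le h hμ0 hi (ho a)
        simp only [hy, Sum.elim_inl] at hq h1 hw hsq ⊢
        rw [abs_sub_comm]
        refine h3.trans ?_
        have hwo := h.outer.hankelWeight_pos a
        have hy2 : 0 ≤ 1 - yo a * yo a := by rw [hsq]; nlinarith [abs_nonneg (yo a)]
        have h4 : 2 * μ * (1 - yo a ^ 2) / ((|yo a| - μ) * (1 + μ * |yo a|)) ≤
            4 / (1 - μ) * (1 - yo a * yo a) := by
          rw [div_mul_eq_mul_div, div_le_div_iff₀ (mul_pos (by linarith) (by positivity)) hμ', sq]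
          have : μ * (1 - μ) ≤ 2 * ((|yo a| - μ) * (1 + μ * |yo a|)) := by
            have h5 : (1 - μ) / 2 ≤ |yo a| - μ := by linarith
            have h6 : 0 ≤ μ * |yo a| := by positivity
            nlinarith
          nlinarith [mul_le_mul_of_nonneg_left this hy2]
        calc _ ≤ 4 / (1 - μ) * (1 - yo a * yo a) * hankelWeight xo yo a :=
              mul_le_mul_of_nonneg_right h4 hwo.le
          _ ≤ _ := mul_le_mul_of_nonneg_left (by linarith) (by positivity)
      · exfalso
        have h5 := hi a
        have h6 := h.lt (Sum.inr a)
        simp only [hy, hx, Sum.elim_inr] at hq h6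
        have : |yi a| ≤ μ := abs_le.2 ⟨by linarith, h5.2⟩
        linarith
  have hsum : ∑ a, |hankelWeight x y a - Sum.elim (hankelWeight xo yo) (0 : κ → ℝ) a| *
      gramMat n y a a ≤ 4 / (1 - μ) * (hankelSeq x y (2 * n) + hankelSeq xo yo (2 * n)) := by
    have e : hankelSeq xo yo (2 * n) =
        ∑ a, Sum.elim (hankelWeight xo yo) (0 : κ → ℝ) a * y a ^ (2 * n) := by
      rw [Fintype.sum_sum_type]; simp [hankelSeq, hy]
    rw [e, hankelSeq, ← Finset.sum_add_distrib, Finset.mul_sum]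
    refine Finset.sum_le_sum fun a _ => ?_
    have hp := one_sub_mul_pos (h.abs_y a) (h.abs_y a)
    have hg : gramMat n y a a = y a ^ (2 * n) / (1 - y a * y a) := by
      rw [gramMat, Matrix.of_apply, pow_mul, sq]
    have hyp : 0 ≤ y a ^ (2 * n) := by rw [pow_mul]; positivity
    rw [hg]
    refine (mul_le_mul_of_nonneg_right (hpt a) (div_nonneg hyp hp.le)).trans (le_of_eq ?_)
    have hc : ∀ c q w r s : ℝ, q ≠ 0 → c * q * (w + s) * (r / q) = c * (w * r + s * r) := by
      intro c q w r s hq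
      field_simp
    exact hc _ _ _ _ _ hp.ne'
  refine hsum.trans ?_
  have h1 := hankelSeq_even_le h n
  have h2 := hankelSeq_even_le h.outer n
  calc _ ≤ 4 / (1 - μ) * (2 / (n + 1) + 2 / (n + 1)) :=
        mul_le_mul_of_nonneg_left (add_le_add h1 h2) (div_nonneg (by norm_num) (by linarith))
    _ = _ := by
      have : 1 - μ ≠ 0 := by linarith
      field_simp
      norm_num

end

/-- Left nodes of the equidistant subdivision of `[p, q]` into `M` cells. -/
def blkX (p q : ℝ) (M : ℕ) (i : Fin M) : ℝ := p + ((i : ℝ) + 1 / 4) * ((q - p) / M)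

/-- Right nodes of the equidistant subdivision of `[p, q]` into `M` cells. -/
def blkY (p q : ℝ) (M : ℕ) (i : Fin M) : ℝ := p + ((i : ℝ) + 3 / 4) * ((q - p) / M)

lemma blk_bounds {p q : ℝ} (hpq : p < q) {M : ℕ} (i : Fin M) :
    p < blkX p q M i ∧ blkX p q M i < blkY p q M i ∧ blkY p q M i < q := by
  have hM : (0 : ℝ) < M := by exact_mod_cast Fin.pos i
  have hh : 0 < (q - p) / M := div_pos (by linarith) hM
  have hi : (i : ℝ) + 1 ≤ M := by exact_mod_cast i.2
  have hi0 : (0 : ℝ) ≤ (i : ℝ) := by positivity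
  have e : (M : ℝ) * ((q - p) / M) = q - p := by field_simp
  unfold blkX blkY
  refine ⟨by nlinarith, by nlinarith, by nlinarith⟩

lemma blk_sep {p q : ℝ} (hpq : p < q) {M : ℕ} {i j : Fin M} (hij : i ≠ j) :
    blkY p q M i < blkX p q M j ∨ blkY p q M j < blkX p q M i := by
  have hM : (0 : ℝ) < M := by exact_mod_cast Fin.pos i
  have hh : 0 < (q - p) / M := div_pos (by linarith) hM
  unfold blkX blkY
  rcases lt_or_gt_of_ne hij with h | h
  · left
    have : (i : ℝ) + 1 ≤ (j : ℝ) := by exact_mod_cast h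
    nlinarith
  · right
    have : (j : ℝ) + 1 ≤ (i : ℝ) := by exact_mod_cast h
    nlinarith

lemma sum_blk_sub (p q : ℝ) {M : ℕ} (hM : 0 < M) :
    ∑ i, (blkY p q M i - blkX p q M i) = (q - p) / 2 := by
  have hM' : (M : ℝ) ≠ 0 := by exact_mod_cast hM.ne'
  have : ∀ i : Fin M, blkY p q M i - blkX p q M i = (q - p) / M / 2 := fun i => by
    unfold blkX blkY; ring
  simp only [this, Finset.sum_const, Finset.card_univ, Fintype.card_fin, nsmul_eq_mul]
  field_simp

lemma norm_taylor_le {E : Type*} [NormedAddCommGroup E] [NormedSpace ℝ E] {φ φ' : ℝ → E}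
    {p q K : ℝ} (hφ : ∀ t ∈ Set.Icc p q, HasDerivAt φ (φ' t) t)
    (hK : ∀ s ∈ Set.Icc p q, ∀ t ∈ Set.Icc p q, ‖φ' s - φ' t‖ ≤ K * |s - t|) (hK0 : 0 ≤ K)
    {c s : ℝ} (hc : c ∈ Set.Icc p q) (hs : s ∈ Set.Icc p q) :
    ‖φ s - φ c - (s - c) • φ' c‖ ≤ K * (s - c) ^ 2 := by
  have hsub : Set.uIcc c s ⊆ Set.Icc p q := Set.uIcc_subset_Icc hc hs
  have h := (convex_uIcc c s).norm_image_sub_le_of_norm_hasDerivWithin_le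
    (f := fun t => φ t - (t - c) • φ' c) (f' := fun t => φ' t - φ' c) (C := K * |s - c|)
    (x := c) (y := s) ?_ ?_ Set.left_mem_uIcc Set.right_mem_uIcc
  · rw [sub_self, zero_smul, sub_zero, Real.norm_eq_abs, mul_assoc, abs_mul_abs_self] at h
    rw [sq]
    convert h using 2
    abel
  · intro t ht
    have h1 := (hφ t (hsub ht)).sub (((hasDerivAt_id t).sub_const c).smul_const (φ' c))
    refine HasDerivAt.hasDerivWithinAt (h1.congr_deriv (by simp))
  · intro t ht
    refine (hK t (hsub ht) c hc).trans (mul_le_mul_of_nonneg_left ?_ hK0)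
    exact Set.abs_sub_left_of_mem_uIcc ht |>.trans le_rfl

lemma norm_sum_blk_sub_le {E : Type*} [NormedAddCommGroup E] [NormedSpace ℝ E] {φ φ' : ℝ → E}
    {p q K : ℝ} (hpq : p < q) (hφ : ∀ t ∈ Set.Icc p q, HasDerivAt φ (φ' t) t)
    (hK : ∀ s ∈ Set.Icc p q, ∀ t ∈ Set.Icc p q, ‖φ' s - φ' t‖ ≤ K * |s - t|) (hK0 : 0 ≤ K)
    {M : ℕ} (hM : 0 < M) :
    ‖∑ i, (φ (blkY p q M i) - φ (blkX p q M i)) - (1 / 2 : ℝ) • (φ q - φ p)‖ ≤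
      K * (q - p) ^ 2 * (1 / M) := by
  have hM' : (0 : ℝ) < M := by exact_mod_cast hM
  set h : ℝ := (q - p) / M with hh
  have hh0 : 0 < h := div_pos (by linarith) hM'
  have hMh : (M : ℝ) * h = q - p := by rw [hh]; field_simp
  have htel : φ q - φ p = ∑ i : Fin M, (φ (p + ((i : ℝ) + 1) * h) - φ (p + (i : ℝ) * h)) := by
    rw [Fin.sum_univ_eq_sum_range (fun i => φ (p + ((i : ℝ) + 1) * h) - φ (p + (i : ℝ) * h))]
    have := Finset.sum_range_sub (fun i : ℕ => φ (p + (i : ℝ) * h)) M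
    simp only [Nat.cast_add, Nat.cast_one, Nat.cast_zero, zero_mul, add_zero, hMh] at this
    rw [this]
    congr 2
    ring
  rw [htel, Finset.smul_sum, ← Finset.sum_sub_distrib]
  refine (norm_sum_le _ _).trans ((Finset.sum_le_sum (g := fun _ => K * h ^ 2) fun i _ => ?_).trans
    (le_of_eq ?_))
  · have hi : (i : ℝ) + 1 ≤ M := by exact_mod_cast i.2
    have hi0 : (0 : ℝ) ≤ (i : ℝ) := by positivity
    have hmem : ∀ r : ℝ, 0 ≤ r → r ≤ 1 → p + ((i : ℝ) + r) * h ∈ Set.Icc p q := fun r h0 h1 =>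
      ⟨by nlinarith, by nlinarith⟩
    have hc := hmem (1 / 2) (by norm_num) (by norm_num)
    have T : ∀ r : ℝ, 0 ≤ r → r ≤ 1 → _ := fun r h0 h1 =>
      norm_taylor_le hφ hK hK0 hc (hmem r h0 h1)
    have T1 := T (3 / 4) (by norm_num) (by norm_num)
    have T2 := T (1 / 4) (by norm_num) (by norm_num)
    have T3 := T 1 (by norm_num) le_rfl
    have T4 := T 0 le_rfl (by norm_num)
    set c := p + ((i : ℝ) + 1 / 2) * h with hcd
    have e : ∀ r : ℝ, p + ((i : ℝ) + r) * h - c = (r - 1 / 2) * h := fun r => by rw [hcd]; ring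
    rw [e] at T1 T2 T3 T4
    rw [add_zero] at T4
    have key : φ (blkY p q M i) - φ (blkX p q M i) -
        (1 / 2 : ℝ) • (φ (p + ((i : ℝ) + 1) * h) - φ (p + (i : ℝ) * h)) =
        (φ (p + ((i : ℝ) + 3 / 4) * h) - φ c - ((3 / 4 - 1 / 2) * h) • φ' c) -
        (φ (p + ((i : ℝ) + 1 / 4) * h) - φ c - ((1 / 4 - 1 / 2) * h) • φ' c) -
        (1 / 2 : ℝ) • (φ (p + ((i : ℝ) + 1) * h) - φ c - ((1 - 1 / 2) * h) • φ' c) +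
        (1 / 2 : ℝ) • (φ (p + (i : ℝ) * h) - φ c - ((0 - 1 / 2) * h) • φ' c) := by
      rw [blkX, blkY, ← hh]
      module
    rw [key]
    refine (norm_add_le _ _).trans ?_
    refine (add_le_add (norm_sub_le _ _) le_rfl).trans ?_
    refine (add_le_add (add_le_add (norm_sub_le _ _) le_rfl) le_rfl).trans ?_
    rw [norm_smul, norm_smul, Real.norm_eq_abs, abs_of_pos (by norm_num : (0 : ℝ) < 1 / 2)]
    have : 0 ≤ K * h ^ 2 := by positivity
    nlinarith
  · rw [Finset.sum_const, Finset.card_univ, Fintype.card_fin, nsmul_eq_mul, hh]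
    field_simp

lemma tendsto_sum_blk {E : Type*} [NormedAddCommGroup E] [NormedSpace ℝ E] {φ φ' : ℝ → E}
    {p q K : ℝ} (hpq : p < q) (hφ : ∀ t ∈ Set.Icc p q, HasDerivAt φ (φ' t) t)
    (hK : ∀ s ∈ Set.Icc p q, ∀ t ∈ Set.Icc p q, ‖φ' s - φ' t‖ ≤ K * |s - t|) (hK0 : 0 ≤ K) :
    Tendsto (fun M : ℕ => ∑ i, (φ (blkY p q M i) - φ (blkX p q M i))) atTop
      (nhds ((1 / 2 : ℝ) • (φ q - φ p))) := by
  rw [tendsto_iff_norm_sub_tendsto_zero]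
  have h1 : Tendsto (fun M : ℕ => K * (q - p) ^ 2 * (1 / (M : ℝ))) atTop (nhds 0) := by
    rw [← mul_zero (K * (q - p) ^ 2)]
    exact tendsto_const_nhds.mul (tendsto_const_div_atTop_nhds_zero_nat 1)
  refine squeeze_zero' (Eventually.of_forall fun _ => norm_nonneg _) ?_ h1
  filter_upwards [eventually_gt_atTop 0] with M hM
  exact norm_sum_blk_sub_le hpq hφ hK hK0 hM

lemma tendsto_sum_blk_log {p q d : ℝ} (hpq : p < q) {z : ℂ} (hz : ‖z‖ ≤ 1) (hd : 0 < d)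
    (h : ∀ t ∈ Set.Icc p q, 1 - (t : ℂ) * z ∈ Complex.slitPlane ∧ d ≤ ‖1 - (t : ℂ) * z‖) :
    Tendsto (fun M : ℕ => ∑ i, (Complex.log (1 - (blkY p q M i : ℂ) * z) -
      Complex.log (1 - (blkX p q M i : ℂ) * z))) atTop
      (nhds ((1 / 2 : ℝ) • (Complex.log (1 - (q : ℂ) * z) - Complex.log (1 - (p : ℂ) * z)))) := by
  refine tendsto_sum_blk (φ := fun t : ℝ => Complex.log (1 - (t : ℂ) * z))
    (φ' := fun t : ℝ => -z / (1 - (t : ℂ) * z)) (K := 1 / (d * d)) hpq ?_ ?_ (by positivity)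
  · intro t ht
    have h1 : HasDerivAt (fun t : ℝ => 1 - (t : ℂ) * z) (-z) t := by
      have := ((Complex.ofRealCLM.hasDerivAt (x := t)).mul_const z).const_sub 1
      refine this.congr_deriv (by simp)
    exact h1.clog_real (h t ht).1
  · intro s hs t ht
    have h1 := (h s hs).2
    have h2 := (h t ht).2
    have n1 : 1 - (s : ℂ) * z ≠ 0 := norm_pos_iff.1 (hd.trans_le h1)
    have n2 : 1 - (t : ℂ) * z ≠ 0 := norm_pos_iff.1 (hd.trans_le h2)
    have e : -z / (1 - (s : ℂ) * z) - -z / (1 - (t : ℂ) * z) =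
        ((t - s : ℝ) : ℂ) * (z * z) / ((1 - (s : ℂ) * z) * (1 - (t : ℂ) * z)) := by
      rw [div_sub_div _ _ n1 n2]
      congr 1
      push_cast
      ring
    rw [e, norm_div, norm_mul, norm_mul, norm_mul, Complex.norm_real, Real.norm_eq_abs,
      abs_sub_comm, div_le_iff₀ (by positivity)]
    have hzz : ‖z‖ * ‖z‖ ≤ 1 := by nlinarith [norm_nonneg z]
    have hdd : d * d ≤ ‖1 - (s : ℂ) * z‖ * ‖1 - (t : ℂ) * z‖ :=
      mul_le_mul h1 h2 hd.le (norm_nonneg _)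
    calc |s - t| * (‖z‖ * ‖z‖) ≤ |s - t| * 1 := mul_le_mul_of_nonneg_left hzz (abs_nonneg _)
      _ = 1 / (d * d) * |s - t| * (d * d) := by field_simp
      _ ≤ _ := mul_le_mul_of_nonneg_left hdd (by positivity)

lemma one_sub_mul_circ_bounds {θ : ℝ} (hθ : Real.sin θ ≠ 0) {t : ℝ} (h1 : -1 ≤ t) (h2 : t ≤ 1) :
    1 - (t : ℂ) * circ θ ∈ Complex.slitPlane ∧ |Real.sin θ| ≤ ‖1 - (t : ℂ) * circ θ‖ := by
  have hc : circ θ = Real.cos θ + Real.sin θ * Complex.I := by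
    rw [circ, mul_comm, Complex.exp_mul_I]; push_cast; ring
  have hre : (1 - (t : ℂ) * circ θ).re = 1 - t * Real.cos θ := by
    rw [hc]; simp [-Complex.ofReal_cos, -Complex.ofReal_sin]
  have him : (1 - (t : ℂ) * circ θ).im = -(t * Real.sin θ) := by
    rw [hc]; simp [-Complex.ofReal_cos, -Complex.ofReal_sin]
  have hsc := Real.sin_sq_add_cos_sq θ
  have hs : 0 < Real.sin θ ^ 2 := by positivity
  constructor
  · rw [Complex.mem_slitPlane_iff]
    left
    rw [hre]
    have : t * Real.cos θ ≤ |Real.cos θ| := by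
      calc t * Real.cos θ ≤ |t * Real.cos θ| := le_abs_self _
        _ = |t| * |Real.cos θ| := abs_mul _ _
        _ ≤ 1 * |Real.cos θ| := mul_le_mul_of_nonneg_right (abs_le.2 ⟨h1, h2⟩) (abs_nonneg _)
        _ = _ := one_mul _
    have : |Real.cos θ| < 1 := by rw [← sq_lt_one_iff_abs_lt_one]; linarith
    linarith
  · rw [← sq_le_sq₀ (abs_nonneg _) (norm_nonneg _), sq_abs, Complex.sq_norm, Complex.normSq_apply,
      hre, him]
    nlinarith [sq_nonneg (t - Real.cos θ)]

lemma sin_neg_ne_zero {θ : ℝ} (hθ : Real.sin θ ≠ 0) : Real.sin (-θ) ≠ 0 := by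
  rw [Real.sin_neg]; exact neg_ne_zero.2 hθ

lemma tendsto_prod_blk {p q : ℝ} (hpq : p < q) (hp : -1 ≤ p) (hq : q ≤ 1) {θ : ℝ}
    (hθ : Real.sin θ ≠ 0) :
    Tendsto (fun M : ℕ => ∏ i, (1 - (blkY p q M i : ℂ) * circ θ) /
      (1 - (blkX p q M i : ℂ) * circ θ)) atTop
      (nhds (Complex.exp ((1 / 2 : ℂ) * (Complex.log (1 - (q : ℂ) * circ θ) -
        Complex.log (1 - (p : ℂ) * circ θ))))) := by
  have hb : ∀ t ∈ Set.Icc p q, _ := fun t ht =>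
    one_sub_mul_circ_bounds hθ (hp.trans ht.1) (ht.2.trans hq)
  have h := (Complex.continuous_exp.tendsto _).comp
    (tendsto_sum_blk_log hpq (norm_circ θ).le (abs_pos.2 hθ) hb)
  have e : ((1 / 2 : ℝ) • (Complex.log (1 - (q : ℂ) * circ θ) -
      Complex.log (1 - (p : ℂ) * circ θ))) = (1 / 2 : ℂ) * (Complex.log (1 - (q : ℂ) * circ θ) -
        Complex.log (1 - (p : ℂ) * circ θ)) := by
    rw [Complex.real_smul]; push_cast; ring
  rw [e] at h
  refine h.congr fun M => ?_
  rw [Function.comp_apply, Complex.exp_sum]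
  refine Finset.prod_congr rfl fun i _ => ?_
  obtain ⟨b1, b2, b3⟩ := blk_bounds hpq i
  have n1 := Complex.slitPlane_ne_zero (hb (blkX p q M i) ⟨b1.le, by linarith⟩).1
  have n2 := Complex.slitPlane_ne_zero (hb (blkY p q M i) ⟨by linarith, b3.le⟩).1
  rw [Complex.exp_sub, Complex.exp_log n1, Complex.exp_log n2]

lemma norm_exp_half_sq (w : ℂ) : ‖Complex.exp ((1 / 2 : ℂ) * w)‖ ^ 2 = ‖Complex.exp w‖ := by
  rw [← norm_pow, ← Complex.exp_nat_mul]
  congr 2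
  push_cast
  ring

lemma norm_one_sub_mul_circ_sq (t θ : ℝ) :
    ‖1 - (t : ℂ) * circ θ‖ ^ 2 = 1 - 2 * t * Real.cos θ + t ^ 2 := by
  have hc : circ θ = Real.cos θ + Real.sin θ * Complex.I := by
    rw [circ, mul_comm, Complex.exp_mul_I]; push_cast; ring
  rw [Complex.sq_norm, Complex.normSq_apply, hc]
  simp [-Complex.ofReal_cos, -Complex.ofReal_sin]
  linear_combination t ^ 2 * Real.sin_sq_add_cos_sq θ

lemma tendsto_prod_blk_weight {p q : ℝ} (hpq : p < q) (hp : -1 ≤ p) (hq : q ≤ 1) {θ : ℝ}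
    (hθ : Real.sin θ ≠ 0) :
    Tendsto (fun M : ℕ => ∏ i, (1 - 2 * blkY p q M i * Real.cos θ + blkY p q M i ^ 2) /
      (1 - 2 * blkX p q M i * Real.cos θ + blkX p q M i ^ 2)) atTop
      (nhds (‖1 - (q : ℂ) * circ θ‖ / ‖1 - (p : ℂ) * circ θ‖)) := by
  have h := ((tendsto_prod_blk hpq hp hq hθ).norm).pow 2
  have n1 := Complex.slitPlane_ne_zero (one_sub_mul_circ_bounds hθ hp (hpq.le.trans hq)).1
  have n2 := Complex.slitPlane_ne_zero (one_sub_mul_circ_bounds hθ (hp.trans hpq.le) hq).1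
  rw [norm_exp_half_sq, Complex.exp_sub, Complex.exp_log n1, Complex.exp_log n2, norm_div] at h
  refine h.congr fun M => ?_
  rw [norm_prod, ← Finset.prod_pow]
  refine Finset.prod_congr rfl fun i _ => ?_
  rw [norm_div, div_pow, norm_one_sub_mul_circ_sq, norm_one_sub_mul_circ_sq]

lemma ratWeight_mul_le {ι : Type*} [Fintype ι] {x y : ι → ℝ}
    (h : Interlacing x y) {θ : ℝ} (hθ : Real.sin θ ≠ 0) :
    ratWeight x y θ * (1 + Real.cos θ) ≤ 2 := by
  set c := Real.cos θ with hc
  have hs : 0 < 1 - c ^ 2 := by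
    have := Real.sin_sq_add_cos_sq θ
    have : 0 < Real.sin θ ^ 2 := by positivity
    rw [hc]; linarith
  have hc1 : |c| < 1 := by rw [← sq_lt_one_iff_abs_lt_one]; linarith
  obtain ⟨hc1, hc2⟩ := abs_lt.1 hc1
  have hf : ∀ t, 0 < 1 - 2 * t * c + t ^ 2 := fun t => by nlinarith [sq_nonneg (t - c)]
  set φ : ℝ → ℝ := fun t => Real.log (1 - 2 * max t c * c + max t c ^ 2) with hφ
  have hmono : MonotoneOn φ (Set.Icc (-1) 1) := by
    intro s _ t _ hst
    refine Real.log_le_log (hf _) ?_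
    have h1 : max s c ≤ max t c := max_le_max_right c hst
    have h2 : c ≤ max s c := le_max_right _ _
    nlinarith
  have key : ∀ i, Real.log (1 - 2 * y i * c + y i ^ 2) - Real.log (1 - 2 * x i * c + x i ^ 2) ≤
      φ (y i) - φ (x i) := by
    intro i
    have hlt := h.lt i
    have hmin : ∀ t, Real.log (1 - 2 * c * c + c ^ 2) ≤ Real.log (1 - 2 * t * c + t ^ 2) :=
      fun t => Real.log_le_log (hf c) (by nlinarith [sq_nonneg (t - c)])
    rcases le_total (y i) c with hy | hy
    · have hx : x i ≤ c := hlt.le.trans hy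
      simp only [hφ, max_eq_right hy, max_eq_right hx, sub_self]
      exact sub_nonpos.2 (Real.log_le_log (hf _) (by nlinarith))
    · rcases le_total (x i) c with hx | hx
      · simp only [hφ, max_eq_left hy, max_eq_right hx]
        linarith [hmin (x i)]
      · simp only [hφ, max_eq_left hy, max_eq_left hx, le_refl]
  have hsum := sum_sub_le_of_monotoneOn h.lt h.sep Finset.univ 1 (by norm_num : (-1 : ℝ) ≤ 1) hmono
    fun i _ => ⟨(h.lower i).le, (h.upper i).le⟩
  have e : ratWeight x y θ = Real.exp (∑ i, (Real.log (1 - 2 * y i * c + y i ^ 2) -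
      Real.log (1 - 2 * x i * c + x i ^ 2))) := by
    rw [Real.exp_sum]
    exact Finset.prod_congr rfl fun i _ => by
      rw [Real.exp_sub, Real.exp_log (hf _), Real.exp_log (hf _)]
  have h2 : ratWeight x y θ ≤ Real.exp (φ 1 - φ (-1)) := by
    rw [e]
    exact Real.exp_le_exp.2 ((Finset.sum_le_sum fun i _ => key i).trans hsum)
  rw [Real.exp_sub, hφ, Real.exp_log (hf _), Real.exp_log (hf _), max_eq_left hc2.le,
    max_eq_right hc1.le, le_div_iff₀ (hf c)] at h2
  have h3 : (ratWeight x y θ * (1 + c)) * (1 - c) ≤ 2 * (1 - c) := by nlinarith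
  exact le_of_mul_le_mul_right h3 (by linarith)

lemma ae_sin_ne_zero : ∀ᵐ θ : ℝ, Real.sin θ ≠ 0 := by
  rw [ae_iff]
  refine Set.Countable.measure_zero ?_ _
  refine (Set.countable_range fun n : ℤ => (n : ℝ) * Real.pi).mono ?_
  intro θ hθ
  simp only [not_not, Set.mem_ofPred_eq] at hθ
  exact Real.sin_eq_zero_iff.1 hθ

/-- Left nodes on `[-1, -μ] ∪ [μ, 1]`. -/
def outX (μ : ℝ) (M : ℕ) : Fin M ⊕ Fin M → ℝ := Sum.elim (blkX (-1) (-μ) M) (blkX μ 1 M)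

/-- Right nodes on `[-1, -μ] ∪ [μ, 1]`. -/
def outY (μ : ℝ) (M : ℕ) : Fin M ⊕ Fin M → ℝ := Sum.elim (blkY (-1) (-μ) M) (blkY μ 1 M)

/-- Left nodes on `[-1, -μ] ∪ [μ, 1] ∪ [-μ, μ]`. -/
abbrev allX (μ : ℝ) (M : ℕ) : (Fin M ⊕ Fin M) ⊕ Fin M → ℝ :=
  Sum.elim (outX μ M) (blkX (-μ) μ M)

/-- Right nodes on `[-1, -μ] ∪ [μ, 1] ∪ [-μ, μ]`. -/
abbrev allY (μ : ℝ) (M : ℕ) : (Fin M ⊕ Fin M) ⊕ Fin M → ℝ :=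
  Sum.elim (outY μ M) (blkY (-μ) μ M)

section
variable {μ : ℝ}

lemma interlacing_all (h0 : 0 < μ) (h1 : μ < 1) (M : ℕ) : Interlacing (allX μ M) (allY μ M) := by
  have A : ∀ i : Fin M, _ := fun i => blk_bounds (show (-1 : ℝ) < -μ by linarith) i
  have B : ∀ i : Fin M, _ := fun i => blk_bounds h1 i
  have C : ∀ i : Fin M, _ := fun i => blk_bounds (show -μ < μ by linarith) i
  constructor
  · rintro ((i | i) | i) <;> simp only [allX, outX, Sum.elim_inl, Sum.elim_inr] <;>
      linarith [(A i).1, (B i).1, (C i).1]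
  · rintro ((i | i) | i) <;> simp only [allY, outY, Sum.elim_inl, Sum.elim_inr] <;>
      linarith [(A i).2.2, (B i).2.2, (C i).2.2]
  · rintro ((i | i) | i) <;> simp only [allX, outX, allY, outY, Sum.elim_inl, Sum.elim_inr] <;>
      linarith [(A i).2.1, (B i).2.1, (C i).2.1]
  · rintro ((i | i) | i) ((j | j) | j) hij <;>
      simp only [allX, outX, allY, outY, Sum.elim_inl, Sum.elim_inr]
    · exact blk_sep (by linarith) (fun e => hij (by rw [e]))
    · left; linarith [(A i).2.2, (B j).1]
    · left; linarith [(A i).2.2, (C j).1]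
    · right; linarith [(A j).2.2, (B i).1]
    · exact blk_sep (by linarith) (fun e => hij (by rw [e]))
    · right; linarith [(C j).2.2, (B i).1]
    · right; linarith [(A j).2.2, (C i).1]
    · left; linarith [(C i).2.2, (B j).1]
    · exact blk_sep (by linarith) (fun e => hij (by rw [e]))

lemma interlacing_out (h0 : 0 < μ) (h1 : μ < 1) (M : ℕ) : Interlacing (outX μ M) (outY μ M) :=
  (interlacing_all h0 h1 M).outer

lemma lt_abs_outY (h1 : μ < 1) (M : ℕ) (i : Fin M ⊕ Fin M) : μ < |outY μ M i| := by
  rcases i with i | i <;> simp only [outY, Sum.elim_inl, Sum.elim_inr]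
  · have := blk_bounds (show (-1 : ℝ) < -μ by linarith) i
    exact lt_abs.2 (Or.inr (by linarith))
  · have := blk_bounds h1 i
    exact lt_abs.2 (Or.inl (by linarith))

lemma tendsto_ratWeight_out (h0 : 0 < μ) (h1 : μ < 1) {θ : ℝ} (hθ : Real.sin θ ≠ 0) :
    Tendsto (fun M => ratWeight (outX μ M) (outY μ M) θ) atTop
      (nhds (‖1 - ((-μ : ℝ) : ℂ) * circ θ‖ / ‖1 - ((-1 : ℝ) : ℂ) * circ θ‖ *
        (‖1 - ((1 : ℝ) : ℂ) * circ θ‖ / ‖1 - (μ : ℂ) * circ θ‖))) := by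
  refine ((tendsto_prod_blk_weight (show (-1 : ℝ) < -μ by linarith) le_rfl (by linarith) hθ).mul
    (tendsto_prod_blk_weight h1 (by linarith) le_rfl hθ)).congr fun M => ?_
  rw [ratWeight, Fintype.prod_sum_type]
  rfl

lemma tendsto_ratWeight_all (h0 : 0 < μ) (h1 : μ < 1) {θ : ℝ} (hθ : Real.sin θ ≠ 0) :
    Tendsto (fun M => ratWeight (allX μ M) (allY μ M) θ) atTop
      (nhds (‖1 - ((1 : ℝ) : ℂ) * circ θ‖ / ‖1 - ((-1 : ℝ) : ℂ) * circ θ‖)) := by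
  have := (tendsto_ratWeight_out h0 h1 hθ).mul
    (tendsto_prod_blk_weight (show -μ < μ by linarith) (by linarith) h1.le hθ)
  have hn : ∀ t : ℝ, -1 ≤ t → t ≤ 1 → ‖1 - (t : ℂ) * circ θ‖ ≠ 0 := fun t a b =>
    norm_ne_zero_iff.2 (Complex.slitPlane_ne_zero (one_sub_mul_circ_bounds hθ a b).1)
  have e : ‖1 - ((-μ : ℝ) : ℂ) * circ θ‖ / ‖1 - ((-1 : ℝ) : ℂ) * circ θ‖ *
        (‖1 - ((1 : ℝ) : ℂ) * circ θ‖ / ‖1 - (μ : ℂ) * circ θ‖) *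
        (‖1 - (μ : ℂ) * circ θ‖ / ‖1 - ((-μ : ℝ) : ℂ) * circ θ‖) =
      ‖1 - ((1 : ℝ) : ℂ) * circ θ‖ / ‖1 - ((-1 : ℝ) : ℂ) * circ θ‖ := by
    have n1 := hn (-μ) (by linarith) (by linarith)
    have n2 := hn μ (by linarith) (by linarith)
    have n3 := hn (-1) (by linarith) (by linarith)
    generalize ‖1 - ((-μ : ℝ) : ℂ) * circ θ‖ = a at *
    generalize ‖1 - (μ : ℂ) * circ θ‖ = b at *
    generalize ‖1 - ((-1 : ℝ) : ℂ) * circ θ‖ = d at *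
    field_simp
  rw [e] at this
  refine this.congr fun M => ?_
  exact (Fintype.prod_sum_type fun i => (1 - 2 * allY μ M i * Real.cos θ + allY μ M i ^ 2) /
    (1 - 2 * allX μ M i * Real.cos θ + allX μ M i ^ 2)).symm

lemma norm_quot_mul_one_add_cos {θ : ℝ} (hθ : 0 < Real.sin θ) :
    ‖1 - ((1 : ℝ) : ℂ) * circ θ‖ / ‖1 - ((-1 : ℝ) : ℂ) * circ θ‖ * (1 + Real.cos θ) =
      Real.sin θ := by
  have n : 0 < ‖1 - ((-1 : ℝ) : ℂ) * circ θ‖ := norm_pos_iff.2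
    (Complex.slitPlane_ne_zero (one_sub_mul_circ_bounds hθ.ne' le_rfl (by norm_num)).1)
  have e1 := norm_one_sub_mul_circ_sq 1 θ
  have e2 := norm_one_sub_mul_circ_sq (-1) θ
  have hc : 0 ≤ 1 + Real.cos θ := by linarith [Real.neg_one_le_cos θ]
  rw [← sq_eq_sq₀ (by positivity) hθ.le, mul_pow, div_pow, e1, e2]
  have hc' := pow_pos n 2
  rw [e2] at hc'
  rw [div_mul_eq_mul_div, div_eq_iff hc'.ne', Real.sin_sq]
  ring

/-- The parameter of the limiting weight. -/
def jacParam (μ : ℝ) : ℝ := 2 * μ / (1 + μ ^ 2)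

lemma norm_quot_eq_sqrt (h0 : 0 < μ) (θ : ℝ) :
    ‖1 - ((-μ : ℝ) : ℂ) * circ θ‖ / ‖1 - (μ : ℂ) * circ θ‖ =
      √((1 + jacParam μ * Real.cos θ) / (1 - jacParam μ * Real.cos θ)) := by
  have e1 := norm_one_sub_mul_circ_sq (-μ) θ
  have e2 := norm_one_sub_mul_circ_sq μ θ
  rw [eq_comm, ← Real.sqrt_sq (div_nonneg (norm_nonneg (1 - ((-μ : ℝ) : ℂ) * circ θ))
    (norm_nonneg (1 - (μ : ℂ) * circ θ))), div_pow, e1, e2]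
  congr 1
  have hp : 0 < 1 + μ ^ 2 := by positivity
  have a1 : 1 + jacParam μ * Real.cos θ =
      (1 - 2 * (-μ) * Real.cos θ + (-μ) ^ 2) / (1 + μ ^ 2) := by
    unfold jacParam; field_simp; ring
  have a2 : 1 - jacParam μ * Real.cos θ = (1 - 2 * μ * Real.cos θ + μ ^ 2) / (1 + μ ^ 2) := by
    unfold jacParam; field_simp; ring
  rw [a1, a2, div_div_div_cancel_right₀ hp.ne']

lemma tendsto_integral_ratWeight {ι : ℕ → Type} [∀ M, Fintype (ι M)] [∀ M, DecidableEq (ι M)]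
    {x y : ∀ M, ι M → ℝ} (h : ∀ M, Interlacing (x M) (y M)) {w : ℝ → ℝ}
    (hw : ∀ θ, 0 < Real.sin θ → Tendsto (fun M => ratWeight (x M) (y M) θ * (1 + Real.cos θ)) atTop
      (nhds (w θ))) {g : ℝ → ℝ} (hg : Continuous g) :
    Tendsto (fun M => ∫ θ in (0 : ℝ)..Real.pi, ratWeight (x M) (y M) θ * (1 + Real.cos θ) * g θ)
      atTop (nhds (∫ θ in (0 : ℝ)..Real.pi, w θ * g θ)) := by
  have hs : ∀ᵐ θ : ℝ, θ ∈ Set.uIoc 0 Real.pi → 0 < Real.sin θ := by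
    filter_upwards [ae_sin_ne_zero] with θ hθ hm
    rw [Set.uIoc_of_le Real.pi_pos.le] at hm
    exact (Real.sin_nonneg_of_nonneg_of_le_pi hm.1.le hm.2).lt_of_ne' hθ
  refine intervalIntegral.tendsto_integral_filter_of_dominated_convergence (fun θ => 2 * |g θ|)
    (Eventually.of_forall fun M => ?_) (Eventually.of_forall fun M => ?_) ?_ ?_
  · have := continuous_ratWeight (h M)
    exact Continuous.aestronglyMeasurable (by fun_prop)
  · filter_upwards [hs] with θ hθ hm
    have h1 := hθ hm
    have h2 : 0 ≤ ratWeight (x M) (y M) θ := Finset.prod_nonneg fun i _ =>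
      div_nonneg (one_sub_two_mul_cos_pos ((h M).abs_y i) θ).le
        (one_sub_two_mul_cos_pos ((h M).abs_x i) θ).le
    have h3 : 0 ≤ 1 + Real.cos θ := by linarith [Real.neg_one_le_cos θ]
    rw [norm_mul, Real.norm_of_nonneg (mul_nonneg h2 h3), Real.norm_eq_abs]
    exact mul_le_mul_of_nonneg_right (ratWeight_mul_le (h M) h1.ne') (abs_nonneg _)
  · exact Continuous.intervalIntegrable (by fun_prop) _ _
  · filter_upwards [hs] with θ hθ hm
    exact (hw θ (hθ hm)).mul_const _

lemma tendsto_det_ratMat {ι : ℕ → Type} [∀ M, Fintype (ι M)] [∀ M, DecidableEq (ι M)]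
    {x y : ∀ M, ι M → ℝ} (h : ∀ M, Interlacing (x M) (y M)) {ρ : ℝ}
    (hw : ∀ θ, 0 < Real.sin θ → Tendsto (fun M => ratWeight (x M) (y M) θ * (1 + Real.cos θ)) atTop
      (nhds (jacobiWeight ρ θ))) (n : ℕ) :
    Tendsto (fun M => (ratMat n (x M) (y M)).det) atTop (nhds (jacobiDet n ρ)) := by
  unfold jacobiDet
  refine ((Continuous.matrix_det (A := id) continuous_id).tendsto _).comp
    (f := fun M => ratMat n (x M) (y M)) (tendsto_pi_nhds.2 fun j => tendsto_pi_nhds.2 fun k => ?_)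
  simp only [ratMat_apply (h _), Matrix.of_apply]
  refine (tendsto_integral_ratWeight h hw ?_).const_mul _
  exact ((Polynomial.continuous _).comp (by fun_prop)).mul
    ((Polynomial.continuous _).comp (by fun_prop))

lemma tendsto_det_ratMat_out (h0 : 0 < μ) (h1 : μ < 1) (n : ℕ) :
    Tendsto (fun M => (ratMat n (outX μ M) (outY μ M)).det) atTop
      (nhds (jacobiDet n (jacParam μ))) := by
  refine tendsto_det_ratMat (fun M => interlacing_out h0 h1 M) (fun θ hθ => ?_) n
  have := (tendsto_ratWeight_out h0 h1 hθ.ne').mul_const (1 + Real.cos θ)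
  rw [jacobiWeight, ← norm_quot_eq_sqrt h0, ← norm_quot_mul_one_add_cos hθ]
  convert this using 2
  ring

lemma tendsto_det_ratMat_all (h0 : 0 < μ) (h1 : μ < 1) (n : ℕ) :
    Tendsto (fun M => (ratMat n (allX μ M) (allY μ M)).det) atTop (nhds (jacobiDet n 0)) := by
  refine tendsto_det_ratMat (fun M => interlacing_all h0 h1 M) (fun θ hθ => ?_) n
  have := (tendsto_ratWeight_all h0 h1 hθ.ne').mul_const (1 + Real.cos θ)
  rw [norm_quot_mul_one_add_cos hθ] at this
  simpa [jacobiWeight] using this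

end

/-- The symbol `c₊(z⁻¹) c₊(z)⁻¹ χ(z)`, `c₊(z) = ((1 + μ z) / (1 - μ z))^{1/2}`. -/
def psiSym (μ θ : ℝ) : ℂ :=
  Complex.exp ((1 / 2 : ℂ) * Complex.log
      ((1 + μ * Complex.exp (-(Complex.I * θ))) / (1 - μ * Complex.exp (-(Complex.I * θ))))) *
    (Complex.exp ((1 / 2 : ℂ) * Complex.log
      ((1 + μ * Complex.exp (Complex.I * θ)) / (1 - μ * Complex.exp (Complex.I * θ)))))⁻¹ * chi θ

lemma log_div_of_re_pos {a b : ℂ} (ha : 0 < a.re) (hb : 0 < b.re) :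
    Complex.log (a / b) = Complex.log a - Complex.log b := by
  have ha' : a ≠ 0 := by rintro rfl; simp at ha
  have hb' : b ≠ 0 := by rintro rfl; simp at hb
  have h1 := abs_lt.1 (Complex.abs_arg_lt_pi_div_two_iff.2 (Or.inl ha))
  have h2 := abs_lt.1 (Complex.abs_arg_lt_pi_div_two_iff.2 (Or.inl hb))
  rw [← Complex.log_exp (x := Complex.log a - Complex.log b), Complex.exp_sub,
    Complex.exp_log ha', Complex.exp_log hb']
  · rw [Complex.sub_im, Complex.log_im, Complex.log_im]; linarith [Real.pi_pos]
  · rw [Complex.sub_im, Complex.log_im, Complex.log_im]; linarith [Real.pi_pos]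

lemma circ_eq_cos_add (θ : ℝ) : circ θ = Real.cos θ + Real.sin θ * Complex.I := by
  rw [circ, mul_comm, Complex.exp_mul_I]; push_cast; ring

lemma re_one_sub_mul_circ_pos {t : ℝ} (ht : |t| < 1) (θ : ℝ) : 0 < (1 - (t : ℂ) * circ θ).re := by
  have hre : (1 - (t : ℂ) * circ θ).re = 1 - t * Real.cos θ := by
    rw [circ_eq_cos_add]; simp [-Complex.ofReal_cos, -Complex.ofReal_sin]
  have : |t * Real.cos θ| ≤ |t| := by
    rw [abs_mul]; exact mul_le_of_le_one_right (abs_nonneg _) (Real.abs_cos_le_one θ)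
  rw [hre]
  linarith [le_abs_self (t * Real.cos θ)]

lemma chi_eq_exp {θ : ℝ} (hθ : Real.sin θ ≠ 0) :
    Complex.exp ((1 / 2 : ℂ) * ((Complex.log (1 - ((1 : ℝ) : ℂ) * circ (-θ)) -
        Complex.log (1 - ((-1 : ℝ) : ℂ) * circ (-θ))) -
      (Complex.log (1 - ((1 : ℝ) : ℂ) * circ θ) -
        Complex.log (1 - ((-1 : ℝ) : ℂ) * circ θ)))) = chi θ := by
  have s1 := (one_sub_mul_circ_bounds hθ (by norm_num : (-1 : ℝ) ≤ 1) le_rfl).1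
  have s2 := (one_sub_mul_circ_bounds hθ le_rfl (by norm_num : (-1 : ℝ) ≤ 1)).1
  have hconj : ∀ t : ℝ, 1 - (t : ℂ) * circ θ ∈ Complex.slitPlane →
      Complex.log (1 - (t : ℂ) * circ (-θ)) =
        (starRingEnd ℂ) (Complex.log (1 - (t : ℂ) * circ θ)) := by
    intro t ht
    rw [← Complex.log_conj _ (Complex.mem_slitPlane_iff_arg.1 ht).1, map_sub, map_one, map_mul,
      conj_circ, Complex.conj_ofReal, circ_neg]
  rw [hconj _ s1, hconj _ s2]
  set u := Complex.log (1 - ((-1 : ℝ) : ℂ) * circ θ) - Complex.log (1 - ((1 : ℝ) : ℂ) * circ θ)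
    with hu
  have e1 : (1 / 2 : ℂ) * (((starRingEnd ℂ) (Complex.log (1 - ((1 : ℝ) : ℂ) * circ θ)) -
      (starRingEnd ℂ) (Complex.log (1 - ((-1 : ℝ) : ℂ) * circ θ))) -
      (Complex.log (1 - ((1 : ℝ) : ℂ) * circ θ) -
        Complex.log (1 - ((-1 : ℝ) : ℂ) * circ θ))) = u - ((u.re : ℝ) : ℂ) := by
    have : ((u.re : ℝ) : ℂ) = (u + (starRingEnd ℂ) u) / 2 := by rw [Complex.re_eq_add_conj]
    rw [this, hu, map_sub]
    ring
  have hcos : 0 < 1 - Real.cos θ := by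
    have h1 := Real.sin_sq_add_cos_sq θ
    have h2 : 0 < Real.sin θ ^ 2 := by positivity
    nlinarith [Real.neg_one_le_cos θ, Real.cos_le_one θ]
  set r : ℝ := Real.sin θ / (1 - Real.cos θ) with hr
  have hexp : Complex.exp u = r * Complex.I := by
    rw [hu, Complex.exp_sub, Complex.exp_log (Complex.slitPlane_ne_zero s1),
      Complex.exp_log (Complex.slitPlane_ne_zero s2), div_eq_iff (Complex.slitPlane_ne_zero s1),
      circ_eq_cos_add, hr]
    have hne : ((1 - Real.cos θ : ℝ) : ℂ) ≠ 0 := by exact_mod_cast hcos.ne'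
    have hsc : (Real.sin θ : ℂ) ^ 2 + (Real.cos θ : ℂ) ^ 2 = 1 := by
      exact_mod_cast Real.sin_sq_add_cos_sq θ
    rw [Complex.ofReal_div, div_mul_eq_mul_div, div_mul_eq_mul_div, eq_div_iff hne]
    push_cast [-Complex.ofReal_cos, -Complex.ofReal_sin]
    linear_combination (-1 : ℂ) * hsc + (Real.sin θ : ℂ) ^ 2 * Complex.I_sq
  have hn : ((Real.exp u.re : ℝ) : ℂ) = ((|r| : ℝ) : ℂ) := by
    rw [← Complex.norm_exp, hexp, norm_mul, Complex.norm_I, mul_one, Complex.norm_real,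
      Real.norm_eq_abs]
  rw [e1, Complex.exp_sub, hexp, ← Complex.ofReal_exp, hn, chi]
  rcases lt_or_gt_of_ne hθ with h | h
  · have hr0 : r < 0 := div_neg_of_neg_of_pos h hcos
    have hr1 : (r : ℂ) ≠ 0 := by exact_mod_cast hr0.ne
    rw [if_neg h.not_gt, abs_of_neg hr0]
    push_cast
    field_simp
  · have hr0 : 0 < r := div_pos h hcos
    have hr1 : (r : ℂ) ≠ 0 := by exact_mod_cast hr0.ne'
    rw [if_pos h, abs_of_pos hr0]
    field_simp

section
variable {μ : ℝ}

lemma psiSym_eq (h0 : 0 < μ) (h1 : μ < 1) {θ : ℝ} (hθ : Real.sin θ ≠ 0) :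
    psiSym μ θ = Complex.exp ((1 / 2 : ℂ) * ((Complex.log (1 - ((-μ : ℝ) : ℂ) * circ (-θ)) -
        Complex.log (1 - (μ : ℂ) * circ (-θ))) - (Complex.log (1 - ((-μ : ℝ) : ℂ) * circ θ) -
        Complex.log (1 - (μ : ℂ) * circ θ)) +
      ((Complex.log (1 - ((1 : ℝ) : ℂ) * circ (-θ)) -
        Complex.log (1 - ((-1 : ℝ) : ℂ) * circ (-θ))) -
      (Complex.log (1 - ((1 : ℝ) : ℂ) * circ θ) -
        Complex.log (1 - ((-1 : ℝ) : ℂ) * circ θ))))) := by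
  have hμ : |μ| < 1 := abs_lt.2 ⟨by linarith, h1⟩
  have hμ' : |(-μ)| < 1 := by rwa [abs_neg]
  have hp : ∀ z : ℂ, 1 + (μ : ℂ) * z = 1 - ((-μ : ℝ) : ℂ) * z := fun z => by push_cast; ring
  rw [mul_add, Complex.exp_add, chi_eq_exp hθ, psiSym, ← inv_circ, ← circ, ← circ_neg, hp, hp,
    log_div_of_re_pos (re_one_sub_mul_circ_pos hμ' _) (re_one_sub_mul_circ_pos hμ _),
    log_div_of_re_pos (re_one_sub_mul_circ_pos hμ' _) (re_one_sub_mul_circ_pos hμ _),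
    ← Complex.exp_neg, ← Complex.exp_add]
  congr 2
  ring

lemma tendsto_ratSym_out (h0 : 0 < μ) (h1 : μ < 1) {θ : ℝ} (hθ : Real.sin θ ≠ 0) :
    Tendsto (fun M => ratSym (outX μ M) (outY μ M) θ) atTop (nhds (psiSym μ θ)) := by
  have hl : (-1 : ℝ) < -μ := by linarith
  have A := tendsto_prod_blk hl le_rfl (by linarith) hθ
  have B := tendsto_prod_blk h1 (by linarith) le_rfl hθ
  have A' := tendsto_prod_blk hl le_rfl (by linarith) (sin_neg_ne_zero hθ)
  have B' := tendsto_prod_blk h1 (by linarith) le_rfl (sin_neg_ne_zero hθ)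
  have T := ((A.inv₀ (Complex.exp_ne_zero _)).mul (B.inv₀ (Complex.exp_ne_zero _))).mul (A'.mul B')
  rw [← Complex.exp_neg, ← Complex.exp_neg, ← Complex.exp_add, ← Complex.exp_add,
    ← Complex.exp_add] at T
  rw [psiSym_eq h0 h1 hθ]
  convert T.congr fun M => ?_ using 2
  · congr 1; ring
  · rw [ratSym_eq (interlacing_out h0 h1 M), Fintype.prod_sum_type, Fintype.prod_sum_type,
      ← circ_neg, ← Finset.prod_inv_distrib, ← Finset.prod_inv_distrib]
    simp only [inv_div]
    rfl

lemma tendsto_hankelSeq_out (h0 : 0 < μ) (h1 : μ < 1) (m : ℕ) :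
    Tendsto (fun M => ((hankelSeq (outX μ M) (outY μ M) m : ℝ) : ℂ)) atTop
      (nhds (fc (psiSym μ) ((m : ℤ) + 1))) := by
  have : ∀ M, ((hankelSeq (outX μ M) (outY μ M) m : ℝ) : ℂ) =
      fc (ratSym (outX μ M) (outY μ M)) ((m : ℤ) + 1) := fun M =>
    (fc_ratSym' (interlacing_out h0 h1 M) m).symm
  simp only [this, fc_eq_circ]
  refine Tendsto.const_mul _ ?_
  refine intervalIntegral.tendsto_integral_filter_of_dominated_convergence (fun _ => 1)
    (Eventually.of_forall fun M => ?_) (Eventually.of_forall fun M => ?_)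
    (Continuous.intervalIntegrable (by fun_prop) _ _) ?_
  · refine Continuous.aestronglyMeasurable ((continuous_ratSym (interlacing_out h0 h1 M)).mul ?_)
    exact continuous_circ.zpow₀ _ fun θ => Or.inl (circ_ne_zero θ)
  · refine Eventually.of_forall fun θ _ => ?_
    rw [norm_mul, norm_ratSym (interlacing_out h0 h1 M), norm_zpow, norm_circ, one_zpow, mul_one]
  · filter_upwards [ae_sin_ne_zero] with θ hθ _
    exact (tendsto_ratSym_out h0 h1 hθ).mul_const _

end

lemma abs_pow_succ_sub_le {r s t : ℝ} (hs : |s| ≤ r) (ht : |t| ≤ r) (n : ℕ) :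
    |s ^ (n + 1) - t ^ (n + 1)| ≤ (n + 1) * r ^ n * |s - t| := by
  have hr : 0 ≤ r := (abs_nonneg s).trans hs
  induction n with
  | zero => simp
  | succ n ih =>
    have e : s ^ (n + 1 + 1) - t ^ (n + 1 + 1) =
        s * (s ^ (n + 1) - t ^ (n + 1)) + (s - t) * t ^ (n + 1) := by ring
    rw [e]
    refine (abs_add_le _ _).trans ?_
    rw [abs_mul, abs_mul, abs_pow]
    have h1 : |s| * |s ^ (n + 1) - t ^ (n + 1)| ≤ r * ((n + 1) * r ^ n * |s - t|) :=
      mul_le_mul hs ih (abs_nonneg _) hr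
    have h2 : |s - t| * |t| ^ (n + 1) ≤ |s - t| * r ^ (n + 1) :=
      mul_le_mul_of_nonneg_left (pow_le_pow_left₀ (abs_nonneg _) ht _) (abs_nonneg _)
    push_cast
    calc _ ≤ _ := add_le_add h1 h2
      _ = _ := by ring

/-- Difference of the power sums of two families. -/
def powDiff {ι : Type*} [Fintype ι] (x y : ι → ℝ) (k : ℕ) : ℝ := ∑ i, (y i ^ k - x i ^ k)

lemma tendsto_powDiff_blk {p q : ℝ} (hpq : p < q) (hp : -1 ≤ p) (hq : q ≤ 1) (k : ℕ) :
    Tendsto (fun M => powDiff (blkX p q M) (blkY p q M) (k + 1)) atTop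
      (nhds (1 / 2 * (q ^ (k + 1) - p ^ (k + 1)))) := by
  refine tendsto_sum_blk (φ := fun t => t ^ (k + 1)) (φ' := fun t => (k + 1) * t ^ k)
    (K := (k + 1) * k) hpq ?_ ?_ (by positivity)
  · intro t _
    refine (hasDerivAt_pow (k + 1) t).congr_deriv (by push_cast; simp)
  · intro s hs t ht
    have hs' : |s| ≤ 1 := abs_le.2 ⟨hp.trans hs.1, hs.2.trans hq⟩
    have ht' : |t| ≤ 1 := abs_le.2 ⟨hp.trans ht.1, ht.2.trans hq⟩
    rw [← mul_sub, norm_mul, Real.norm_eq_abs, Real.norm_eq_abs,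
      abs_of_nonneg (by positivity : (0 : ℝ) ≤ (k : ℝ) + 1), mul_assoc]
    refine mul_le_mul_of_nonneg_left ?_ (by positivity)
    cases k with
    | zero => simp
    | succ k =>
      have := abs_pow_succ_sub_le hs' ht' k
      rw [one_pow, mul_one] at this
      exact_mod_cast this

lemma abs_powDiff_le {ι : Type*} [Fintype ι] {x y : ι → ℝ} {r : ℝ} (hx : ∀ i, |x i| ≤ r)
    (hy : ∀ i, |y i| ≤ r) (hlt : ∀ i, x i < y i) (k : ℕ) :
    |powDiff x y (k + 1)| ≤ (k + 1) * r ^ k * ∑ i, (y i - x i) := by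
  rw [Finset.mul_sum]
  refine (Finset.abs_sum_le_sum_abs _ _).trans (Finset.sum_le_sum fun i _ => ?_)
  have := abs_pow_succ_sub_le (hy i) (hx i) k
  rwa [abs_of_pos (sub_pos.2 (hlt i))] at this

lemma hasSum_log_one_sub {x : ℝ} (hx : |x| < 1) :
    HasSum (fun k : ℕ => -(x ^ (k + 1) / ((k : ℝ) + 1))) (Real.log (1 - x)) := by
  simpa using (Real.hasSum_pow_div_log_of_abs_lt_one hx).neg

lemma hasSum_kappa {ι : Type*} [Fintype ι] {x y : ι → ℝ} (hx : ∀ i, |x i| < 1)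
    (hy : ∀ i, |y i| < 1) :
    HasSum (fun k : ℕ => -(powDiff x y (k + 1) ^ 2 / ((k : ℝ) + 1)))
      (∑ i, ∑ k, (Real.log (1 - y i * y k) + Real.log (1 - x i * x k) - Real.log (1 - y i * x k) -
      Real.log (1 - x i * y k))) := by
  have hm : ∀ {a b : ℝ}, |a| < 1 → |b| < 1 → |a * b| < 1 := fun {a b} ha hb => by
    rw [abs_mul]; nlinarith [abs_nonneg a, abs_nonneg b]
  refine (hasSum_sum fun i _ => hasSum_sum fun k _ =>
    (((hasSum_log_one_sub (hm (hy i) (hy k))).add (hasSum_log_one_sub (hm (hx i) (hx k)))).sub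
      (hasSum_log_one_sub (hm (hy i) (hx k)))).sub
        (hasSum_log_one_sub (hm (hx i) (hy k)))).congr_fun fun n => ?_
  rw [sq, powDiff, Finset.sum_mul_sum, Finset.sum_div, ← Finset.sum_neg_distrib]
  refine Finset.sum_congr rfl fun i _ => ?_
  rw [Finset.sum_div, ← Finset.sum_neg_distrib]
  refine Finset.sum_congr rfl fun j _ => ?_
  rw [mul_pow, mul_pow, mul_pow, mul_pow]
  ring

lemma hasSum_lambda {ι : Type*} [Fintype ι] {x y : ι → ℝ} (hx : ∀ i, |x i| < 1)
    (hy : ∀ i, |y i| < 1) :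
    HasSum (fun k : ℕ => powDiff x y (k + 1) * (1 - (-1) ^ (k + 1)) / ((k : ℝ) + 1))
      (∑ i, (Real.log (1 + y i) - Real.log (1 - y i) -
        (Real.log (1 + x i) - Real.log (1 - x i)))) := by
  have hp : ∀ {a : ℝ}, |a| < 1 →
      HasSum (fun k : ℕ => -((-a) ^ (k + 1) / ((k : ℝ) + 1))) (Real.log (1 + a)) := fun {a} ha => by
    have := hasSum_log_one_sub (x := -a) (by rwa [abs_neg])
    rwa [sub_neg_eq_add] at this
  refine (hasSum_sum fun i _ => ((hp (hy i)).sub (hasSum_log_one_sub (hy i))).sub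
    ((hp (hx i)).sub (hasSum_log_one_sub (hx i)))).congr_fun fun n => ?_
  rw [powDiff, Finset.sum_mul, Finset.sum_div]
  refine Finset.sum_congr rfl fun i _ => ?_
  rw [neg_pow (y i), neg_pow (x i)]
  ring

section
variable {ι κ : Type*} [Fintype ι] [DecidableEq ι] [Fintype κ] [DecidableEq κ]
  {xo yo : ι → ℝ} {xi yi : κ → ℝ}

lemma hasSum_log_gramDet_zero_sub (h : Interlacing (Sum.elim xo xi) (Sum.elim yo yi)) :
    HasSum (fun k : ℕ => (powDiff xi yi (k + 1) * (1 - (-1) ^ (k + 1)) -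
      2 * powDiff xi yi (k + 1) * powDiff (Sum.elim xo xi) (Sum.elim yo yi) (k + 1) +
      powDiff xi yi (k + 1) ^ 2) / ((k : ℝ) + 1))
      (2 * (Real.log (gramDet 0 (Sum.elim xo xi) (Sum.elim yo yi)) -
        Real.log (gramDet 0 xo yo))) := by
  have ho := h.outer
  rw [mul_sub, log_gramDet_zero h, log_gramDet_zero ho]
  refine (((hasSum_lambda h.abs_x h.abs_y).add (hasSum_kappa h.abs_x h.abs_y)).sub
    ((hasSum_lambda ho.abs_x ho.abs_y).add (hasSum_kappa ho.abs_x ho.abs_y))).congr_fun fun k => ?_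
  have e : powDiff (Sum.elim xo xi) (Sum.elim yo yi) (k + 1) =
      powDiff xo yo (k + 1) + powDiff xi yi (k + 1) := Fintype.sum_sum_type _
  rw [e]
  ring

end

section
variable {μ : ℝ}

lemma tendsto_powDiff_all (h0 : 0 < μ) (h1 : μ < 1) (k : ℕ) :
    Tendsto (fun M => powDiff (allX μ M) (allY μ M) (k + 1)) atTop
      (nhds (1 / 2 * (1 - (-1) ^ (k + 1)))) := by
  have := ((tendsto_powDiff_blk (show (-1 : ℝ) < -μ by linarith) le_rfl (by linarith) k).add
    (tendsto_powDiff_blk h1 (by linarith) le_rfl k)).add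
    (tendsto_powDiff_blk (show -μ < μ by linarith) (by linarith) h1.le k)
  convert this using 2 with M
  · simp only [powDiff, allX, allY, outX, outY, Fintype.sum_sum_type, Sum.elim_inl, Sum.elim_inr]
  · ring

lemma tendsto_log_gramDet_zero_sub (h0 : 0 < μ) (h1 : μ < 1) :
    Tendsto (fun M => Real.log (gramDet 0 (allX μ M) (allY μ M)) -
      Real.log (gramDet 0 (outX μ M) (outY μ M))) atTop
      (nhds (1 / 4 * Real.log ((1 + μ ^ 2) / (1 - μ ^ 2)))) := by
  set T : ℕ → ℕ → ℝ := fun M k =>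
    (powDiff (blkX (-μ) μ M) (blkY (-μ) μ M) (k + 1) * (1 - (-1) ^ (k + 1)) -
      2 * powDiff (blkX (-μ) μ M) (blkY (-μ) μ M) (k + 1) *
        powDiff (allX μ M) (allY μ M) (k + 1) +
      powDiff (blkX (-μ) μ M) (blkY (-μ) μ M) (k + 1) ^ 2) / ((k : ℝ) + 1) with hT
  have hlim : Tendsto (fun M => ∑' k, T M k) atTop
      (nhds (∑' k : ℕ, (1 / 2 * (μ ^ (k + 1) - (-μ) ^ (k + 1))) ^ 2 / ((k : ℝ) + 1))) := by
    refine tendsto_tsum_of_dominated_convergence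
      (bound := fun k : ℕ => 5 * (((k : ℝ) + 1) * μ ^ (k + 1))) ?_ ?_ ?_
    · refine Summable.mul_left _ ?_
      have := summable_pow_mul_geometric_of_norm_lt_one 1
        (show ‖μ‖ < 1 by rw [Real.norm_of_nonneg h0.le]; exact h1)
      have := (summable_nat_add_iff 1).2 this
      exact this.congr fun k => by push_cast; ring
    · intro k
      have hi := tendsto_powDiff_blk (show -μ < μ by linarith) (by linarith) h1.le k
      have ha := tendsto_powDiff_all h0 h1 k
      have := (((hi.mul_const (1 - (-1) ^ (k + 1))).sub ((hi.const_mul 2).mul ha)).add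
        (hi.pow 2)).div_const ((k : ℝ) + 1)
      convert this using 2
      ring
    · filter_upwards [eventually_gt_atTop 0] with M hM k
      have hall := interlacing_all h0 h1 M
      have hin := hall.inner
      have hb : ∀ i : Fin M, _ := fun i => blk_bounds (show -μ < μ by linarith) i
      have b1 := abs_powDiff_le (r := μ) (x := blkX (-μ) μ M) (y := blkY (-μ) μ M)
        (fun i => abs_le.2 ⟨(hb i).1.le, by linarith [(hb i).2.1, (hb i).2.2]⟩)
        (fun i => abs_le.2 ⟨by linarith [(hb i).1, (hb i).2.1], (hb i).2.2.le⟩) hin.lt k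
      have b2 := abs_powDiff_le (fun i => (hall.abs_x i).le) (fun i => (hall.abs_y i).le) hall.lt k
      have s1 := sum_blk_sub (-μ) μ hM
      have s2 : ∑ i, (allY μ M i - allX μ M i) = 1 := by
        simp only [allX, allY, outX, outY, Fintype.sum_sum_type, Sum.elim_inl, Sum.elim_inr]
        rw [s1, sum_blk_sub _ _ hM, sum_blk_sub _ _ hM]
        ring
      rw [s1] at b1
      rw [s2, one_pow, mul_one, mul_one] at b2
      have b1' : |powDiff (blkX (-μ) μ M) (blkY (-μ) μ M) (k + 1)| ≤ (k + 1) * μ ^ (k + 1) := by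
        refine b1.trans (le_of_eq ?_); ring
      have b3 : |(1 : ℝ) - (-1) ^ (k + 1)| ≤ 2 := by
        rcases neg_one_pow_eq_or ℝ (k + 1) with h | h <;> rw [h] <;> norm_num
      have b4 : μ ^ (k + 1) ≤ 1 := pow_le_one₀ h0.le h1.le
      have hμk : 0 ≤ μ ^ (k + 1) := by positivity
      rw [hT, Real.norm_eq_abs, abs_div, abs_of_pos (by positivity : (0 : ℝ) < (k : ℝ) + 1),
        div_le_iff₀ (by positivity)]
      generalize powDiff (blkX (-μ) μ M) (blkY (-μ) μ M) (k + 1) = p at *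
      generalize powDiff (allX μ M) (allY μ M) (k + 1) = a at *
      generalize (1 : ℝ) - (-1) ^ (k + 1) = e at *
      generalize μ ^ (k + 1) = m at *
      have hk : (0 : ℝ) ≤ k := by positivity
      calc |p * e - 2 * p * a + p ^ 2| ≤ |p * e| + |2 * p * a| + |p ^ 2| :=
            (abs_add_le _ _).trans (add_le_add (abs_sub _ _) le_rfl)
        _ = |p| * |e| + 2 * |p| * |a| + |p| * |p| := by
            rw [abs_mul, abs_mul, abs_mul, sq, abs_mul, abs_two]
        _ ≤ |p| * 2 + 2 * |p| * (k + 1) + |p| * (k + 1) := by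
            have : |p| ≤ k + 1 := b1'.trans (by nlinarith)
            gcongr
        _ ≤ |p| * (5 * (k + 1)) := by nlinarith [abs_nonneg p]
        _ ≤ (k + 1) * m * (5 * (k + 1)) := mul_le_mul_of_nonneg_right b1' (by positivity)
        _ = _ := by ring
  have hval : ∑' k : ℕ, (1 / 2 * (μ ^ (k + 1) - (-μ) ^ (k + 1))) ^ 2 / ((k : ℝ) + 1) =
      1 / 2 * Real.log ((1 + μ ^ 2) / (1 - μ ^ 2)) := by
    have hμ2 : |μ ^ 2| < 1 := by rw [abs_of_pos (by positivity)]; nlinarith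
    have a1 := hasSum_log_one_sub hμ2
    have a2 := hasSum_log_one_sub (x := -μ ^ 2) (by rwa [abs_neg])
    rw [sub_neg_eq_add] at a2
    rw [abs_lt] at hμ2
    rw [Real.log_div (by positivity) (by linarith)]
    refine HasSum.tsum_eq (((a2.sub a1).mul_left (1 / 2)).congr_fun fun k => ?_)
    rw [neg_pow μ, neg_pow (μ ^ 2)]
    rcases neg_one_pow_eq_or ℝ (k + 1) with h | h <;> rw [h] <;> ring
  rw [hval] at hlim
  have := hlim.const_mul (1 / 2)
  convert this using 2 with M
  · rw [(hasSum_log_gramDet_zero_sub (interlacing_all h0 h1 M)).tsum_eq]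
    ring
  · ring

end

lemma det_ratMat_eq {ι : Type*} [Fintype ι] [DecidableEq ι] {x y : ι → ℝ} (h : Interlacing x y)
    (n : ℕ) : 0 < (ratMat n x y).det ∧
      Real.log (ratMat n x y).det = Real.log (gramDet n x y) - Real.log (gramDet 0 x y) := by
  rw [← det_ratSol_eq_det_ratMat, det_ratSol h]
  exact ⟨div_pos (gramDet_pos h n) (gramDet_pos h 0),
    Real.log_div (gramDet_pos h n).ne' (gramDet_pos h 0).ne'⟩

lemma abs_log_jacobiDet_sub_le {μ : ℝ} (h0 : 0 < μ) (h1 : μ < 1) (n : ℕ) :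
    0 < jacobiDet n (jacParam μ) ∧
      |Real.log (jacobiDet n (jacParam μ)) - Real.log (jacobiDet n 0) -
        1 / 4 * Real.log ((1 + μ ^ 2) / (1 - μ ^ 2))| ≤ 16 / ((1 - μ) * (n + 1)) := by
  set C := 16 / ((1 - μ) * (n + 1)) with hC
  have hD := tendsto_log_gramDet_zero_sub h0 h1
  have hA := (tendsto_det_ratMat_all h0 h1 n).log (jacobiDet_zero n).1.ne'
  have hB := tendsto_det_ratMat_out h0 h1 n
  have key : ∀ M, |Real.log (ratMat n (outX μ M) (outY μ M)).det -
      (Real.log (ratMat n (allX μ M) (allY μ M)).det +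
        (Real.log (gramDet 0 (allX μ M) (allY μ M)) -
          Real.log (gramDet 0 (outX μ M) (outY μ M))))| ≤ C := by
    intro M
    have hall := interlacing_all h0 h1 M
    have hb : ∀ i : Fin M, _ := fun i => blk_bounds (show -μ < μ by linarith) i
    have := abs_log_gramDet_sub_le hall h0 h1 (fun k => ⟨(hb k).1.le, (hb k).2.2.le⟩)
      (lt_abs_outY h1 M) n
    rw [(det_ratMat_eq hall n).2, (det_ratMat_eq (interlacing_out h0 h1 M) n).2, abs_sub_comm]
    convert this using 2
    ring
  have hS := hA.add hD
  have hpos : 0 < jacobiDet n (jacParam μ) := by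
    have hE := (Real.continuous_exp.tendsto _).comp (hS.sub_const C)
    refine (Real.exp_pos _).trans_le (le_of_tendsto_of_tendsto' hE hB fun M => ?_)
    have h2 := (det_ratMat_eq (interlacing_out h0 h1 M) n).1
    rw [Function.comp_apply, ← Real.exp_log h2]
    exact Real.exp_le_exp.2 (by linarith [(abs_le.1 (key M)).1])
  refine ⟨hpos, ?_⟩
  have hL := ((hB.log hpos.ne').sub hS).abs
  have := le_of_tendsto' hL key
  rwa [← sub_sub] at this

lemma inner_ee (j : ℕ) (f : l2) : ⟪ee j, f⟫_ℂ = f j := by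
  rw [ee, lp.inner_single_left]; simp

lemma hasSum_ee (f : l2) : HasSum (fun k => f k • ee k) f := by
  refine (lp.hasSum_single (p := 2) (by norm_num) f).congr_fun fun k => ?_
  rw [ee, ← lp.single_smul, smul_eq_mul, mul_one]

lemma hasSum_ent (A : l2 →L[ℂ] l2) (f : l2) (j : ℕ) :
    HasSum (fun k => f k * ent A j k) (A f j) := by
  have h := ((hasSum_ee f).mapL A).mapL (innerSL ℂ (ee j))
  simp only [map_smul, innerSL_apply_apply, inner_ee, smul_eq_mul] at h
  refine h.congr_fun fun k => ?_
  rw [ent, inner_ee]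

lemma summable_inv_mul_sqrt :
    Summable fun k : ℕ => 4 / ((k : ℝ) + 1) * √(2 / ((k : ℝ) + 1)) := by
  have h := (Real.summable_one_div_nat_add_rpow 1 (3 / 2)).2 (by norm_num)
  refine (h.mul_left (4 * √2)).congr fun k => ?_
  have hk : (0 : ℝ) < (k : ℝ) + 1 := by positivity
  rw [abs_of_pos hk, show (3 / 2 : ℝ) = 1 + 1 / 2 by norm_num, Real.rpow_add hk, Real.rpow_one,
    ← Real.sqrt_eq_rpow, Real.sqrt_div (by norm_num)]
  have : √((k : ℝ) + 1) ≠ 0 := (Real.sqrt_pos.2 hk).ne'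
  field_simp

section
variable {μ : ℝ}

lemma exists_limit_ratSol (h0 : 0 < μ) (h1 : μ < 1) : ∃ (g : ℕ × ℕ → ℝ) (φ : ℕ → ℕ),
    StrictMono φ ∧ ∀ l k, Tendsto (fun M => ratSol (outX μ (φ M)) (outY μ (φ M)) l k) atTop
      (nhds (g (l, k))) := by
  obtain ⟨g, -, φ, hφ, hg⟩ := (isCompact_univ_pi (X := fun _ : ℕ × ℕ => ℝ)
    (s := fun _ => Set.Icc (-3) 3) fun _ => isCompact_Icc).tendsto_subseq
    (x := fun M (p : ℕ × ℕ) => ratSol (outX μ M) (outY μ M) p.1 p.2) (fun M => by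
      rintro ⟨l, k⟩ -
      have h := ratSol_sub_sq_le (interlacing_out h0 h1 M) l k
      have h2 : (2 : ℝ) / (k + 1) ≤ 2 := by
        rw [div_le_iff₀ (by positivity)]
        have : (0 : ℝ) ≤ k := by positivity
        linarith
      have h3 := abs_le_of_sq_le_sq' ((h.trans h2).trans (by norm_num : (2 : ℝ) ≤ 2 ^ 2))
        (by norm_num)
      simp only [Set.mem_Icc]
      split_ifs at h3 <;> constructor <;> linarith [h3.1, h3.2])
  refine ⟨g, φ, hφ, fun l k => ?_⟩
  exact (tendsto_pi_nhds.1 hg) (l, k)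

theorem detP_eq_jacobiDet (h0 : 0 < μ) (h1 : μ < 1) {A B : l2 →L[ℂ] l2}
    (hA : ∀ j k : ℕ, ent A j k = (if j = k then 1 else 0) + fc (psiSym μ) ((j : ℤ) + k + 1))
    (hBA : B ∘L A = 1) (n : ℕ) : detP n B = ((jacobiDet n (jacParam μ) : ℝ) : ℂ) := by
  obtain ⟨g, φ, hφ, hg⟩ := exists_limit_ratSol h0 h1
  have hint := fun M => interlacing_out h0 h1 (φ M)
  set a : ℕ → ℝ := fun m => (fc (psiSym μ) ((m : ℤ) + 1)).re with ha
  have hH : ∀ m, Tendsto (fun M => hankelSeq (outX μ (φ M)) (outY μ (φ M)) m) atTop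
      (nhds (a m)) := fun m =>
    ((Complex.continuous_re.tendsto _).comp (tendsto_hankelSeq_out h0 h1 m)).comp hφ.tendsto_atTop
  have hfc : ∀ m : ℕ, fc (psiSym μ) ((m : ℤ) + 1) = ((a m : ℝ) : ℂ) := fun m =>
    tendsto_nhds_unique ((tendsto_hankelSeq_out h0 h1 m).comp hφ.tendsto_atTop)
      ((Complex.continuous_ofReal.tendsto _).comp (hH m))
  have hF : ∀ l k, |(if k = l then 1 else 0) - g (l, k)| ≤ √(2 / ((k : ℝ) + 1)) := fun l k =>
    le_of_tendsto' ((hg l k).const_sub _).abs fun M =>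
      Real.abs_le_sqrt (ratSol_sub_sq_le (hint M) l k)
  have hsq : ∀ l (s : Finset ℕ), ∑ k ∈ s, ((if k = l then 1 else 0) - g (l, k)) ^ 2 ≤ 1 :=
    fun l s => le_of_tendsto' (tendsto_finsetSum s fun k _ => ((hg l k).const_sub _).pow 2)
      fun M => (ratSol_energy (hint M) l).2 s
  have hmem : ∀ l, Memℓp (fun k => ((g (l, k) : ℝ) : ℂ)) 2 := by
    intro l
    have m1 : Memℓp (fun k => (((if k = l then 1 else 0) - g (l, k) : ℝ) : ℂ)) 2 := by
      refine memℓp_gen ?_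
      have := summable_of_sum_le (c := 1) (fun k => sq_nonneg ((if k = l then 1 else 0) - g (l, k)))
        (hsq l)
      refine this.congr fun k => ?_
      rw [Complex.norm_real, Real.norm_eq_abs]
      norm_num
    have m2 := (lp.memℓp (ee l)).sub m1
    convert m2 using 1
    ext k
    rw [Pi.sub_apply, ee, lp.single_apply]
    by_cases hk : k = l
    · subst hk; simp
    · simp [hk]
  have hsum : ∀ l j, HasSum (fun k => a (j + k) * g (l, k)) ((if j = l then 1 else 0) - g (l, j)) := by
    intro l j
    set bound : ℕ → ℝ := fun k =>
      (if k = l then 4 else 0) + 4 / ((k : ℝ) + 1) * √(2 / ((k : ℝ) + 1)) with hb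
    have hbs : Summable bound :=
      (summable_of_ne_finset_zero (s := {l}) fun k hk => if_neg (by simpa using hk)).add
        summable_inv_mul_sqrt
    have hbd : ∀ (c r : ℝ) (k : ℕ), |c| ≤ 4 / ((j + k : ℕ) + 1 : ℝ) →
        |(if k = l then 1 else 0) - r| ≤ √(2 / ((k : ℝ) + 1)) → ‖c * r‖ ≤ bound k := by
      intro c r k hc hr
      have hc' : |c| ≤ 4 / ((k : ℝ) + 1) := hc.trans
        (div_le_div_of_nonneg_left (by norm_num) (by positivity) (by push_cast; linarith [(Nat.cast_nonneg j : (0 : ℝ) ≤ j)]))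
      have hr' : |r| ≤ (if k = l then 1 else 0) + √(2 / ((k : ℝ) + 1)) := by
        have := abs_sub_abs_le_abs_sub r (if k = l then 1 else 0)
        rw [abs_sub_comm] at this
        have e : |(if k = l then (1 : ℝ) else 0)| = if k = l then 1 else 0 := by
          split_ifs <;> simp
        linarith
      rw [norm_mul, Real.norm_eq_abs, Real.norm_eq_abs]
      refine (mul_le_mul hc' hr' (abs_nonneg _) (by positivity)).trans ?_
      rw [mul_add, hb]
      refine add_le_add ?_ le_rfl
      split_ifs
      · rw [mul_one]
        exact div_le_self (by norm_num) (by linarith [(Nat.cast_nonneg k : (0 : ℝ) ≤ k)])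
      · simp
    have hah : ∀ m, |a m| ≤ 4 / ((m : ℝ) + 1) := fun m =>
      le_of_tendsto' (hH m).abs fun M => abs_hankelSeq_le (hint M) m
    have hs : Summable fun k => a (j + k) * g (l, k) :=
      Summable.of_norm_bounded hbs fun k => hbd _ _ k (hah _) (hF l k)
    have ht := tendsto_tsum_of_dominated_convergence (𝓕 := atTop) hbs
      (f := fun M k => hankelSeq (outX μ (φ M)) (outY μ (φ M)) (j + k) *
        ratSol (outX μ (φ M)) (outY μ (φ M)) l k)
      (fun k => (hH (j + k)).mul (hg l k)) (Eventually.of_forall fun M k =>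
        hbd _ _ k (abs_hankelSeq_le (hint M) _)
          (Real.abs_le_sqrt (ratSol_sub_sq_le (hint M) l k)))
    have e : ∀ M, ∑' k, hankelSeq (outX μ (φ M)) (outY μ (φ M)) (j + k) *
        ratSol (outX μ (φ M)) (outY μ (φ M)) l k =
        (if j = l then 1 else 0) - ratSol (outX μ (φ M)) (outY μ (φ M)) l j := fun M =>
      (hasSum_hankel_ratSol (hint M) l j).tsum_eq
    simp only [e] at ht
    have := tendsto_nhds_unique ht ((hg l j).const_sub _)
    rw [← this]
    exact hs.hasSum
  set G : ℕ → l2 := fun l => ⟨_, hmem l⟩ with hG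
  have hAG : ∀ l, A (G l) = ee l := by
    intro l
    ext j
    have h2 := hasSum_ent A (G l) j
    have h3 : HasSum (fun k => G l k * ent A j k)
        ((g (l, j) : ℂ) + (((if j = l then 1 else 0) - g (l, j) : ℝ) : ℂ)) := by
      have h4 : HasSum (fun k => if k = j then (g (l, j) : ℂ) else 0) (g (l, j) : ℂ) :=
        hasSum_ite_eq j _
      refine (h4.add (Complex.hasSum_ofReal.2 (hsum l j))).congr_fun fun k => ?_
      have e : ((j : ℤ) + k + 1) = ((j + k : ℕ) : ℤ) + 1 := by push_cast; ring
      rw [hA, e, hfc]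
      change (g (l, k) : ℂ) * _ = _
      by_cases hk : k = j
      · subst hk; simp only [if_true]; push_cast; ring
      · rw [if_neg hk, if_neg (Ne.symm hk)]; push_cast; ring
    rw [h2.unique h3, ee, lp.single_apply]
    by_cases hj : j = l
    · subst hj; simp
    · simp [hj]
  have hent : ∀ k l, ent B k l = ((g (l, k) : ℝ) : ℂ) := by
    intro k l
    have : B (ee l) = G l := by
      rw [← hAG l]
      exact congrArg (fun T : l2 →L[ℂ] l2 => T (G l)) hBA
    rw [ent, this, inner_ee]
  have hdet : (Matrix.of fun k l : Fin n => g ((l : ℕ), (k : ℕ))).det =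
      jacobiDet n (jacParam μ) := by
    have t1 := (tendsto_det_ratMat_out h0 h1 n).comp hφ.tendsto_atTop
    have t2 := ((Continuous.matrix_det (A := id) continuous_id).tendsto _).comp
      (f := fun M => Matrix.of fun k l : Fin n => ratSol (outX μ (φ M)) (outY μ (φ M)) l k)
      (tendsto_pi_nhds.2 fun k => tendsto_pi_nhds.2 fun l => hg l k)
    refine tendsto_nhds_unique (t2.congr fun M => ?_) t1
    exact det_ratSol_eq_det_ratMat n _ _
  rw [← hdet, detP]
  simp only [hent]
  exact (RingHom.map_det Complex.ofRealHom _).symm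

end

/-! ### Traces of powers of discretised convolution operators -/

/-- A mean over `{0, …, n-1}` as an integral over the unit interval. -/
lemma mean_eq_integral_floor {n : ℕ} (hn : 0 < n) (a : ℕ → ℝ) :
    1 / (n : ℝ) * ∑ l ∈ Finset.range n, a l = ∫ s in (0:ℝ)..1, a ⌊(n : ℝ) * s⌋₊ := by
  have hn' : (n : ℝ) ≠ 0 := by positivity
  rw [intervalIntegral.integral_comp_mul_left (fun t => a ⌊t⌋₊) hn', mul_zero, mul_one,
    smul_eq_mul, one_div]
  congr 1
  have hc : ∀ k : ℕ, ∀ t ∈ Set.Ico (k : ℝ) (k + 1), a ⌊t⌋₊ = a k := fun k t ht => by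
    rw [Nat.floor_eq_on_Ico k t ht]
  have hae : ∀ k : ℕ, ∀ᵐ t : ℝ, t ∈ Set.uIoc (k : ℝ) ((k + 1 : ℕ) : ℝ) → a ⌊t⌋₊ = a k := by
    intro k
    filter_upwards [Measure.ae_ne volume ((k : ℝ) + 1)] with t ht hk
    rw [Set.uIoc_of_le (by push_cast; linarith)] at hk
    push_cast at hk
    exact hc k t ⟨hk.1.le, lt_of_le_of_ne hk.2 ht⟩
  have hI : ∀ k : ℕ, IntervalIntegrable (fun t : ℝ => a ⌊t⌋₊) volume (k : ℝ) ((k + 1 : ℕ) : ℝ) := by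
    intro k
    refine (intervalIntegrable_const (c := a k)).congr_ae ?_
    rw [EventuallyEq, ae_restrict_iff' measurableSet_uIoc]
    filter_upwards [hae k] with t ht h
    exact (ht h).symm
  have := intervalIntegral.sum_integral_adjacent_intervals (μ := volume)
    (f := fun t : ℝ => a ⌊t⌋₊) (a := fun k : ℕ => (k : ℝ)) (n := n) (fun k _ => hI k)
  rw [Nat.cast_zero] at this
  rw [← this]
  refine Finset.sum_congr rfl fun k _ => ?_
  rw [intervalIntegral.integral_congr_ae (hae k)]
  simp

lemma tendsto_floor_mul_div (x : ℝ) (hx : 0 ≤ x) :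
    Tendsto (fun n : ℕ => (⌊(n : ℝ) * x⌋₊ : ℝ) / n) atTop (nhds x) := by
  have := (tendsto_nat_floor_mul_div_atTop hx).comp tendsto_natCast_atTop_atTop
  simpa [Function.comp_def, mul_comm] using this

/-- The matrix `(h((j-k)/n)/n)`. -/
def convMatrix (h : ℝ → ℝ) (n : ℕ) : Matrix (Fin n) (Fin n) ℝ :=
  Matrix.of fun j k => 1 / (n : ℝ) * h (((j : ℝ) - k) / n)

/-- The rescaled kernel of the powers of `convMatrix`. -/
def convKernel (h : ℝ → ℝ) (n : ℕ) : ℕ → ℕ → ℕ → ℝ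
  | 0, i, j => h (((i : ℝ) - j) / n)
  | k + 1, i, j => 1 / (n : ℝ) * ∑ l ∈ Finset.range n, h (((i : ℝ) - l) / n) * convKernel h n k l j

/-- The kernel of the powers of the convolution operator on the unit interval. -/
def convLimit (h : ℝ → ℝ) : ℕ → ℝ → ℝ → ℝ
  | 0, x, y => h (x - y)
  | k + 1, x, y => ∫ s in (0:ℝ)..1, h (x - s) * convLimit h k s y

lemma convMatrix_pow (h : ℝ → ℝ) (n k : ℕ) (i j : Fin n) :
    (convMatrix h n ^ (k + 1)) i j = 1 / (n : ℝ) * convKernel h n k i j := by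
  induction k generalizing i j with
  | zero => simp [convMatrix, convKernel]
  | succ k ih =>
    rw [pow_succ', Matrix.mul_apply]
    simp only [ih, convKernel]
    rw [← Fin.sum_univ_eq_sum_range (fun l => h (((i : ℝ) - l) / n) * convKernel h n k l j),
      Finset.mul_sum, Finset.mul_sum]
    refine Finset.sum_congr rfl fun l _ => ?_
    simp only [convMatrix, Matrix.of_apply]
    ring

lemma trace_convMatrix_pow (h : ℝ → ℝ) (n k : ℕ) :
    (convMatrix h n ^ (k + 1)).trace =
      1 / (n : ℝ) * ∑ i ∈ Finset.range n, convKernel h n k i i := by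
  rw [Matrix.trace, ← Fin.sum_univ_eq_sum_range (fun i => convKernel h n k i i), Finset.mul_sum]
  exact Finset.sum_congr rfl fun i _ => convMatrix_pow h n k i i

lemma abs_convKernel_le {h : ℝ → ℝ} {C : ℝ} (hC : ∀ u, |h u| ≤ C) (n k i j : ℕ) :
    |convKernel h n k i j| ≤ C ^ (k + 1) := by
  have hC0 : 0 ≤ C := (abs_nonneg _).trans (hC 0)
  induction k generalizing i j with
  | zero => simpa [convKernel] using hC _
  | succ k ih =>
    rw [convKernel, abs_mul, abs_of_nonneg (by positivity)]
    calc _ ≤ 1 / (n : ℝ) * ∑ l ∈ Finset.range n, C * C ^ (k + 1) := by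
          gcongr
          refine (Finset.abs_sum_le_sum_abs _ _).trans (Finset.sum_le_sum fun l _ => ?_)
          rw [abs_mul]
          gcongr
          exacts [hC _, ih _ _]
      _ = (n : ℝ) / n * C ^ (k + 1 + 1) := by
          rw [Finset.sum_const, Finset.card_range, nsmul_eq_mul]; ring
      _ ≤ _ := by
          have := div_self_le_one (n : ℝ)
          exact mul_le_of_le_one_left (by positivity) this

lemma tendsto_convKernel {h : ℝ → ℝ} (hh : Continuous h) {C : ℝ} (hC : ∀ u, |h u| ≤ C) (k : ℕ)
    (x y : ℝ) (hx : 0 ≤ x) (hy : 0 ≤ y) :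
    Tendsto (fun n : ℕ => convKernel h n k ⌊(n : ℝ) * x⌋₊ ⌊(n : ℝ) * y⌋₊) atTop
      (nhds (convLimit h k x y)) := by
  have hC0 : 0 ≤ C := (abs_nonneg _).trans (hC 0)
  have hlim : ∀ x y : ℝ, 0 ≤ x → 0 ≤ y →
      Tendsto (fun n : ℕ => h (((⌊(n : ℝ) * x⌋₊ : ℝ) - ⌊(n : ℝ) * y⌋₊) / n)) atTop
        (nhds (h (x - y))) := by
    intro x y hx hy
    refine (hh.tendsto _).comp ?_
    simp only [sub_div]
    exact (tendsto_floor_mul_div x hx).sub (tendsto_floor_mul_div y hy)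
  induction k generalizing x y with
  | zero => exact hlim x y hx hy
  | succ k ih =>
    have e : (fun n : ℕ => ∫ s in (0:ℝ)..1, h (((⌊(n : ℝ) * x⌋₊ : ℝ) - ⌊(n : ℝ) * s⌋₊) / n) *
        convKernel h n k ⌊(n : ℝ) * s⌋₊ ⌊(n : ℝ) * y⌋₊) =ᶠ[atTop]
        fun n : ℕ => convKernel h n (k + 1) ⌊(n : ℝ) * x⌋₊ ⌊(n : ℝ) * y⌋₊ := by
      filter_upwards [eventually_gt_atTop 0] with n hn
      rw [convKernel, mean_eq_integral_floor hn (fun l => h (((⌊(n : ℝ) * x⌋₊ : ℝ) - l) / n) *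
        convKernel h n k l ⌊(n : ℝ) * y⌋₊)]
    refine Tendsto.congr' e ?_
    rw [convLimit]
    refine intervalIntegral.tendsto_integral_filter_of_dominated_convergence
      (fun _ => C * C ^ (k + 1)) (Eventually.of_forall fun n => ?_)
      (Eventually.of_forall fun n => ?_) intervalIntegrable_const ?_
    · have : Measurable fun s : ℝ => ⌊(n : ℝ) * s⌋₊ := Nat.measurable_floor.comp (by fun_prop)
      exact ((measurable_from_nat (f := fun l : ℕ => h (((⌊(n : ℝ) * x⌋₊ : ℝ) - l) / n) *
        convKernel h n k l ⌊(n : ℝ) * y⌋₊)).comp this).aestronglyMeasurable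
    · refine Eventually.of_forall fun s _ => ?_
      rw [Real.norm_eq_abs, abs_mul]
      exact mul_le_mul (hC _) (abs_convKernel_le hC _ _ _ _) (abs_nonneg _) hC0
    · refine Eventually.of_forall fun s hs => ?_
      rw [Set.uIoc_of_le zero_le_one] at hs
      exact (hlim x s hx hs.1.le).mul (ih s y hs.1.le hy)

/-- The traces of the powers of `convMatrix h n` converge. -/
lemma exists_tendsto_trace_convMatrix_pow {h : ℝ → ℝ} (hh : Continuous h) {C : ℝ}
    (hC : ∀ u, |h u| ≤ C) (k : ℕ) :
    ∃ l, Tendsto (fun n : ℕ => (convMatrix h n ^ (k + 1)).trace) atTop (nhds l) := by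
  refine ⟨∫ s in (0:ℝ)..1, convLimit h k s s, ?_⟩
  have e : (fun n : ℕ => ∫ s in (0:ℝ)..1, convKernel h n k ⌊(n : ℝ) * s⌋₊ ⌊(n : ℝ) * s⌋₊)
      =ᶠ[atTop] fun n : ℕ => (convMatrix h n ^ (k + 1)).trace := by
    filter_upwards [eventually_gt_atTop 0] with n hn
    rw [trace_convMatrix_pow, mean_eq_integral_floor hn (fun l => convKernel h n k l l)]
  refine Tendsto.congr' e ?_
  refine intervalIntegral.tendsto_integral_filter_of_dominated_convergence
    (fun _ => C ^ (k + 1)) (Eventually.of_forall fun n => ?_)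
    (Eventually.of_forall fun n => ?_) intervalIntegrable_const ?_
  · have : Measurable fun s : ℝ => ⌊(n : ℝ) * s⌋₊ := Nat.measurable_floor.comp (by fun_prop)
    exact ((measurable_from_nat (f := fun l : ℕ => convKernel h n k l l)).comp
      this).aestronglyMeasurable
  · exact Eventually.of_forall fun s _ => abs_convKernel_le hC _ _ _ _
  · refine Eventually.of_forall fun s hs => ?_
    rw [Set.uIoc_of_le zero_le_one] at hs
    exact tendsto_convKernel hh hC k s s hs.1.le hs.1.le

/-- The eigenvalues of a symmetric real contraction. -/
lemma exists_eigenvalues {m : Type*} [Fintype m] [DecidableEq m] {K : Matrix m m ℝ}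
    (h0 : K.PosSemidef) (h1 : (1 - K).PosSemidef) :
    ∃ lam : m → ℝ, (∀ i, 0 ≤ lam i ∧ lam i ≤ 1) ∧ (∀ k : ℕ, (K ^ k).trace = ∑ i, lam i ^ k) ∧
      (1 - K).det = ∏ i, (1 - lam i) := by
  have hK := h0.1
  set U := hK.eigenvectorUnitary with hU
  have hs := hK.spectral_theorem
  rw [Unitary.conjStarAlgAut_apply] at hs
  set D : Matrix m m ℝ := Matrix.diagonal (RCLike.ofReal ∘ hK.eigenvalues) with hD
  have hU1 : (star (U : Matrix m m ℝ)) * (U : Matrix m m ℝ) = 1 := Unitary.coe_star_mul_self U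
  have hU2 : (U : Matrix m m ℝ) * star (U : Matrix m m ℝ) = 1 := Unitary.coe_mul_star_self U
  have hpow : ∀ k : ℕ, K ^ k = (U : Matrix m m ℝ) * D ^ k * star (U : Matrix m m ℝ) := by
    intro k
    induction k with
    | zero => simp [hU2]
    | succ k ih =>
      rw [pow_succ, ih]
      conv_lhs => rw [hs]
      rw [pow_succ]
      simp only [Matrix.mul_assoc]
      rw [← Matrix.mul_assoc (star (U : Matrix m m ℝ)) (U : Matrix m m ℝ), hU1, Matrix.one_mul]
  refine ⟨hK.eigenvalues, fun i => ⟨h0.eigenvalues_nonneg i, ?_⟩, fun k => ?_, ?_⟩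
  · have hv := hK.mulVec_eigenvectorBasis i
    have hq := h1.dotProduct_mulVec_nonneg (WithLp.ofLp (hK.eigenvectorBasis i))
    rw [Matrix.sub_mulVec, hv, Matrix.one_mulVec] at hq
    have hnorm : star (WithLp.ofLp (hK.eigenvectorBasis i)) ⬝ᵥ
        WithLp.ofLp (hK.eigenvectorBasis i) = 1 := by
      have := hK.eigenvectorBasis.orthonormal.1 i
      have h2 := EuclideanSpace.real_norm_sq_eq (hK.eigenvectorBasis i)
      rw [this] at h2
      simp only [dotProduct, star_trivial]
      rw [one_pow] at h2
      rw [h2]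
      exact Finset.sum_congr rfl fun j _ => by ring
    rw [dotProduct_sub, dotProduct_smul, hnorm] at hq
    simp only [smul_eq_mul, mul_one] at hq
    linarith
  · rw [hpow, Matrix.trace_mul_comm, ← Matrix.mul_assoc, hU1, Matrix.one_mul, hD,
      Matrix.diagonal_pow, Matrix.trace_diagonal]
    simp
  · have : 1 - K = (U : Matrix m m ℝ) * (1 - D) * star (U : Matrix m m ℝ) := by
      rw [Matrix.mul_sub, Matrix.sub_mul, ← hs, Matrix.mul_one, hU2]
    rw [this, Matrix.det_mul_comm, ← Matrix.mul_assoc, hU1, Matrix.one_mul, hD,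
      ← Matrix.diagonal_one, Matrix.diagonal_sub, Matrix.det_diagonal]
    simp

/-- The logarithm of `det (1 - K)` in terms of the traces of the powers of `K`. -/
lemma log_det_one_sub {m : Type*} [Fintype m] [DecidableEq m] {K : Matrix m m ℝ}
    (h0 : K.PosSemidef) (h1 : (1 - K).PosSemidef) {c : ℝ} (hc : 0 < c) (hdet : c ≤ (1 - K).det) :
    Real.log (1 - K).det = -∑' k : ℕ, (K ^ (k + 1)).trace / (k + 1) ∧
      ∀ k : ℕ, |(K ^ (k + 1)).trace / (k + 1)| ≤ K.trace * (1 - c) ^ k := by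
  obtain ⟨lam, hl, ht, hd⟩ := exists_eigenvalues h0 h1
  have hlc : ∀ i, lam i ≤ 1 - c := by
    intro i
    have : ∏ j, (1 - lam j) ≤ 1 - lam i := by
      rw [← Finset.mul_prod_erase _ _ (Finset.mem_univ i)]
      refine mul_le_of_le_one_right (by linarith [(hl i).2]) ?_
      exact Finset.prod_le_one (fun j _ => by linarith [(hl j).2]) fun j _ => by linarith [(hl j).1]
    linarith [hd ▸ hdet]
  constructor
  · rw [hd, Real.log_prod fun i _ => by linarith [hlc i]]
    have hs : ∀ i, HasSum (fun k : ℕ => lam i ^ (k + 1) / ((k : ℝ) + 1)) (-Real.log (1 - lam i)) :=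
      fun i => Real.hasSum_pow_div_log_of_abs_lt_one
        (by rw [abs_of_nonneg (hl i).1]; linarith [hlc i])
    have := hasSum_sum (s := Finset.univ) fun i _ => hs i
    simp only [ht, Finset.sum_div]
    rw [this.tsum_eq, Finset.sum_neg_distrib, neg_neg]
  · intro k
    have htr : K.trace = ∑ i, lam i := by simpa using ht 1
    rw [ht, htr, abs_of_nonneg (div_nonneg (Finset.sum_nonneg fun i _ => pow_nonneg (hl i).1 _)
      (by positivity)), Finset.sum_mul]
    refine (div_le_self (Finset.sum_nonneg fun i _ => pow_nonneg (hl i).1 _)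
      (by linarith [(Nat.cast_nonneg k : (0:ℝ) ≤ k)])).trans (Finset.sum_le_sum fun i _ => ?_)
    rw [pow_succ']
    exact mul_le_mul_of_nonneg_left (pow_le_pow_left₀ (hl i).1 (hlc i) k) (hl i).1

/-- Convergence of `det (1 - K_n)` for nonnegative contractions whose traces of powers converge,
provided the determinants stay away from zero. -/
lemma exists_tendsto_log_det {d : ℕ → ℕ} {K : ∀ n, Matrix (Fin (d n)) (Fin (d n)) ℝ} {c t : ℝ}
    (hc : 0 < c) (hK : ∀ᶠ n in atTop, (K n).PosSemidef ∧ (1 - K n).PosSemidef ∧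
      c ≤ (1 - K n).det ∧ (K n).trace ≤ t)
    (hlim : ∀ k : ℕ, ∃ l, Tendsto (fun n => (K n ^ (k + 1)).trace) atTop (nhds l)) :
    ∃ l, Tendsto (fun n => Real.log (1 - K n).det) atTop (nhds l) := by
  have hc1 : c ≤ 1 := by
    obtain ⟨n, h0, h1, hd, _⟩ := hK.exists
    obtain ⟨lam, hl, _, hp⟩ := exists_eigenvalues h0 h1
    rw [hp] at hd
    exact hd.trans (Finset.prod_le_one (fun j _ => by linarith [(hl j).2])
      fun j _ => by linarith [(hl j).1])
  choose l hl using hlim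
  refine ⟨-∑' k : ℕ, l k / (k + 1), ?_⟩
  have h : Tendsto (fun n => ∑' k : ℕ, (K n ^ (k + 1)).trace / ((k : ℝ) + 1)) atTop
      (nhds (∑' k : ℕ, l k / (k + 1))) := by
    refine tendsto_tsum_of_dominated_convergence (bound := fun k : ℕ => t * (1 - c) ^ k) ?_ ?_ ?_
    · exact (summable_geometric_of_lt_one (by linarith) (by linarith)).mul_left t
    · exact fun k => (hl k).div_const _
    · filter_upwards [hK] with n ⟨h0, h1, hd, ht⟩ k
      refine ((log_det_one_sub h0 h1 hc hd).2 k).trans ?_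
      exact mul_le_mul_of_nonneg_right ht (pow_nonneg (by linarith) k)
  refine h.neg.congr' ?_
  filter_upwards [hK] with n ⟨h0, h1, hd, _⟩
  exact ((log_det_one_sub h0 h1 hc hd).1).symm

/-! ### The arc determinant as a Toeplitz determinant -/

lemma continuous_cos_mul (m : ℝ) : Continuous fun φ : ℝ => Real.cos (m * φ) := by fun_prop

lemma integral_cos_int_mul (p : ℤ) :
    ∫ φ in (0:ℝ)..Real.pi, Real.cos (p * φ) = if p = 0 then Real.pi else 0 := by
  split_ifs with hp
  · simp [hp]
  · have hp' : (p : ℝ) ≠ 0 := by exact_mod_cast hp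
    rw [intervalIntegral.integral_comp_mul_left (fun x => Real.cos x) hp', integral_cos]
    simp [Real.sin_int_mul_pi]

lemma integral_arc_cos_odd (p : ℤ) (b : ℝ) :
    ∫ φ in b..(Real.pi - b), Real.cos (((2 * p + 1 : ℤ) : ℝ) * φ) = 0 := by
  have h := intervalIntegral.integral_comp_sub_left (a := b) (b := Real.pi - b)
    (fun φ => Real.cos (((2 * p + 1 : ℤ) : ℝ) * φ)) Real.pi
  rw [sub_sub_cancel] at h
  have e : ∀ φ : ℝ, Real.cos (((2 * p + 1 : ℤ) : ℝ) * (Real.pi - φ)) =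
      -Real.cos (((2 * p + 1 : ℤ) : ℝ) * φ) := by
    intro φ
    rw [show ((2 * p + 1 : ℤ) : ℝ) * (Real.pi - φ) =
      Real.pi - ((2 * p + 1 : ℤ) : ℝ) * φ + p * (2 * Real.pi) by push_cast; ring,
      Real.cos_add_int_mul_two_pi, Real.cos_pi_sub]
  simp only [e, intervalIntegral.integral_neg] at h
  linarith

lemma integral_arc_cos_even (p : ℤ) (b : ℝ) :
    ∫ φ in b..(Real.pi - b), Real.cos (((2 * p : ℤ) : ℝ) * φ) =
      (if p = 0 then Real.pi else 0) - ∫ φ in (0:ℝ)..(2 * b), Real.cos (p * φ) := by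
  have h := intervalIntegral.integral_comp_sub_left (a := 0) (b := b)
    (fun φ => Real.cos (((2 * p : ℤ) : ℝ) * φ)) Real.pi
  rw [sub_zero] at h
  have e : ∀ φ : ℝ, Real.cos (((2 * p : ℤ) : ℝ) * (Real.pi - φ)) =
      Real.cos (((2 * p : ℤ) : ℝ) * φ) := by
    intro φ
    rw [show ((2 * p : ℤ) : ℝ) * (Real.pi - φ) =
      -(((2 * p : ℤ) : ℝ) * φ) + p * (2 * Real.pi) by push_cast; ring,
      Real.cos_add_int_mul_two_pi, Real.cos_neg]
  simp only [e] at h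
  have hd : ∫ φ in (0:ℝ)..(2 * b), Real.cos (p * φ) =
      2 * ∫ φ in (0:ℝ)..b, Real.cos (((2 * p : ℤ) : ℝ) * φ) := by
    have := intervalIntegral.mul_integral_comp_mul_left (a := 0) (b := b)
      (f := fun φ => Real.cos (p * φ)) 2
    rw [mul_zero] at this
    rw [← this]
    congr 1
    apply intervalIntegral.integral_congr; intro φ _
    simp only
    congr 1
    push_cast
    ring
  have hI : ∀ x y : ℝ, IntervalIntegrable (fun φ : ℝ => Real.cos (((2 * p : ℤ) : ℝ) * φ))
      volume x y := fun x y => (continuous_cos_mul _).intervalIntegrable _ _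
  have h1 := intervalIntegral.integral_add_adjacent_intervals (hI 0 b) (hI b (Real.pi - b))
  have h2 := intervalIntegral.integral_add_adjacent_intervals (hI 0 (Real.pi - b))
    (hI (Real.pi - b) Real.pi)
  rw [integral_cos_int_mul (2 * p)] at h2
  simp only [mul_eq_zero, OfNat.ofNat_ne_zero, false_or] at h2
  linarith

/-- The sine-type convolution kernel. -/
def sineKernel (α u : ℝ) : ℝ := 1 / Real.pi * ∫ x in (0:ℝ)..α, Real.cos (u * x)

lemma sineKernel_scaled {n : ℕ} (hn : 0 < n) (α m : ℝ) :
    1 / (n : ℝ) * sineKernel α (m / n) =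
      1 / Real.pi * ∫ φ in (0:ℝ)..(α / n), Real.cos (m * φ) := by
  have hn' : (n : ℝ) ≠ 0 := by positivity
  have := intervalIntegral.mul_integral_comp_mul_left (a := 0) (b := α / n)
      (f := fun φ => Real.cos (m / n * φ)) n
  rw [mul_zero, mul_div_cancel₀ _ hn'] at this
  rw [sineKernel, ← this, mul_left_comm]
  congr 1
  rw [← mul_assoc, one_div_mul_cancel hn', one_mul]
  apply intervalIntegral.integral_congr; intro φ _
  simp only
  congr 1
  field_simp

lemma abs_sineKernel_le {α : ℝ} (hα : 0 < α) (u : ℝ) : |sineKernel α u| ≤ α / Real.pi := by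
  have h := intervalIntegral.norm_integral_le_of_norm_le_const (a := 0) (b := α)
    (f := fun x => Real.cos (u * x)) (C := 1) fun x _ => Real.abs_cos_le_one _
  rw [sub_zero, one_mul, abs_of_pos hα, Real.norm_eq_abs] at h
  rw [sineKernel, abs_mul, abs_of_pos (by have := Real.pi_pos; positivity), one_div_mul_eq_div]
  have := Real.pi_pos
  gcongr

lemma continuous_sineKernel (α : ℝ) : Continuous (sineKernel α) := by
  unfold sineKernel
  refine continuous_const.mul ?_
  exact intervalIntegral.continuous_parametric_intervalIntegral_of_continuous'
    (f := fun u x => Real.cos (u * x)) (by fun_prop) 0 α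

lemma sineKernel_zero (α : ℝ) : sineKernel α 0 = α / Real.pi := by
  simp [sineKernel]
  ring

/-- Toeplitz matrices of nonnegative symbols are positive semidefinite. -/
lemma posSemidef_integral_cos {n : ℕ} {a b : ℝ} (hab : a ≤ b) :
    (Matrix.of fun j k : Fin n =>
      1 / Real.pi * ∫ φ in a..b, Real.cos (((j : ℝ) - k) * φ)).PosSemidef := by
  refine Matrix.PosSemidef.of_dotProduct_mulVec_nonneg ?_ fun x => ?_
  · ext j k
    simp only [Matrix.conjTranspose_apply, Matrix.of_apply, star_trivial]
    congr 1
    apply intervalIntegral.integral_congr; intro φ _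
    simp only
    rw [← Real.cos_neg]
    ring_nf
  · have e : star x ⬝ᵥ (Matrix.of fun j k : Fin n =>
        1 / Real.pi * ∫ φ in a..b, Real.cos (((j : ℝ) - k) * φ)).mulVec x =
        1 / Real.pi * ∫ φ in a..b, ((∑ j : Fin n, x j * Real.cos (j * φ)) ^ 2 +
          (∑ j : Fin n, x j * Real.sin (j * φ)) ^ 2) := by
      simp only [dotProduct, Matrix.mulVec, Matrix.of_apply, star_trivial]
      have e1 : ∀ φ : ℝ, ((∑ j : Fin n, x j * Real.cos (j * φ)) ^ 2 +
          (∑ j : Fin n, x j * Real.sin (j * φ)) ^ 2) =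
          ∑ j : Fin n, ∑ k : Fin n, x j * x k * Real.cos (((j : ℝ) - k) * φ) := by
        intro φ
        rw [sq, sq, Finset.sum_mul_sum, Finset.sum_mul_sum, ← Finset.sum_add_distrib]
        refine Finset.sum_congr rfl fun j _ => ?_
        rw [← Finset.sum_add_distrib]
        refine Finset.sum_congr rfl fun k _ => ?_
        rw [sub_mul, Real.cos_sub]
        ring
      simp only [e1]
      rw [intervalIntegral.integral_finsetSum fun j _ =>
        (Continuous.intervalIntegrable (by fun_prop) _ _), Finset.mul_sum]
      refine Finset.sum_congr rfl fun j _ => ?_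
      rw [intervalIntegral.integral_finsetSum fun k _ =>
        (Continuous.intervalIntegrable (by fun_prop) _ _), Finset.mul_sum, Finset.mul_sum]
      refine Finset.sum_congr rfl fun k _ => ?_
      rw [intervalIntegral.integral_const_mul]
      ring
    rw [e]
    have := Real.pi_pos
    refine mul_nonneg (by positivity) (intervalIntegral.integral_nonneg hab fun φ _ => by positivity)

lemma convMatrix_sineKernel {n : ℕ} (α : ℝ) :
    convMatrix (sineKernel α) n = Matrix.of fun j k : Fin n =>
      1 / Real.pi * ∫ φ in (0:ℝ)..(α / n), Real.cos (((j : ℝ) - k) * φ) := by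
  ext j k
  exact sineKernel_scaled (Fin.pos j) α _

lemma posSemidef_convMatrix {n : ℕ} {α : ℝ} (hα : 0 < α) (hn : α / Real.pi < n) :
    (convMatrix (sineKernel α) n).PosSemidef ∧ (1 - convMatrix (sineKernel α) n).PosSemidef := by
  have hpi := Real.pi_pos
  have hn0 : (0 : ℝ) < n := lt_trans (by positivity) hn
  refine ⟨by rw [convMatrix_sineKernel]; exact posSemidef_integral_cos (by positivity), ?_⟩
  have e : 1 - convMatrix (sineKernel α) n = Matrix.of fun j k : Fin n =>
      1 / Real.pi * ∫ φ in (α / n)..Real.pi, Real.cos (((j : ℝ) - k) * φ) := by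
    rw [convMatrix_sineKernel]
    ext j k
    have hI : ∀ x y : ℝ, IntervalIntegrable (fun φ : ℝ => Real.cos (((j : ℝ) - k) * φ))
      volume x y := fun x y => (continuous_cos_mul _).intervalIntegrable _ _
    have h1 := intervalIntegral.integral_add_adjacent_intervals (hI 0 (α / n)) (hI (α / n) Real.pi)
    have h2 := integral_cos_int_mul ((j : ℤ) - k)
    push_cast at h2
    rw [h2] at h1
    simp only [Matrix.sub_apply, Matrix.of_apply, Matrix.one_apply]
    rw [sub_eq_iff_eq_add, ← mul_add, add_comm, h1]
    have : ((j : ℕ) : ℤ) - (k : ℕ) = 0 ↔ j = k := by rw [Fin.ext_iff]; omega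
    simp only [this]
    split_ifs <;> field_simp
    simp
  rw [e]
  refine posSemidef_integral_cos ?_
  rw [div_le_iff₀ hn0]
  rw [div_lt_iff₀ hpi] at hn
  linarith

lemma trace_convMatrix_sineKernel {n : ℕ} (hn : 0 < n) (α : ℝ) :
    (convMatrix (sineKernel α) n).trace = α / Real.pi := by
  simp only [Matrix.trace, Matrix.diag, convMatrix, Matrix.of_apply, sub_self, zero_div,
    sineKernel_zero, Finset.sum_const, Finset.card_univ, Fintype.card_fin, nsmul_eq_mul]
  have hn' : (n : ℝ) ≠ 0 := by positivity
  field_simp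

/-- The zigzag permutation, which orders the indices by parity and size. -/
def zigzag (n : ℕ) (j : Fin n) : Fin n :=
  ⟨if (j : ℕ) % 2 = 0 then n / 2 + j / 2 else n / 2 - (j + 1) / 2, by split_ifs <;> omega⟩

lemma zigzag_injective (n : ℕ) : Function.Injective (zigzag n) := by
  intro j k h
  simp only [zigzag, Fin.ext_iff] at h ⊢
  split_ifs at h <;> omega

lemma arcDet_eq_det_convMatrix {n : ℕ} (hn : 0 < n) (α : ℝ) :
    arcDet n (α / (2 * n)) = (1 - convMatrix (sineKernel α) n).det := by
  set e : Fin n ≃ Fin n := Equiv.ofBijective (zigzag n)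
    ((Finite.injective_iff_bijective).1 (zigzag_injective n)) with he
  rw [← Matrix.det_submatrix_equiv_self e, arcDet, convMatrix_sineKernel]
  congr 1
  ext j k
  have hpi := Real.pi_pos
  have hn' : (n : ℝ) ≠ 0 := by positivity
  have hI : ∀ m x y : ℝ, IntervalIntegrable (fun φ : ℝ => Real.cos (m * φ))
    volume x y := fun m x y => (continuous_cos_mul _).intervalIntegrable _ _
  have hb : 2 * (α / (2 * n)) = α / n := by field_simp
  simp only [Matrix.of_apply, Matrix.submatrix_apply, Matrix.sub_apply, Matrix.one_apply,
    e.injective.eq_iff]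
  rw [intervalIntegral.integral_add (hI _ _ _) (hI _ _ _)]
  have hej : ((e j : ℕ)) = if (j : ℕ) % 2 = 0 then n / 2 + (j : ℕ) / 2
    else n / 2 - ((j : ℕ) + 1) / 2 := rfl
  have hek : ((e k : ℕ)) = if (k : ℕ) % 2 = 0 then n / 2 + (k : ℕ) / 2
    else n / 2 - ((k : ℕ) + 1) / 2 := rfl
  have hjn := j.2
  have hkn := k.2
  have main : ∀ p q : ℤ, ∀ s : ℤ, (s = 1 ∨ s = -1) → ((e j : ℕ) : ℤ) - (e k : ℕ) = s * p →
      ∀ m : ℝ, m = ((2 * p : ℤ) : ℝ) → ∀ m' : ℝ, m' = ((2 * q + 1 : ℤ) : ℝ) →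
      (p = 0 ↔ j = k) →
      1 / Real.pi * ((∫ φ in (α / (2 * n))..(Real.pi - α / (2 * n)), Real.cos (m * φ)) +
        ∫ φ in (α / (2 * n))..(Real.pi - α / (2 * n)), Real.cos (m' * φ)) =
      (if j = k then 1 else 0) - 1 / Real.pi *
        ∫ φ in (0:ℝ)..(α / n), Real.cos ((((e j : ℕ) : ℝ) - (e k : ℕ)) * φ) := by
    intro p q s hs hd m hm m' hm' hp
    have hd' : ((e j : ℕ) : ℝ) - (e k : ℕ) = s * p := by exact_mod_cast congrArg (Int.cast (R := ℝ)) hd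
    rw [hm, hm', integral_arc_cos_even, integral_arc_cos_odd, hb, add_zero, hd', mul_sub]
    congr 1
    · simp only [hp]
      split_ifs <;> field_simp
      simp
    · congr 1
      apply intervalIntegral.integral_congr; intro φ _
      rcases hs with rfl | rfl
      · simp
      · simp
  rcases Nat.mod_two_eq_zero_or_one (j : ℕ) with hj | hj <;>
    rcases Nat.mod_two_eq_zero_or_one (k : ℕ) with hk | hk
  · rw [if_pos hj] at hej
    rw [if_pos hk] at hek
    refine main ((j : ℕ) / 2 - (k : ℕ) / 2 : ℤ) ((j : ℕ) / 2 + (k : ℕ) / 2 : ℤ) 1 (Or.inl rfl)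
      (by omega) _ ?_ _ ?_ (by rw [Fin.ext_iff]; omega)
    · rw [show (2 * ((j : ℕ) / 2 - (k : ℕ) / 2) : ℤ) = (j : ℕ) - (k : ℕ) by omega]; push_cast; ring
    · rw [show (2 * ((j : ℕ) / 2 + (k : ℕ) / 2) + 1 : ℤ) = (j : ℕ) + (k : ℕ) + 1 by omega]
      push_cast; ring
  · rw [if_pos hj] at hej
    rw [if_neg (by omega)] at hek
    rw [add_comm (intervalIntegral _ _ _ _)]
    refine main ((j : ℕ) / 2 + ((k : ℕ) + 1) / 2 : ℤ) ((j : ℕ) / 2 - ((k : ℕ) + 1) / 2 : ℤ) 1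
      (Or.inl rfl) (by omega) _ ?_ _ ?_ (by rw [Fin.ext_iff]; omega)
    · rw [show (2 * ((j : ℕ) / 2 + ((k : ℕ) + 1) / 2) : ℤ) = (j : ℕ) + (k : ℕ) + 1 by omega]
      push_cast; ring
    · rw [show (2 * ((j : ℕ) / 2 - ((k : ℕ) + 1) / 2) + 1 : ℤ) = (j : ℕ) - (k : ℕ) by omega]
      push_cast; ring
  · rw [if_neg (by omega)] at hej
    rw [if_pos hk] at hek
    rw [add_comm (intervalIntegral _ _ _ _)]
    refine main (((j : ℕ) + 1) / 2 + (k : ℕ) / 2 : ℤ) (((j : ℕ) - 1) / 2 - (k : ℕ) / 2 : ℤ) (-1)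
      (Or.inr rfl) (by omega) _ ?_ _ ?_ (by rw [Fin.ext_iff]; omega)
    · rw [show (2 * (((j : ℕ) + 1) / 2 + (k : ℕ) / 2) : ℤ) = (j : ℕ) + (k : ℕ) + 1 by omega]
      push_cast; ring
    · rw [show (2 * (((j : ℕ) - 1) / 2 - (k : ℕ) / 2) + 1 : ℤ) = (j : ℕ) - (k : ℕ) by omega]
      push_cast; ring
  · rw [if_neg (by omega)] at hej
    rw [if_neg (by omega)] at hek
    refine main (((j : ℕ) + 1) / 2 - ((k : ℕ) + 1) / 2 : ℤ) (((j : ℕ) + (k : ℕ)) / 2 : ℤ) (-1)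
      (Or.inr rfl) (by omega) _ ?_ _ ?_ (by rw [Fin.ext_iff]; omega)
    · rw [show (2 * (((j : ℕ) + 1) / 2 - ((k : ℕ) + 1) / 2) : ℤ) = (j : ℕ) - (k : ℕ) by omega]
      push_cast; ring
    · rw [show (2 * (((j : ℕ) + (k : ℕ)) / 2) + 1 : ℤ) = (j : ℕ) + (k : ℕ) + 1 by omega]
      push_cast; ring

/-! ### The limit for fixed `α` -/

lemma tendsto_sinc_div (c : ℝ) : Tendsto (fun x : ℝ => Real.sinc (c / x)) atTop (nhds 1) := by
  have := (Real.continuous_sinc.tendsto 0).comp (tendsto_const_nhds.div_atTop tendsto_id (a := c))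
  simpa [Function.comp_def] using this

lemma tendsto_mul_sin_div {c : ℝ} (hc : c ≠ 0) :
    Tendsto (fun x : ℝ => x * Real.sin (c / x)) atTop (nhds c) := by
  have := (tendsto_sinc_div c).const_mul c
  rw [mul_one] at this
  refine this.congr' ?_
  filter_upwards [eventually_gt_atTop 0] with x hx
  rw [Real.sinc_of_ne_zero (div_ne_zero hc hx.ne')]
  field_simp

lemma tendsto_sq_mul_log_cos {c : ℝ} (hc : c ≠ 0) :
    Tendsto (fun n : ℕ => (n : ℝ) ^ 2 * Real.log (Real.cos (c / n))) atTop
      (nhds (-(c ^ 2 / 2))) := by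
  have h1 : Tendsto (fun x : ℝ => x * (Real.cos (c / √x) - 1)) atTop (nhds (-(c ^ 2 / 2))) := by
    have h := (((tendsto_mul_sin_div (div_ne_zero hc two_ne_zero)).comp
      Real.tendsto_sqrt_atTop).pow 2).const_mul (-2)
    rw [show -2 * (c / 2) ^ 2 = -(c ^ 2 / 2) by ring] at h
    refine h.congr' ?_
    filter_upwards [eventually_ge_atTop 0] with x hx
    simp only [Function.comp]
    rw [show c / √x = 2 * (c / 2 / √x) by ring, Real.cos_two_mul, Real.cos_sq', mul_pow,
      Real.sq_sqrt hx]
    ring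
  have h2 := (Real.tendsto_mul_log_one_add_of_tendsto h1).comp
    ((tendsto_pow_atTop two_ne_zero).comp (tendsto_natCast_atTop_atTop (R := ℝ)))
  refine h2.congr fun n => ?_
  simp only [Function.comp]
  rw [Real.sqrt_sq (Nat.cast_nonneg n), add_sub_cancel]

/-- The parameter `μ` attached to the angle `b`. -/
def angleParam (b : ℝ) : ℝ := (1 - Real.sin b) / Real.cos b

lemma angleParam_spec {b : ℝ} (h0 : 0 < b) (h1 : b < Real.pi / 2) :
    0 < angleParam b ∧ angleParam b < 1 ∧ jacParam (angleParam b) = Real.cos b ∧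
      (1 + angleParam b ^ 2) / (1 - angleParam b ^ 2) = 1 / Real.sin b ∧
      b / Real.pi ≤ 1 - angleParam b := by
  have hc : 0 < Real.cos b := Real.cos_pos_of_mem_Ioo ⟨by linarith, h1⟩
  have hs : 0 < Real.sin b := Real.sin_pos_of_pos_of_lt_pi h0 (by linarith)
  have hsc := Real.sin_sq_add_cos_sq b
  have hs1 : Real.sin b < 1 := by nlinarith
  have hsum : 1 < Real.sin b + Real.cos b := by nlinarith
  set s := Real.sin b
  set c := Real.cos b
  have hm0 : 0 < angleParam b := div_pos (by linarith) hc
  have hm1 : angleParam b < 1 := (div_lt_one hc).2 (by linarith)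
  have hm : angleParam b * c = 1 - s := div_mul_cancel₀ _ hc.ne'
  have hsq : angleParam b ^ 2 * (1 + s) = 1 - s := by
    have h3 : angleParam b ^ 2 * (1 + s) * (1 - s) = (1 - s) * (1 - s) := by
      rw [← hm]
      have : (1 + s) * (1 - s) = c * c := by nlinarith
      rw [mul_assoc, ← hm] at *
      linear_combination (angleParam b ^ 2) * this
    exact mul_right_cancel₀ (by linarith : (1 - s) ≠ 0) h3
  set m := angleParam b
  have hk : 1 + m ^ 2 ≠ 0 := by positivity
  have hk2 : 0 < 1 - m ^ 2 := by nlinarith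
  refine ⟨hm0, hm1, ?_, ?_, ?_⟩
  · rw [jacParam, div_eq_iff hk]
    have h3 : (2 * m - c * (1 + m ^ 2)) * (1 + s) = 0 := by
      have : c * (m * c) = c * (1 - s) := by rw [hm]
      have e : m * (1 + s) = c := by
        have : (m * (1 + s) - c) * c = 0 := by
          linear_combination (1 + s) * hm - hsc
        rcases mul_eq_zero.1 this with h | h
        · linarith
        · exact absurd h hc.ne'
      linear_combination 2 * e - c * hsq
    rcases mul_eq_zero.1 h3 with h | h
    · linarith
    · linarith
  · rw [div_eq_div_iff hk2.ne' hs.ne']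
    linear_combination hsq
  · have hj := Real.mul_le_sin h0.le h1.le
    have e : s * (1 + m ^ 2) = 1 - m ^ 2 := by linear_combination hsq
    have h4 : s ≤ 2 * (1 - m) := by nlinarith
    have : 2 / Real.pi * b = 2 * (b / Real.pi) := by ring
    linarith

lemma angle_mem {α : ℝ} (hα : 0 < α) {n : ℕ} (hn : α / Real.pi < n) :
    0 < n ∧ 0 < α / (2 * n) ∧ α / (2 * n) < Real.pi / 2 := by
  have hpi := Real.pi_pos
  have hn0 : (0 : ℝ) < n := lt_trans (by positivity) hn
  refine ⟨by exact_mod_cast hn0, by positivity, ?_⟩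
  rw [div_lt_iff₀ hpi] at hn
  rw [div_lt_div_iff₀ (by positivity) two_pos]
  linarith

lemma eventually_angle (α : ℝ) : ∀ᶠ n : ℕ in atTop, α / Real.pi < n :=
  tendsto_natCast_atTop_atTop.eventually_gt_atTop _

lemma abs_log_jacobiDet_cos_le {α : ℝ} (hα : 0 < α) {n : ℕ} (hn : α / Real.pi < n) :
    0 < jacobiDet n (Real.cos (α / (2 * n))) ∧
      |Real.log (jacobiDet n (Real.cos (α / (2 * n)))) -
        (logLegendre n - 1 / 4 * Real.log (Real.sin (α / (2 * n))))| ≤ 32 * Real.pi / α := by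
  have hpi := Real.pi_pos
  obtain ⟨hn0, hb0, hb1⟩ := angle_mem hα hn
  obtain ⟨h0, h1, hj, hr, hle⟩ := angleParam_spec hb0 hb1
  have hn0' : (0 : ℝ) < n := by exact_mod_cast hn0
  obtain ⟨hpos, h⟩ := abs_log_jacobiDet_sub_le h0 h1 n
  rw [hj] at hpos h
  refine ⟨hpos, ?_⟩
  rw [hr, one_div (Real.sin _), Real.log_inv, (jacobiDet_zero n).2] at h
  refine le_trans (le_of_eq (by congr 1; ring)) (h.trans ?_)
  rw [div_le_div_iff₀ (mul_pos (by linarith) (by linarith)) hα]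
  have e : α / (2 * n) / Real.pi * n = α / (2 * Real.pi) := by field_simp
  have h3 : α / (2 * Real.pi) ≤ (1 - angleParam (α / (2 * n))) * (n + 1) := by
    rw [← e]
    exact mul_le_mul hle (by linarith) hn0'.le (by linarith)
  have h4 : 32 * Real.pi * (α / (2 * Real.pi)) = 16 * α := by field_simp; ring
  rw [← h4]
  gcongr

lemma tendsto_logLegendre_sub {α : ℝ} (hα : 0 < α) :
    Tendsto (fun n : ℕ => logLegendre n - 1 / 4 * Real.log (Real.sin (α / (2 * n)))) atTop
      (nhds (Real.log 2 / 12 + 3 * (deriv riemannZeta (-1)).re - 1 / 4 * Real.log (α / 2))) := by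
  have h1 := (((tendsto_mul_sin_div (c := α / 2) (by positivity)).comp
    (tendsto_natCast_atTop_atTop (R := ℝ))).log (by positivity)).const_mul (1 / 4)
  refine (tendsto_logLegendre.sub h1).congr' ?_
  filter_upwards [eventually_angle α] with n hn
  obtain ⟨hn0, hb0, hb1⟩ := angle_mem hα hn
  have hn0' : (0 : ℝ) < n := by exact_mod_cast hn0
  have hs : 0 < Real.sin (α / (2 * n)) := Real.sin_pos_of_pos_of_lt_pi hb0
    (by linarith [Real.pi_pos])
  simp only [Function.comp]
  rw [div_div, Real.log_mul hn0'.ne' hs.ne']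
  ring

/-- Existence of the limit of the determinants for fixed `α`, with an estimate for large `α`. -/
lemma exists_tendsto_log_jacobiDet {α : ℝ} (hα : 0 < α) :
    ∃ l : ℝ, Tendsto (fun n : ℕ => Real.log (jacobiDet n (Real.cos (α / (2 * n))))) atTop (nhds l) ∧
      |l - (Real.log 2 / 12 + 3 * (deriv riemannZeta (-1)).re - 1 / 4 * Real.log (α / 2))| ≤
        32 * Real.pi / α := by
  have hF := tendsto_logLegendre_sub hα
  set F := Real.log 2 / 12 + 3 * (deriv riemannZeta (-1)).re - 1 / 4 * Real.log (α / 2)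
  have hG := tendsto_sq_mul_log_cos (c := α / 2) (by positivity)
  simp only [div_div] at hG
  set G := -((α / 2) ^ 2 / 2)
  have hdet : ∀ n : ℕ, α / Real.pi < n → 0 < (1 - convMatrix (sineKernel α) n).det ∧
      Real.log (1 - convMatrix (sineKernel α) n).det =
        (n : ℝ) ^ 2 * Real.log (Real.cos (α / (2 * n))) +
        Real.log (jacobiDet n (Real.cos (α / (2 * n)))) := by
    intro n hn
    obtain ⟨hn0, hb0, hb1⟩ := angle_mem hα hn
    have hc : 0 < Real.cos (α / (2 * n)) := Real.cos_pos_of_mem_Ioo ⟨by linarith, hb1⟩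
    have hJ := (abs_log_jacobiDet_cos_le hα hn).1
    rw [← arcDet_eq_det_convMatrix hn0, arcDet_eq hb0 hb1]
    refine ⟨by positivity, ?_⟩
    rw [Real.log_mul (by positivity) hJ.ne', Real.log_pow]
    push_cast
    rfl
  obtain ⟨l, hl⟩ := exists_tendsto_log_det (d := fun n => n)
    (K := fun n => convMatrix (sineKernel α) n)
    (c := Real.exp (G - 1 + (F - 1 - 32 * Real.pi / α))) (t := α / Real.pi)
    (Real.exp_pos _) (by
      filter_upwards [eventually_angle α, hF.eventually_const_lt (sub_one_lt F),
        hG.eventually_const_lt (sub_one_lt G)] with n hn h1 h2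
      obtain ⟨hp, hp'⟩ := posSemidef_convMatrix hα hn
      obtain ⟨hd, hd'⟩ := hdet n hn
      refine ⟨hp, hp', ?_, (trace_convMatrix_sineKernel (angle_mem hα hn).1 α).le⟩
      rw [← Real.le_log_iff_exp_le hd, hd']
      have := (abs_le.1 (abs_log_jacobiDet_cos_le hα hn).2).1
      linarith)
    (exists_tendsto_trace_convMatrix_pow (continuous_sineKernel α) (abs_sineKernel_le hα))
  have hJ : Tendsto (fun n : ℕ => Real.log (jacobiDet n (Real.cos (α / (2 * n))))) atTop
      (nhds (l - G)) := by
    refine (hl.sub hG).congr' ?_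
    filter_upwards [eventually_angle α] with n hn
    rw [(hdet n hn).2]
    ring
  refine ⟨l - G, hJ, le_of_tendsto (hJ.sub hF).abs ?_⟩
  filter_upwards [eventually_angle α] with n hn
  exact (abs_log_jacobiDet_cos_le hα hn).2

/-- For each `α > 0` the limit `L(α) = lim_{n→∞} det[Pₙ (I + H(ψ_{α,n}))⁻¹ Pₙ]` exists
and is a positive real number, and
`log L(2α) + (log α)/4 → (log 2)/12 + 3ζ′(−1)` as `α → ∞`.  Here `A α n = I + H(ψ_{α,n})`
and `B α n` is its inverse. -/
theorem stmt18
    (μ : ℝ → ℕ → ℝ)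
    (hμ : ∀ (α : ℝ) (n : ℕ), μ α n = (1 - Real.sin (α / (2 * n))) / Real.cos (α / (2 * n)))
    (ψ : ℝ → ℕ → ℝ → ℂ)
    (hψ : ∀ (α : ℝ), 0 < α → ∀ n : ℕ, α / Real.pi < n → ∀ θ : ℝ, ψ α n θ =
      Complex.exp ((1 / 2 : ℂ) * Complex.log
          ((1 + μ α n * Complex.exp (-(Complex.I * θ))) /
            (1 - μ α n * Complex.exp (-(Complex.I * θ))))) *
        (Complex.exp ((1 / 2 : ℂ) * Complex.log
          ((1 + μ α n * Complex.exp (Complex.I * θ)) /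
            (1 - μ α n * Complex.exp (Complex.I * θ)))))⁻¹ * chi θ)
    (A B : ℝ → ℕ → l2 →L[ℂ] l2)
    (hA : ∀ (α : ℝ), 0 < α → ∀ n : ℕ, α / Real.pi < n → ∀ j k : ℕ,
      ent (A α n) j k = (if j = k then 1 else 0) + fc (ψ α n) ((j : ℤ) + k + 1))
    (hinv : ∀ (α : ℝ), 0 < α → ∀ n : ℕ, α / Real.pi < n →
      A α n ∘L B α n = 1 ∧ B α n ∘L A α n = 1) :
    ∃ L : ℝ → ℝ,
      (∀ α : ℝ, 0 < α → 0 < L α ∧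
        Tendsto (fun n : ℕ => detP n (B α n)) atTop (nhds ((L α : ℝ) : ℂ))) ∧
      Tendsto (fun α : ℝ => Real.log (L (2 * α)) + Real.log α / 4) atTop
        (nhds (Real.log 2 / 12 + 3 * (deriv riemannZeta (-1)).re)) := by
  choose! l hl hle using fun (α : ℝ) (hα : 0 < α) => exists_tendsto_log_jacobiDet hα
  refine ⟨fun α => Real.exp (l α), fun α hα => ⟨Real.exp_pos _, ?_⟩, ?_⟩
  · have h := (Complex.continuous_ofReal.tendsto _).comp
      ((Real.continuous_exp.tendsto _).comp (hl α hα))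
    refine h.congr' ?_
    filter_upwards [eventually_angle α] with n hn
    obtain ⟨_, hb0, hb1⟩ := angle_mem hα hn
    obtain ⟨h0, h1, hj, _, _⟩ := angleParam_spec hb0 hb1
    have hψ' : ψ α n = psiSym (angleParam (α / (2 * n))) := by
      funext θ
      rw [hψ α hα n hn θ, hμ α n]
      rfl
    have hA' := hA α hα n hn
    rw [hψ'] at hA'
    rw [detP_eq_jacobiDet h0 h1 hA' (hinv α hα n hn).2, hj]
    simp only [Function.comp]
    rw [Real.exp_log (abs_log_jacobiDet_cos_le hα hn).1]
  · rw [tendsto_iff_dist_tendsto_zero]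
    have hz : Tendsto (fun α : ℝ => 32 * Real.pi / (2 * α)) atTop (nhds 0) :=
      tendsto_const_nhds.div_atTop (tendsto_id.const_mul_atTop two_pos)
    refine squeeze_zero' (Eventually.of_forall fun _ => dist_nonneg) ?_ hz
    filter_upwards [eventually_gt_atTop 0] with α hα
    have h := hle (2 * α) (by positivity)
    rw [Real.dist_eq, Real.log_exp]
    refine le_trans (le_of_eq ?_) h
    rw [mul_div_cancel_left₀ α two_ne_zero]
    congr 1
    ring

end
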